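/- arXiv:math/0610604 — 2 statements merged into one kernel-verified Lean document; each statement's English description precedes it below -/
import Mathlib

section
/- Let $\alpha_1, \ldots, \alpha_d$ be real numbers and $N \ge 1$ an integer. Then there exists an integer $n$ with $1 \le n \le N$ such that $\|n^2 \alpha_j\|_{\mathbb{R}/\mathbb{Z}} \le C d N^{-c/d^2}$ for all $j = 1, \ldots, d$, where $c, C > 0$ are absolute constants. -/
/-- The distance from a real number to the nearest integer. -/
noncomputable def distToInt (x : ℝ) : ℝ := |x - round x|

lemma distToInt_nonneg (x : ℝ) : 0 ≤ distToInt x := abs_nonneg _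

lemma distToInt_le_abs_sub_intCast (x : ℝ) (m : ℤ) : distToInt x ≤ |x - m| := round_le x m

lemma distToInt_le_half (x : ℝ) : distToInt x ≤ 1 / 2 := abs_sub_round x

lemma distToInt_sub_le (x y : ℝ) : distToInt (x - y) ≤ distToInt x + distToInt y := by
  refine (distToInt_le_abs_sub_intCast _ (round x - round y)).trans ?_
  have h : x - y - ((round x - round y : ℤ) : ℝ) = (x - round x) - (y - round y) := by
    push_cast; ring
  rw [h]
  exact abs_sub _ _

lemma distToInt_add_intCast_of_abs_lt_half {x : ℝ} (hx : |x| < 1 / 2) (m : ℤ) :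
    distToInt (m + x) = |x| := by
  have h : round ((m : ℝ) + x) = m := by
    rw [round_intCast_add, (round_eq_zero_iff).2, add_zero]
    rw [abs_lt] at hx
    exact ⟨by linarith, by linarith⟩
  rw [distToInt, h, add_sub_cancel_left]

lemma distToInt_intCast_mul_le (m : ℤ) (x : ℝ) : distToInt (m * x) ≤ |(m : ℝ)| * distToInt x := by
  refine (distToInt_le_abs_sub_intCast _ (m * round x)).trans (le_of_eq ?_)
  rw [distToInt, ← abs_mul]
  push_cast
  ring_nf

lemma distToInt_sum_le {ι : Type*} (s : Finset ι) (f : ι → ℝ) :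
    distToInt (∑ i ∈ s, f i) ≤ ∑ i ∈ s, distToInt (f i) := by
  refine (distToInt_le_abs_sub_intCast _ (∑ i ∈ s, round (f i))).trans ?_
  push_cast
  rw [← Finset.sum_sub_distrib]
  exact Finset.abs_sum_le_sum_abs _ _

/-- A dense set of integers whose differences are all almost multiples of the period `ψ⁻¹` forces
a very good rational approximation to `ψ` with small denominator. -/
lemma exists_small_denominator {D L : ℕ} (hD : 0 < D) (hL : 20 * D ^ 3 ≤ L) {ψ : ℝ}
    {H : Finset ℕ} (hHL : ∀ h ∈ H, h < L) (hcard : L ≤ D * H.card)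
    (hψ : ∀ h ∈ H, ∀ h' ∈ H, distToInt (((h : ℝ) - h') * ψ) ≤ D / L) :
    ∃ q : ℕ, 0 < q ∧ q ≤ 2 * D ∧ distToInt (q * ψ) ≤ 80 * D ^ 5 / L ^ 2 := by
  have hD1 : 1 ≤ D ^ 2 := Nat.one_le_pow _ _ hD
  have hDL : 20 * D ≤ L := by nlinarith
  have hLpos : 0 < L := by omega
  have hLr : (0 : ℝ) < L := by exact_mod_cast hLpos
  have hDr : (1 : ℝ) ≤ D := by exact_mod_cast hD
  -- two elements in a common short block
  obtain ⟨q, hq0, hq2, hqψ⟩ : ∃ q : ℕ, 0 < q ∧ q ≤ 2 * D ∧ distToInt (q * ψ) ≤ D / L := by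
    obtain ⟨x, hx, y, hy, hxy, hb⟩ : ∃ x ∈ H, ∃ y ∈ H, x ≠ y ∧ x / (2 * D) = y / (2 * D) := by
      apply Finset.exists_ne_map_eq_of_card_lt_of_maps_to (t := Finset.range (L / (2 * D) + 1))
      · rw [Finset.card_range]
        have h1 : 2 * D * (L / (2 * D)) ≤ L := Nat.mul_div_le _ _
        have h2 : D * (2 * (L / (2 * D) + 1)) < D * (2 * H.card) := by nlinarith
        have := Nat.lt_of_mul_lt_mul_left h2
        omega
      · intro h hh
        simp only [Finset.coe_range, Set.mem_Iio]
        exact Nat.lt_succ_of_le (Nat.div_le_div_right (hHL h hh).le)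
    wlog hlt : y < x generalizing x y
    · exact this y hy x hx hxy.symm hb.symm (by omega)
    refine ⟨x - y, by omega, ?_, ?_⟩
    · have h1 := Nat.div_add_mod x (2 * D)
      have h2 := Nat.div_add_mod y (2 * D)
      have h3 := Nat.mod_lt x (show 0 < 2 * D by omega)
      rw [hb] at h1
      omega
    · have := hψ x hx y hy
      rwa [← Nat.cast_sub hlt.le] at this
  have hqr : (0 : ℝ) < q := by exact_mod_cast hq0
  have hq1 : (1 : ℝ) ≤ q := by exact_mod_cast hq0
  have hq2r : (q : ℝ) ≤ 2 * D := by exact_mod_cast hq2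
  set a : ℤ := round (q * ψ) with ha
  set φ : ℝ := q * ψ - a with hφ
  have hφle : |φ| ≤ D / L := hqψ
  have hψeq : (q : ℝ) * ψ = a + φ := by rw [hφ]; ring
  -- two far apart elements in a common class
  obtain ⟨⟨s, m⟩, -, hfib⟩ :
      ∃ y ∈ Finset.range q ×ˢ Finset.Icc (-(2 * D : ℤ)) (2 * D), (L : ℝ) / (20 * D ^ 3) <
        ((H.filter fun h => (h % q, ⌊2 * h * φ / q⌋) = y).card : ℝ) := by
    apply Finset.exists_lt_card_fiber_of_nsmul_lt_card_of_maps_to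
    · intro h hh
      have hhL : (h : ℝ) ≤ L := by exact_mod_cast (hHL h hh).le
      have habs : |2 * h * φ / q| ≤ 2 * D := by
        rw [abs_div, abs_mul, abs_of_pos hqr, abs_of_nonneg (by positivity : (0 : ℝ) ≤ 2 * h)]
        rw [div_le_iff₀ hqr]
        calc 2 * h * |φ| ≤ 2 * L * (D / L) := by gcongr
          _ = 2 * D * 1 := by field_simp
          _ ≤ 2 * D * q := by gcongr
      rw [abs_le] at habs
      simp only [Finset.mem_product, Finset.mem_range, Finset.mem_Icc]
      refine ⟨Nat.mod_lt _ hq0, ?_, ?_⟩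
      · rw [Int.le_floor]; push_cast; linarith
      · have := (Int.floor_le (2 * h * φ / q)).trans habs.2
        exact_mod_cast this
    · rw [Finset.card_product, Finset.card_range, Int.card_Icc, nsmul_eq_mul]
      have hc : (2 * (D : ℤ) + 1 - -(2 * D)).toNat = 4 * D + 1 := by omega
      rw [hc]
      have hcard' : (L : ℝ) ≤ D * H.card := by exact_mod_cast hcard
      have : (L : ℝ) / D ≤ H.card := by rw [div_le_iff₀ (by linarith)]; linarith
      refine lt_of_lt_of_le ?_ this
      push_cast
      have h1 : (q : ℝ) * (4 * D + 1) * ((L : ℝ) / (20 * D ^ 3))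
          ≤ (2 * D) * (4 * D + D) * ((L : ℝ) / (20 * D ^ 3)) := by gcongr
      have h2 : (2 * D : ℝ) * (4 * D + D) * ((L : ℝ) / (20 * D ^ 3)) = L / D / 2 := by
        field_simp; norm_num
      exact (h1.trans_eq h2).trans_lt (half_lt_self (by positivity))
  set E := H.filter fun h => (h % q, ⌊2 * h * φ / q⌋) = (s, m) with hE
  have hbig : (1 : ℝ) ≤ L / (20 * D ^ 3) := by
    rw [le_div_iff₀ (by positivity), one_mul]; exact_mod_cast hL
  have hEcard : 1 < E.card := by exact_mod_cast hbig.trans_lt hfib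
  have hEne : E.Nonempty := Finset.card_pos.1 (by omega)
  set x := E.max' hEne with hx
  set y := E.min' hEne with hy
  have hxE : x ∈ E := Finset.max'_mem _ _
  have hyE : y ∈ E := Finset.min'_mem _ _
  have hyx : E.card ≤ x - y + 1 := by
    have hsub : E ⊆ Finset.Icc y x := fun z hz =>
      Finset.mem_Icc.2 ⟨Finset.min'_le _ _ hz, Finset.le_max' _ _ hz⟩
    have := Finset.card_le_card hsub
    rw [Nat.card_Icc] at this
    omega
  have hlt : y < x := by omega
  rw [hE, Finset.mem_filter, Prod.mk.injEq] at hxE hyE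
  obtain ⟨t, ht⟩ : q ∣ x - y :=
    (Nat.modEq_iff_dvd' hlt.le).1 (hyE.2.1.trans hxE.2.1.symm)
  have htr : (x : ℝ) - y = q * t := by rw [← Nat.cast_sub hlt.le, ht]; push_cast; ring
  have htφ : |t * φ| < 1 / 2 := by
    have h1 := Int.abs_sub_lt_one_of_floor_eq_floor (hxE.2.2.trans hyE.2.2.symm)
    have h2 : 2 * (x : ℝ) * φ / q - 2 * y * φ / q = 2 * (t * φ) := by
      have : 2 * (x : ℝ) * φ / q - 2 * y * φ / q = 2 * ((x : ℝ) - y) * φ / q := by ring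
      rw [this, htr]; field_simp
    rw [h2, abs_mul, abs_two] at h1
    linarith
  have hdist : |t * φ| ≤ D / L := by
    have h1 := hψ x hxE.1 y hyE.1
    have h2 : ((x : ℝ) - y) * ψ = ((t * a : ℤ) : ℝ) + t * φ := by
      rw [htr, mul_right_comm, hψeq]; push_cast; ring
    rwa [h2, distToInt_add_intCast_of_abs_lt_half htφ] at h1
  have htL : (L : ℝ) / (80 * D ^ 4) ≤ t := by
    have h1 : (E.card : ℝ) ≤ 2 * (q * t) := by
      rw [← htr, ← Nat.cast_sub hlt.le]
      exact_mod_cast (show E.card ≤ 2 * (x - y) by omega)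
    have h2 : (L : ℝ) / (20 * D ^ 3) ≤ 2 * (2 * D * t) :=
      hfib.le.trans (h1.trans (by gcongr))
    rw [div_le_iff₀ (by positivity)] at h2 ⊢
    linarith
  refine ⟨q, hq0, hq2, ?_⟩
  change |φ| ≤ _
  rw [abs_mul, Nat.abs_cast] at hdist
  have hpos : 0 < (L : ℝ) / (80 * D ^ 4) := by positivity
  have h3 : L / (80 * D ^ 4) * |φ| ≤ D / L :=
    (mul_le_mul_of_nonneg_right htL (abs_nonneg _)).trans hdist
  rw [mul_comm, ← le_div_iff₀ hpos] at h3
  refine h3.trans (le_of_eq ?_)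
  field_simp

section

open scoped ComplexConjugate

/-- The additive character `x ↦ exp (2πix)` of period `1`. -/
noncomputable def unitExp (x : ℝ) : ℂ := Complex.exp ((2 * Real.pi * x : ℝ) * Complex.I)

lemma norm_unitExp (x : ℝ) : ‖unitExp x‖ = 1 := Complex.norm_exp_ofReal_mul_I _

lemma unitExp_add (x y : ℝ) : unitExp (x + y) = unitExp x * unitExp y := by
  rw [unitExp, unitExp, unitExp, ← Complex.exp_add]
  push_cast
  ring_nf

lemma unitExp_zero : unitExp 0 = 1 := by simp [unitExp]

lemma unitExp_natCast_mul (n : ℕ) (x : ℝ) : unitExp (n * x) = unitExp x ^ n := by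
  rw [unitExp, unitExp, ← Complex.exp_nat_mul]
  push_cast
  ring_nf

lemma conj_unitExp (x : ℝ) : conj (unitExp x) = unitExp (-x) := by
  rw [unitExp, unitExp, ← Complex.exp_conj, map_mul, Complex.conj_ofReal, Complex.conj_I]
  push_cast
  ring_nf

lemma unitExp_re (x : ℝ) : (unitExp x).re = Real.cos (2 * Real.pi * x) :=
  Complex.exp_ofReal_mul_I_re _

lemma two_mul_distToInt_le_abs_sin (x : ℝ) : 2 * distToInt x ≤ |Real.sin (Real.pi * x)| := by
  have h1 : Real.pi * x = Real.pi * (x - round x) + round x * Real.pi := by ring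
  rw [h1, Real.sin_add_int_mul_pi, abs_mul, abs_zpow, abs_neg, abs_one, one_zpow, one_mul, distToInt]
  have h2 := abs_sub_round x
  set y := x - round x
  have hpi := Real.pi_pos
  have h3 : |Real.sin (Real.pi * y)| = |Real.sin (Real.pi * |y|)| := by
    rcases abs_cases y with ⟨h, _⟩ | ⟨h, _⟩ <;> simp [h]
  rw [h3]
  refine le_trans ?_ (le_abs_self _)
  have h4 := Real.mul_le_sin (x := Real.pi * |y|) (by positivity) (by nlinarith)
  refine le_trans (le_of_eq ?_) h4
  field_simp

lemma norm_sum_unitExp_mul_distToInt_le (L : ℕ) (x : ℝ) :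
    ‖∑ n ∈ Finset.range L, unitExp (n * x)‖ * distToInt x ≤ 1 / 2 := by
  simp_rw [unitExp_natCast_mul]
  have h1 := congrArg norm (mul_neg_geom_sum (unitExp x) L)
  rw [norm_mul] at h1
  have h2 : ‖1 - unitExp x ^ L‖ ≤ 2 := by
    refine (norm_sub_le _ _).trans ?_
    rw [norm_pow, norm_unitExp, norm_one, one_pow]
    norm_num
  have h3 : ‖1 - unitExp x‖ = 2 * |Real.sin (Real.pi * x)| := by
    rw [norm_sub_rev, unitExp, mul_comm, Complex.norm_exp_I_mul_ofReal_sub_one, Real.norm_eq_abs, abs_mul,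
      abs_two]
    ring_nf
  rw [h3] at h1
  have h4 := two_mul_distToInt_le_abs_sin x
  have h5 := norm_nonneg (∑ n ∈ Finset.range L, unitExp x ^ n)
  nlinarith [mul_le_mul_of_nonneg_right h4 h5]

lemma norm_sq_bilinear_sum_le (L : ℕ) (u v : ℕ → ℂ) (hu : ∀ n, ‖u n‖ ≤ 1) (hv : ∀ n, ‖v n‖ ≤ 1)
    (ψ : ℝ) :
    ‖∑ x ∈ Finset.range L, ∑ y ∈ Finset.range L, u x * v y * unitExp (x * (y * ψ))‖ ^ 2 ≤
      L * ∑ y ∈ Finset.range L, ∑ z ∈ Finset.range L,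
        ‖∑ x ∈ Finset.range L, unitExp (x * (((y : ℝ) - z) * ψ))‖ := by
  set V : ℕ → ℂ := fun x => ∑ y ∈ Finset.range L, v y * unitExp (x * (y * ψ)) with hV
  have h1 : ‖∑ x ∈ Finset.range L, ∑ y ∈ Finset.range L, u x * v y * unitExp (x * (y * ψ))‖ ≤
      ∑ x ∈ Finset.range L, ‖V x‖ := by
    refine (norm_sum_le _ _).trans (Finset.sum_le_sum fun x _ => ?_)
    simp_rw [mul_assoc, ← Finset.mul_sum]
    rw [norm_mul]
    exact mul_le_of_le_one_left (norm_nonneg _) (hu x)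
  have h2 : (∑ x ∈ Finset.range L, ‖V x‖) ^ 2 ≤ L * ∑ x ∈ Finset.range L, ‖V x‖ ^ 2 := by
    simpa using sq_sum_le_card_mul_sum_sq (s := Finset.range L) (f := fun x => ‖V x‖)
  refine (pow_le_pow_left₀ (norm_nonneg _) h1 2).trans (h2.trans ?_)
  refine mul_le_mul_of_nonneg_left ?_ (Nat.cast_nonneg L)
  have h3 : ((∑ x ∈ Finset.range L, ‖V x‖ ^ 2 : ℝ) : ℂ) = ∑ y ∈ Finset.range L,
      ∑ z ∈ Finset.range L, v y * conj (v z) *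
        ∑ x ∈ Finset.range L, unitExp (x * (((y : ℝ) - z) * ψ)) := by
    push_cast
    have : ∀ x ∈ Finset.range L, (‖V x‖ : ℂ) ^ 2 = ∑ y ∈ Finset.range L,
        ∑ z ∈ Finset.range L, v y * conj (v z) * unitExp (x * (((y : ℝ) - z) * ψ)) := by
      intro x _
      rw [← Complex.mul_conj', hV, map_sum, Finset.sum_mul_sum]
      refine Finset.sum_congr rfl fun y _ => Finset.sum_congr rfl fun z _ => ?_
      rw [map_mul, conj_unitExp]
      have : (x : ℝ) * (((y : ℝ) - z) * ψ) = x * (y * ψ) + -(x * (z * ψ)) := by ring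
      rw [this, unitExp_add]
      ring
    rw [Finset.sum_congr rfl this, Finset.sum_comm]
    refine Finset.sum_congr rfl fun y _ => ?_
    rw [Finset.sum_comm]
    simp_rw [Finset.mul_sum]
  have h4 : 0 ≤ ∑ x ∈ Finset.range L, ‖V x‖ ^ 2 := Finset.sum_nonneg fun _ _ => by positivity
  rw [← Complex.norm_of_nonneg h4, h3]
  refine (norm_sum_le _ _).trans (Finset.sum_le_sum fun y _ => ?_)
  refine (norm_sum_le _ _).trans (Finset.sum_le_sum fun z _ => ?_)
  rw [norm_mul, norm_mul, RCLike.norm_conj]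
  exact mul_le_of_le_one_left (norm_nonneg _)
    (mul_le_one₀ (hv y) (norm_nonneg _) (hv z))

/-- Inverse form of Weyl's inequality for bilinear phases. -/
lemma exists_denominator_of_bilinear_sum {D L : ℕ} (hD : 0 < D) (hL : 20 * D ^ 3 ≤ L) {u v : ℕ → ℂ}
    (hu : ∀ n, ‖u n‖ ≤ 1) (hv : ∀ n, ‖v n‖ ≤ 1) {ψ : ℝ}
    (h : 2 * (L : ℝ) ^ 4 ≤ D *
      ‖∑ x ∈ Finset.range L, ∑ y ∈ Finset.range L, u x * v y * unitExp (x * (y * ψ))‖ ^ 2) :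
    ∃ q : ℕ, 0 < q ∧ q ≤ 2 * D ∧ distToInt (q * ψ) ≤ 80 * D ^ 5 / L ^ 2 := by
  have hLpos : 0 < L := lt_of_lt_of_le (by positivity) hL
  have hLr : (0 : ℝ) < L := by exact_mod_cast hLpos
  have hDr : (0 : ℝ) < D := by exact_mod_cast hD
  set T : ℕ → ℕ → ℝ := fun y z =>
    ‖∑ x ∈ Finset.range L, unitExp (x * (((y : ℝ) - z) * ψ))‖ with hT
  have hTL : ∀ y z, T y z ≤ L := fun y z => by
    refine (norm_sum_le _ _).trans ?_
    simp [norm_unitExp]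
  obtain ⟨y, -, hy⟩ : ∃ y ∈ Finset.range L,
      2 * (L : ℝ) ^ 2 / D ≤ ∑ z ∈ Finset.range L, T y z := by
    apply Finset.exists_le_of_sum_le (by simpa using hLpos.ne')
    rw [Finset.sum_const, Finset.card_range, nsmul_eq_mul]
    have h1 := norm_sq_bilinear_sum_le L u v hu hv ψ
    have h2 := h.trans (mul_le_mul_of_nonneg_left h1 hDr.le)
    rw [mul_div_assoc', div_le_iff₀ hDr]
    refine le_of_mul_le_mul_left ?_ hLr
    calc (L : ℝ) * (L * (2 * L ^ 2)) = 2 * (L : ℝ) ^ 4 := by ring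
      _ ≤ _ := h2
      _ = _ := by ring
  set H := (Finset.range L).filter fun z => (L : ℝ) / D ≤ T y z with hH
  have hdist : ∀ z ∈ H, distToInt (((y : ℝ) - z) * ψ) ≤ D / L / 2 := by
    intro z hz
    rw [hH, Finset.mem_filter] at hz
    have h1 := norm_sum_unitExp_mul_distToInt_le L (((y : ℝ) - z) * ψ)
    have h2 := (mul_le_mul_of_nonneg_right hz.2 (distToInt_nonneg (((y : ℝ) - z) * ψ))).trans h1
    rw [← le_div_iff₀' (by positivity)] at h2
    refine h2.trans (le_of_eq ?_)
    field_simp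
  refine exists_small_denominator hD hL (H := H) (fun z hz => ?_) ?_ fun z hz z' hz' => ?_
  · exact Finset.mem_range.1 (Finset.mem_filter.1 hz).1
  · have h1 : ∑ z ∈ Finset.range L, T y z ≤ ∑ z ∈ Finset.range L,
        ((L : ℝ) / D + if (L : ℝ) / D ≤ T y z then (L : ℝ) else 0) := by
      refine Finset.sum_le_sum fun z _ => ?_
      split_ifs with hz
      · have := hTL y z
        have : 0 ≤ (L : ℝ) / D := by positivity
        linarith
      · linarith
    rw [Finset.sum_add_distrib, ← Finset.sum_filter, Finset.sum_const, Finset.sum_const,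
      Finset.card_range, nsmul_eq_mul, nsmul_eq_mul, ← hH] at h1
    have h2 := hy.trans h1
    have h3 : (L : ℝ) * (L / D) = L ^ 2 / D := by ring
    rw [h3, mul_div_assoc, two_mul, add_le_add_iff_left, div_le_iff₀ hDr] at h2
    have h4 : (L : ℝ) ≤ D * H.card := by
      refine le_of_mul_le_mul_left ?_ hLr
      linarith
    exact_mod_cast h4
  · have h1 : ((z : ℝ) - z') * ψ = ((y : ℝ) - z') * ψ - ((y : ℝ) - z) * ψ := by ring
    rw [h1]
    refine (distToInt_sub_le _ _).trans ?_
    linarith [hdist z hz, hdist z' hz']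

/-- Inverse form of Weyl's inequality for quadratic phases. -/
lemma exists_denominator_of_quadratic_sum {D L : ℕ} (hD : 0 < D) (hL : 20 * D ^ 3 ≤ L) {θ : ℝ}
    (h : 2 * (L : ℝ) ^ 4 ≤ D *
      ‖∑ x ∈ Finset.range L, ∑ y ∈ Finset.range L,
        unitExp (((x + y + 1 : ℕ) : ℝ) ^ 2 * θ)‖ ^ 2) :
    ∃ q : ℕ, 0 < q ∧ q ≤ 4 * D ∧ distToInt (q * θ) ≤ 80 * D ^ 5 / L ^ 2 := by
  obtain ⟨q, hq, hqD, hqθ⟩ := exists_denominator_of_bilinear_sum (ψ := 2 * θ)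
    (u := fun x => unitExp (((x : ℝ) ^ 2 + 2 * x + 1) * θ))
    (v := fun x => unitExp (((x : ℝ) ^ 2 + 2 * x) * θ)) hD hL
    (fun _ => (norm_unitExp _).le) (fun _ => (norm_unitExp _).le) (by
      convert h using 9 with x _ y _
      rw [← unitExp_add, ← unitExp_add]
      congr 1
      push_cast
      ring)
  refine ⟨q * 2, by omega, by omega, ?_⟩
  convert hqθ using 2
  push_cast
  ring

lemma unitExp_sum {ι : Type*} (s : Finset ι) (f : ι → ℝ) :
    unitExp (∑ i ∈ s, f i) = ∏ i ∈ s, unitExp (f i) := by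
  simp_rw [unitExp, ← Complex.exp_sum, ← Finset.sum_mul, Finset.mul_sum]
  push_cast
  rfl

lemma norm_one_add_unitExp_sq (x : ℝ) :
    ‖(1 + unitExp x) / 2‖ ^ 2 = Real.cos (Real.pi * x) ^ 2 := by
  rw [unitExp, ← Complex.normSq_eq_norm_sq, Complex.normSq_apply, Complex.exp_mul_I,
    ← Complex.ofReal_cos, ← Complex.ofReal_sin]
  have h1 : 2 * Real.pi * x = 2 * (Real.pi * x) := by ring
  simp only [Complex.div_ofNat_re, Complex.div_ofNat_im, Complex.add_re, Complex.add_im,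
    Complex.one_re, Complex.one_im, Complex.ofReal_re, Complex.ofReal_im, Complex.mul_re,
    Complex.mul_im, Complex.I_re, Complex.I_im, h1, Real.cos_two_mul, Real.sin_two_mul]
  have h2 := Real.sin_sq_add_cos_sq (Real.pi * x)
  have h3 : Real.sin (Real.pi * x) ^ 2 = 1 - Real.cos (Real.pi * x) ^ 2 := by linarith
  ring_nf
  rw [h3]
  ring

/-- Weights of the symmetric binomial distribution on `{0, …, p}ᵈ`. -/
noncomputable def binomialWeight (d p : ℕ) (a : Fin d → Fin (p + 1)) : ℝ :=
  ∏ j, (p.choose (a j) : ℝ) / 2 ^ p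

lemma binomialWeight_nonneg {d p : ℕ} (a : Fin d → Fin (p + 1)) : 0 ≤ binomialWeight d p a :=
  Finset.prod_nonneg fun _ _ => by positivity

lemma sum_binomialWeight_mul_unitExp (d p : ℕ) (x : Fin d → ℝ) :
    ∑ a, (binomialWeight d p a : ℂ) * unitExp (∑ j, (a j : ℕ) * x j) =
      ∏ j, ((1 + unitExp (x j)) / 2) ^ p := by
  have h1 : ∀ j, ((1 + unitExp (x j)) / 2) ^ p =
      ∑ i : Fin (p + 1), ((p.choose i : ℂ) / 2 ^ p) * unitExp ((i : ℕ) * x j) := by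
    intro j
    rw [div_pow, add_comm, add_pow, Finset.sum_range, Finset.sum_div]
    refine Finset.sum_congr rfl fun i _ => ?_
    rw [unitExp_natCast_mul, one_pow]
    ring
  simp_rw [h1]
  rw [Finset.prod_univ_sum, Fintype.piFinset_univ]
  refine Finset.sum_congr rfl fun a _ => ?_
  rw [Finset.prod_mul_distrib, unitExp_sum, binomialWeight]
  push_cast
  rfl

lemma sum_binomialWeight (d p : ℕ) : ∑ a, binomialWeight d p a = 1 := by
  have h := sum_binomialWeight_mul_unitExp d p 0
  simp only [Pi.zero_apply, mul_zero, Finset.sum_const_zero, unitExp_zero, mul_one] at h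
  norm_num at h
  exact_mod_cast h

lemma one_le_sum_binomialWeight_sq (d p : ℕ) :
    1 ≤ ((p : ℝ) + 1) ^ d * ∑ a, binomialWeight d p a ^ 2 := by
  have h := sq_sum_le_card_mul_sum_sq (s := Finset.univ) (f := binomialWeight d p)
  rw [sum_binomialWeight] at h
  simpa using h

lemma prod_cos_sq_pow_eq_sum (d p : ℕ) (x : Fin d → ℝ) :
    ∏ j, (Real.cos (Real.pi * x j) ^ 2) ^ p = ∑ a, ∑ b,
      binomialWeight d p a * binomialWeight d p b *
        (unitExp (∑ j, (((a j : ℕ) - (b j : ℕ) : ℤ) : ℝ) * x j)).re := by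
  have h1 : ∏ j, (Real.cos (Real.pi * x j) ^ 2) ^ p =
      ‖∏ j, ((1 + unitExp (x j)) / 2) ^ p‖ ^ 2 := by
    rw [norm_prod, ← Finset.prod_pow]
    refine Finset.prod_congr rfl fun j _ => ?_
    rw [norm_pow, ← norm_one_add_unitExp_sq, pow_right_comm]
  have h2 : ((‖∏ j, ((1 + unitExp (x j)) / 2) ^ p‖ ^ 2 : ℝ) : ℂ) = ∑ a, ∑ b,
      ((binomialWeight d p a * binomialWeight d p b : ℝ) : ℂ) *
        unitExp (∑ j, (((a j : ℕ) - (b j : ℕ) : ℤ) : ℝ) * x j) := by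
    rw [Complex.ofReal_pow, ← Complex.mul_conj', ← sum_binomialWeight_mul_unitExp, map_sum,
      Finset.sum_mul_sum]
    refine Finset.sum_congr rfl fun a _ => Finset.sum_congr rfl fun b _ => ?_
    rw [map_mul, conj_unitExp, Complex.conj_ofReal]
    have : ∑ j, (((a j : ℕ) - (b j : ℕ) : ℤ) : ℝ) * x j =
        ∑ j, ((a j : ℕ) : ℝ) * x j + -∑ j, ((b j : ℕ) : ℝ) * x j := by
      rw [← sub_eq_add_neg, ← Finset.sum_sub_distrib]
      refine Finset.sum_congr rfl fun j _ => ?_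
      push_cast
      ring
    rw [this, unitExp_add]
    push_cast
    ring
  have h3 := congrArg Complex.re h2
  rw [Complex.ofReal_re, Complex.re_sum] at h3
  rw [h1, h3]
  refine Finset.sum_congr rfl fun a _ => ?_
  rw [Complex.re_sum]
  exact Finset.sum_congr rfl fun b _ => Complex.re_ofReal_mul _ _

/-- If the kernel is small on all the given points, then some small frequency is strongly negatively
correlated with them. -/
lemma exists_frequency_sum_re_le {ι : Type*} {d p : ℕ} (s : Finset ι) (x : ι → Fin d → ℝ)
    (hx : ∀ i ∈ s, ∏ j, (Real.cos (Real.pi * x i j) ^ 2) ^ p ≤ 1 / (2 * ((p : ℝ) + 1) ^ d)) :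
    ∃ k : Fin d → ℤ, (∀ j, |k j| ≤ p) ∧
      ∑ i ∈ s, (unitExp (∑ j, k j * x i j)).re ≤ -(s.card / (2 * ((p : ℝ) + 1) ^ d)) := by
  set τ : ℝ := 1 / ((p : ℝ) + 1) ^ d with hτ
  have hτpos : 0 < τ := by positivity
  have hτ2 : 1 / (2 * ((p : ℝ) + 1) ^ d) = τ / 2 := by rw [hτ]; field_simp
  have hs2 : s.card / (2 * ((p : ℝ) + 1) ^ d) = s.card * (τ / 2) := by rw [hτ]; field_simp
  rw [hs2]
  simp_rw [hτ2] at hx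
  set w := binomialWeight d p with hw
  set R : (Fin d → Fin (p + 1)) → (Fin d → Fin (p + 1)) → ℝ := fun a b =>
    ∑ i ∈ s, (unitExp (∑ j, (((a j : ℕ) - (b j : ℕ) : ℤ) : ℝ) * x i j)).re with hR
  by_contra! hcon
  rcases s.eq_empty_or_nonempty with rfl | hs
  · simpa using hcon 0 (by simp)
  have hcard : (0 : ℝ) < s.card := by exact_mod_cast hs.card_pos
  have hRab : ∀ a b, 0 ≤ R a b + s.card * (τ / 2) := by
    intro a b
    have := hcon (fun j => ((a j : ℕ) : ℤ) - (b j : ℕ)) (fun j => by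
      have := (a j).2; have := (b j).2
      rw [abs_le]; omega)
    simp only [hR]
    linarith
  have hRaa : ∀ a, R a a = s.card := by
    intro a
    simp [hR, unitExp_zero]
  have h1 : ∑ a, ∑ b, w a * w b * R a b ≤ s.card * (τ / 2) := by
    have : ∑ i ∈ s, ∏ j, (Real.cos (Real.pi * x i j) ^ 2) ^ p =
        ∑ a, ∑ b, w a * w b * R a b := by
      simp_rw [prod_cos_sq_pow_eq_sum, hR, Finset.mul_sum]
      rw [Finset.sum_comm]
      refine Finset.sum_congr rfl fun a _ => ?_
      rw [Finset.sum_comm]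
    rw [← this]
    simpa using Finset.sum_le_sum hx
  have h2 : ∑ a, ∑ b, w a * w b * (R a b + s.card * (τ / 2)) =
      ∑ a, ∑ b, w a * w b * R a b + s.card * (τ / 2) := by
    simp_rw [mul_add, Finset.sum_add_distrib, ← Finset.sum_mul, ← Finset.sum_mul_sum]
    rw [hw, sum_binomialWeight]
    ring
  have h3 : ∑ a, w a ^ 2 * (s.card * (1 + τ / 2)) ≤
      ∑ a, ∑ b, w a * w b * (R a b + s.card * (τ / 2)) := by
    refine Finset.sum_le_sum fun a _ => ?_
    have := Finset.single_le_sum (f := fun b => w a * w b * (R a b + s.card * (τ / 2)))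
      (fun b _ => mul_nonneg (mul_nonneg (binomialWeight_nonneg a) (binomialWeight_nonneg b))
        (hRab a b)) (Finset.mem_univ a)
    refine le_trans (le_of_eq ?_) this
    simp only [hRaa]
    ring
  have h4 : τ ≤ ∑ a, w a ^ 2 := by
    rw [hτ, div_le_iff₀' (by positivity)]
    exact one_le_sum_binomialWeight_sq d p
  rw [← Finset.sum_mul] at h3
  have h5 : τ * (s.card * (1 + τ / 2)) ≤ s.card * (τ / 2) + s.card * (τ / 2) :=
    (mul_le_mul_of_nonneg_right h4 (by positivity)).trans (h3.trans (h2.trans_le (by linarith)))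
  nlinarith [mul_pos hcard (mul_pos hτpos hτpos)]

lemma prod_cos_sq_pow_le {d M : ℕ} (hM : 1 ≤ M) (hdM : d ≤ M) {x : Fin d → ℝ}
    (hx : ∃ j, 1 / (M : ℝ) ≤ distToInt (x j)) :
    ∏ j, (Real.cos (Real.pi * x j) ^ 2) ^ (M ^ 4) ≤ 1 / (2 * (((M ^ 4 : ℕ) : ℝ) + 1) ^ d) := by
  obtain ⟨j, hj⟩ := hx
  have hMr : (1 : ℝ) ≤ M := by exact_mod_cast hM
  have h1 : ∏ j, (Real.cos (Real.pi * x j) ^ 2) ^ (M ^ 4) ≤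
      (Real.cos (Real.pi * x j) ^ 2) ^ (M ^ 4) := by
    rw [← Finset.mul_prod_erase _ _ (Finset.mem_univ j)]
    refine mul_le_of_le_one_right (by positivity) (Finset.prod_le_one (fun _ _ => by positivity) ?_)
    exact fun i _ => pow_le_one₀ (by positivity) (Real.cos_sq_le_one _)
  have h2 : Real.cos (Real.pi * x j) ^ 2 ≤ Real.exp (-(4 / M ^ 2)) := by
    rw [Real.cos_sq']
    have h3 : 2 * (1 / (M : ℝ)) ≤ |Real.sin (Real.pi * x j)| :=
      (mul_le_mul_of_nonneg_left hj zero_le_two).trans (two_mul_distToInt_le_abs_sin _)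
    have h4 := pow_le_pow_left₀ (by positivity) h3 2
    rw [sq_abs] at h4
    have h5 := Real.add_one_le_exp (-(4 / (M : ℝ) ^ 2))
    have h6 : (2 * (1 / (M : ℝ))) ^ 2 = 4 / M ^ 2 := by ring
    linarith
  refine h1.trans ((pow_le_pow_left₀ (by positivity) h2 _).trans ?_)
  rw [← Real.exp_nat_mul, mul_neg, Real.exp_neg, ← one_div]
  refine one_div_le_one_div_of_le (by positivity) ?_
  have h7 : ((M ^ 4 : ℕ) : ℝ) * (4 / M ^ 2) = M * (4 * M) := by
    push_cast; field_simp
  rw [h7, Real.exp_nat_mul]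
  have h8 : 4 * (M : ℝ) ^ 4 ≤ Real.exp (4 * M) := by
    have := pow_le_pow_left₀ (by positivity) (Real.two_mul_le_exp (x := M)) 4
    rw [← Real.exp_nat_mul] at this
    push_cast at this
    refine le_trans ?_ this
    nlinarith [pow_pos (show (0 : ℝ) < M by linarith) 4]
  refine le_trans ?_ (pow_le_pow_left₀ (by positivity) h8 M)
  have h9 : (1 : ℝ) ≤ (M : ℝ) ^ 4 := one_le_pow₀ hMr
  calc 2 * (((M ^ 4 : ℕ) : ℝ) + 1) ^ d ≤ 2 * (((M ^ 4 : ℕ) : ℝ) + 1) ^ M := by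
        gcongr
        push_cast; linarith
    _ ≤ 2 ^ M * (2 * (M : ℝ) ^ 4) ^ M := by
        push_cast
        gcongr
        · exact le_self_pow₀ one_le_two (by omega)
        · linarith
    _ = (4 * (M : ℝ) ^ 4) ^ M := by rw [← mul_pow]; ring_nf

end

lemma det_mul_transpose_ne_zero {r d : ℕ} {K : Matrix (Fin r) (Fin d) ℤ}
    (hK : LinearIndependent ℝ fun i j => (K i j : ℝ)) : (K * K.transpose).det ≠ 0 := by
  intro h0
  set KR : Matrix (Fin r) (Fin d) ℝ := K.map (Int.cast : ℤ → ℝ) with hKR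
  have h1 : (KR * KR.transpose).det = 0 := by
    have h2 : KR * KR.transpose = (K * K.transpose).map (Int.cast : ℤ → ℝ) := by
      ext i j
      simp [hKR, Matrix.mul_apply]
    rw [h2, ← Int.cast_det, h0, Int.cast_zero]
  obtain ⟨v, hv0, hv⟩ := Matrix.exists_mulVec_eq_zero_iff.2 h1
  apply hv0
  have h3 : Matrix.vecMul v KR = 0 := by
    rw [← dotProduct_self_eq_zero]
    have h4 := congrArg (dotProduct v) hv
    rwa [← Matrix.mulVec_mulVec, Matrix.dotProduct_mulVec, Matrix.mulVec_transpose,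
      dotProduct_zero] at h4
  funext i
  refine Fintype.linearIndependent_iff.1 hK v ?_ i
  funext j
  have := congrFun h3 j
  simpa [Matrix.vecMul, dotProduct, hKR] using this

/-- Cramer's rule with bounds: a common denominator for the coordinates, with respect to
a family of short independent integer vectors, of the integer vectors in their span. -/
lemma exists_common_denominator {r d P : ℕ} (hd : 0 < d) (hP : 0 < P)
    {K : Matrix (Fin r) (Fin d) ℤ} (hK : LinearIndependent ℝ fun i j => (K i j : ℝ))
    (hKP : ∀ i j, |K i j| ≤ P) :
    ∃ Δ : ℕ, 0 < Δ ∧ Δ ≤ r.factorial * (d * P ^ 2) ^ r ∧ ∀ v : Fin d → ℤ, (∀ j, |v j| ≤ P) →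
      (fun j => (v j : ℝ)) ∈ Submodule.span ℝ (Set.range fun i j => (K i j : ℝ)) →
      ∃ c : Fin r → ℤ, (∀ i, |c i| ≤ r * (r.factorial * (d * P ^ 2) ^ r * (d * P ^ 2) : ℕ)) ∧
        ∀ j, Δ * v j = ∑ i, c i * K i j := by
  set G := K * K.transpose with hG
  have hdot : ∀ u v : Fin d → ℤ, (∀ j, |u j| ≤ P) → (∀ j, |v j| ≤ P) →
      |∑ j, u j * v j| ≤ (d * P ^ 2 : ℕ) := by
    intro u v hu hv
    refine (Finset.abs_sum_le_sum_abs _ _).trans ?_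
    have : ∀ j ∈ Finset.univ, |u j * v j| ≤ (P : ℤ) ^ 2 := fun j _ => by
      rw [abs_mul, sq]
      exact mul_le_mul (hu j) (hv j) (abs_nonneg _) (by positivity)
    refine (Finset.sum_le_sum this).trans ?_
    simp
  have hGle : ∀ i j, |G i j| ≤ (d * P ^ 2 : ℕ) := fun i j => by
    simpa [hG, Matrix.mul_apply] using hdot (K i) (K j) (hKP i) (hKP j)
  have hone : (1 : ℤ) ≤ (d * P ^ 2 : ℕ) := by
    exact_mod_cast Nat.one_le_iff_ne_zero.2 (by positivity)
  have hdet : ∀ A : Matrix (Fin r) (Fin r) ℤ, (∀ i j, |A i j| ≤ (d * P ^ 2 : ℕ)) →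
      |A.det| ≤ (r.factorial * (d * P ^ 2) ^ r : ℕ) := fun A hA => by
    have := Matrix.det_le (A := A) (abv := AbsoluteValue.abs) (x := ((d * P ^ 2 : ℕ) : ℤ)) hA
    simpa using this
  have hadj : ∀ i j, |G.adjugate i j| ≤ (r.factorial * (d * P ^ 2) ^ r : ℕ) := fun i j => by
    rw [Matrix.adjugate_apply]
    refine hdet _ fun a b => ?_
    rw [Matrix.updateRow_apply]
    split_ifs
    · rw [Pi.single_apply]
      split_ifs <;> simp only [abs_one, abs_zero] <;> omega
    · exact hGle a b
  have hG0 : G.det ≠ 0 := det_mul_transpose_ne_zero hK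
  refine ⟨G.det.natAbs, Int.natAbs_pos.2 hG0, ?_, fun v hv hspan => ?_⟩
  · have := hdet G hGle
    rw [Int.abs_eq_natAbs] at this
    exact_mod_cast this
  set c₀ : Fin r → ℤ := G.adjugate.mulVec (K.mulVec v) with hc₀
  refine ⟨fun i => G.det.sign * c₀ i, fun i => ?_, fun j => ?_⟩
  · rw [abs_mul, Int.abs_sign_of_ne_zero hG0, one_mul, hc₀, Matrix.mulVec, dotProduct]
    refine (Finset.abs_sum_le_sum_abs _ _).trans ?_
    have : ∀ l ∈ Finset.univ, |G.adjugate i l * K.mulVec v l| ≤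
        (r.factorial * (d * P ^ 2) ^ r * (d * P ^ 2) : ℕ) := fun l _ => by
      rw [abs_mul, Nat.cast_mul (_ * _)]
      exact mul_le_mul (hadj i l) (hdot (K l) v (hKP l) hv) (abs_nonneg _) (by positivity)
    refine (Finset.sum_le_sum this).trans ?_
    simp
  · obtain ⟨a, ha⟩ := (Submodule.mem_span_range_iff_exists_fun ℝ).1 hspan
    have hva : ∀ j, (v j : ℝ) = ∑ i, a i * K i j := fun j => by
      have := congrFun ha j
      simpa using this.symm
    have hKv : (fun i => ((K.mulVec v i : ℤ) : ℝ)) =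
        (G.map (Int.cast : ℤ → ℝ)).mulVec a := by
      funext i
      simp only [Matrix.mulVec, dotProduct, hG, Matrix.map_apply, Matrix.mul_apply,
        Matrix.transpose_apply, Int.cast_sum, Int.cast_mul, hva, Finset.mul_sum, Finset.sum_mul]
      rw [Finset.sum_comm]
      exact Finset.sum_congr rfl fun _ _ => Finset.sum_congr rfl fun _ _ => by ring
    have hc : ∀ i, (c₀ i : ℝ) = G.det * a i := by
      intro i
      have h1 : (c₀ i : ℝ) =
          ((G.adjugate.map (Int.cast : ℤ → ℝ)).mulVec fun i => ((K.mulVec v i : ℤ) : ℝ)) i := by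
        rw [hc₀]
        simp [Matrix.mulVec, dotProduct]
      have h2 : G.adjugate.map (Int.cast : ℤ → ℝ) * G.map (Int.cast : ℤ → ℝ) =
          (G.det : ℝ) • (1 : Matrix (Fin r) (Fin r) ℝ) := by
        have h3 := congrArg (fun A => A.map (Int.castRingHom ℝ)) (Matrix.adjugate_mul G)
        rw [Matrix.map_mul] at h3
        refine h3.trans ?_
        ext i j
        rw [Matrix.map_apply, Matrix.smul_apply, Matrix.smul_apply, Matrix.one_apply,
          Matrix.one_apply]
        split_ifs <;> simp
      rw [h1, hKv, Matrix.mulVec_mulVec, h2, Matrix.smul_mulVec, Matrix.one_mulVec]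
      rfl
    have h4 : G.det * v j = ∑ i, c₀ i * K i j := by
      have : (G.det : ℝ) * v j = ∑ i, (c₀ i : ℝ) * K i j := by
        rw [hva, Finset.mul_sum]
        exact Finset.sum_congr rfl fun i _ => by rw [hc]; ring
      exact_mod_cast this
    simp_rw [mul_assoc]
    rw [← Finset.mul_sum, ← h4, ← mul_assoc, Int.sign_mul_self_eq_natAbs]

lemma unitExp_re_nonneg {x : ℝ} (hx : distToInt x ≤ 1 / 4) : 0 ≤ (unitExp x).re := by
  have h1 : 2 * Real.pi * x = 2 * Real.pi * (x - round x) + round x * (2 * Real.pi) := by ring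
  rw [unitExp_re, h1, Real.cos_add_int_mul_two_pi]
  have h2 := abs_le.1 hx
  have hpi := Real.pi_pos
  exact Real.cos_nonneg_of_mem_Icc ⟨by nlinarith, by nlinarith⟩

/-- If quadratic recurrence fails, then a given family of approximate integer relations between the
`α j` can be enlarged, after passing to a multiple. -/
lemma exists_next_relation {d M L N r q : ℕ} {α : Fin d → ℝ} (hd : 0 < d) (hM : 16 ≤ M)
    (hdM : d ≤ M) (hL : (M ^ d) ^ 35 ≤ L)
    (hbad : ∀ n, 1 ≤ n → n ≤ N → ∃ j, 1 / (M : ℝ) ≤ distToInt ((n : ℝ) ^ 2 * α j))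
    (hq : 0 < q) (hqN : (M ^ d) ^ 10 * q * (2 * L) ≤ N)
    {K : Fin r → Fin d → ℤ} (hK : LinearIndependent ℝ fun i j => (K i j : ℝ))
    (hKM : ∀ i j, |K i j| ≤ (M ^ 4 : ℕ))
    (hKα : ∀ i, distToInt ((q : ℝ) ^ 2 * ∑ j, K i j * α j) ≤ 1 / (((M : ℝ) ^ d) ^ 60 * L ^ 2)) :
    ∃ (Δ t : ℕ) (k : Fin d → ℤ), 0 < Δ ∧ Δ ≤ (M ^ d) ^ 10 ∧ 0 < t ∧ t ≤ (M ^ d) ^ 12 ∧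
      (∀ j, |k j| ≤ (M ^ 4 : ℕ)) ∧
      (fun j => (k j : ℝ)) ∉ Submodule.span ℝ (Set.range fun i j => (K i j : ℝ)) ∧
      distToInt (t * (((Δ * q : ℕ) : ℝ) ^ 2 * ∑ j, k j * α j)) ≤ ((M : ℝ) ^ d) ^ 57 / L ^ 2 := by
  have hrd : r ≤ d := by simpa using hK.fintype_card_le_finrank
  have hMB : M ≤ M ^ d := Nat.le_self_pow hd.ne' M
  have hBdef : ((M ^ d : ℕ) : ℝ) = (M : ℝ) ^ d := by push_cast; rfl
  have hrB : r ≤ M ^ d := (hrd.trans hdM).trans hMB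
  have hdP : d * (M ^ 4) ^ 2 ≤ M ^ 9 := by
    calc d * (M ^ 4) ^ 2 ≤ M * (M ^ 4) ^ 2 := Nat.mul_le_mul_right _ hdM
      _ = M ^ 9 := by ring
  have hΔbound : r.factorial * (d * (M ^ 4) ^ 2) ^ r ≤ (M ^ d) ^ 10 := by
    calc r.factorial * (d * (M ^ 4) ^ 2) ^ r ≤ M ^ r * (M ^ 9) ^ r := by
          gcongr
          exact (Nat.factorial_le_pow r).trans (Nat.pow_le_pow_left (hrd.trans hdM) r)
      _ ≤ M ^ d * (M ^ 9) ^ d := by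
          gcongr <;> first | omega | exact Nat.one_le_pow _ _ (by omega)
      _ = (M ^ d) ^ 10 := by ring
  have hcbound : r * (r.factorial * (d * (M ^ 4) ^ 2) ^ r * (d * (M ^ 4) ^ 2)) ≤ (M ^ d) ^ 20 := by
    calc _ ≤ M ^ d * ((M ^ d) ^ 10 * (M ^ d) ^ 9) := by
          gcongr
          exact hdP.trans (Nat.pow_le_pow_left hMB 9)
      _ = _ := by ring
  have hTbound : (M ^ 4 + 1) ^ d ≤ (M ^ d) ^ 5 := by
    rw [pow_right_comm]
    refine Nat.pow_le_pow_left ?_ d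
    have : 1 ≤ M ^ 4 := Nat.one_le_pow _ _ (by omega)
    nlinarith
  set B := M ^ d with hB
  rw [← hBdef] at hKα ⊢
  have hB16 : 16 ≤ B := hM.trans hMB
  have hLpos : 0 < L := lt_of_lt_of_le (by positivity) hL
  have hLr : (0 : ℝ) < L := by exact_mod_cast hLpos
  have hBr : (16 : ℝ) ≤ B := by exact_mod_cast hB16
  obtain ⟨Δ, hΔ0, hΔ, hspan⟩ := exists_common_denominator hd (by positivity) hK hKM
  replace hΔ := hΔ.trans hΔbound
  set θ : (Fin d → ℤ) → ℝ := fun k => ((Δ * q : ℕ) : ℝ) ^ 2 * ∑ j, k j * α j with hθ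
  set T := (M ^ 4 + 1) ^ d with hT
  have hT0 : 0 < T := by positivity
  have hTr : (0 : ℝ) < T := by exact_mod_cast hT0
  obtain ⟨k, hkM, hk⟩ := exists_frequency_sum_re_le (d := d) (p := M ^ 4)
    (Finset.range L ×ˢ Finset.range L)
    (fun z j => ((Δ * q * (z.1 + z.2 + 1) : ℕ) : ℝ) ^ 2 * α j) (by
      rintro ⟨x, y⟩ hxy
      rw [Finset.mem_product, Finset.mem_range, Finset.mem_range] at hxy
      refine prod_cos_sq_pow_le (by omega) hdM (hbad _ (Nat.one_le_iff_ne_zero.2 (by positivity)) ?_)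
      refine le_trans ?_ hqN
      gcongr
      dsimp only at hxy ⊢
      omega)
  have hsum : ∀ z : ℕ × ℕ, ∑ j, (k j : ℝ) * (((Δ * q * (z.1 + z.2 + 1) : ℕ) : ℝ) ^ 2 * α j) =
      ((z.1 + z.2 + 1 : ℕ) : ℝ) ^ 2 * θ k := by
    intro z
    simp only [hθ, Finset.mul_sum]
    refine Finset.sum_congr rfl fun j _ => ?_
    push_cast
    ring
  have hcardT : ((Finset.range L ×ˢ Finset.range L).card : ℝ) /
      (2 * (((M ^ 4 : ℕ) : ℝ) + 1) ^ d) = L ^ 2 / (2 * T) := by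
    rw [Finset.card_product, Finset.card_range, hT]
    push_cast
    ring
  simp only [hsum] at hk
  rw [hcardT] at hk
  have hneg : 0 < (L : ℝ) ^ 2 / (2 * T) := by positivity
  obtain ⟨t, ht0, ht, htθ⟩ := exists_denominator_of_quadratic_sum (D := 8 * T ^ 2) (L := L)
    (θ := θ k) (by positivity) (by
      refine le_trans ?_ hL
      calc 20 * (8 * T ^ 2) ^ 3 ≤ (B * B) * (B * (B ^ 5) ^ 2) ^ 3 := by
            gcongr
            · nlinarith
            · omega
        _ = B ^ 35 := by ring) (by
      set S := ∑ x ∈ Finset.range L, ∑ y ∈ Finset.range L,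
        unitExp (((x + y + 1 : ℕ) : ℝ) ^ 2 * θ k) with hS
      have h1 : S.re ≤ -((L : ℝ) ^ 2 / (2 * T)) := by
        rw [Finset.sum_product] at hk
        rw [hS, Complex.re_sum]
        simpa only [Complex.re_sum] using hk
      have h2 : (L : ℝ) ^ 2 / (2 * T) ≤ ‖S‖ := by
        have := Complex.abs_re_le_norm S
        have := neg_abs_le S.re
        linarith
      calc 2 * (L : ℝ) ^ 4 = ((8 * T ^ 2 : ℕ) : ℝ) * ((L : ℝ) ^ 2 / (2 * T)) ^ 2 := by
            push_cast; field_simp; norm_num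
        _ ≤ _ := by gcongr)
  have hD : 8 * T ^ 2 ≤ B ^ 11 := by
    calc 8 * T ^ 2 ≤ B * (B ^ 5) ^ 2 := by gcongr; omega
      _ = B ^ 11 := by ring
  refine ⟨Δ, t, k, hΔ0, hΔ, ht0, ?_, hkM, fun hmem => ?_, ?_⟩
  · calc t ≤ 4 * (8 * T ^ 2) := ht
      _ ≤ B * B ^ 11 := by gcongr; omega
      _ = B ^ 12 := by ring
  · obtain ⟨c, hc, hck⟩ := hspan k hkM hmem
    have hθk : distToInt (θ k) ≤ B ^ 31 * (1 / ((B : ℝ) ^ 60 * L ^ 2)) := by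
      have h1 : θ k = ∑ i, ((Δ * c i : ℤ) : ℝ) * ((q : ℝ) ^ 2 * ∑ j, K i j * α j) := by
        have h2 : ∀ j, (Δ : ℝ) * k j = ∑ i, (c i : ℝ) * K i j := fun j => by
          exact_mod_cast hck j
        calc θ k = Δ * q ^ 2 * ∑ j, (Δ * (k j : ℝ)) * α j := by
              simp only [hθ, Finset.mul_sum]
              refine Finset.sum_congr rfl fun j _ => ?_
              push_cast
              ring
          _ = _ := by
              simp only [h2, Finset.mul_sum, Finset.sum_mul]
              rw [Finset.sum_comm]
              refine Finset.sum_congr rfl fun i _ => Finset.sum_congr rfl fun j _ => ?_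
              push_cast
              ring
      rw [h1]
      refine (distToInt_sum_le _ _).trans ?_
      have h3 : ∀ i ∈ Finset.univ,
          distToInt (((Δ * c i : ℤ) : ℝ) * ((q : ℝ) ^ 2 * ∑ j, K i j * α j)) ≤
            B ^ 30 * (1 / ((B : ℝ) ^ 60 * L ^ 2)) := by
        intro i _
        refine (distToInt_intCast_mul_le _ _).trans ?_
        refine mul_le_mul ?_ (hKα i) (distToInt_nonneg _) (by positivity)
        have h4 : |(Δ * c i : ℤ)| ≤ (B : ℤ) ^ 30 := by
          rw [abs_mul, Nat.abs_cast]
          have h5 : |c i| ≤ (B : ℤ) ^ 20 := (hc i).trans (by exact_mod_cast hcbound)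
          have h6 : (Δ : ℤ) ≤ (B : ℤ) ^ 10 := by exact_mod_cast hΔ
          calc (Δ : ℤ) * |c i| ≤ (B : ℤ) ^ 10 * (B : ℤ) ^ 20 := by gcongr
            _ = _ := by ring
        exact_mod_cast h4
      refine (Finset.sum_le_sum h3).trans ?_
      rw [Finset.sum_const, Finset.card_univ, Fintype.card_fin, nsmul_eq_mul]
      have : (r : ℝ) ≤ B := by exact_mod_cast hrB
      calc (r : ℝ) * (B ^ 30 * (1 / ((B : ℝ) ^ 60 * L ^ 2))) ≤
            B * (B ^ 30 * (1 / ((B : ℝ) ^ 60 * L ^ 2))) := by gcongr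
        _ = _ := by ring
    refine absurd hk (not_le.2 (lt_of_lt_of_le (neg_neg_of_pos hneg) ?_))
    refine Finset.sum_nonneg fun z hz => unitExp_re_nonneg ?_
    rw [Finset.mem_product, Finset.mem_range, Finset.mem_range] at hz
    have hz2 : ((z.1 + z.2 + 1 : ℕ) : ℝ) ≤ 2 * L := by
      exact_mod_cast (show z.1 + z.2 + 1 ≤ 2 * L by omega)
    have h1 := distToInt_intCast_mul_le (((z.1 + z.2 + 1 : ℕ) : ℤ) ^ 2) (θ k)
    rw [abs_of_nonneg (by positivity)] at h1
    push_cast at h1 hz2 ⊢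
    refine h1.trans ?_
    calc ((z.1 : ℝ) + (z.2 : ℝ) + 1) ^ 2 * distToInt (θ k) ≤
          (2 * (L : ℝ)) ^ 2 * ((B : ℝ) ^ 31 * (1 / ((B : ℝ) ^ 60 * L ^ 2))) := by
            have := distToInt_nonneg (θ k)
            gcongr
      _ = 4 / (B : ℝ) ^ 29 := by field_simp; norm_num
      _ ≤ 4 / (B : ℝ) ^ 1 := by gcongr <;> linarith
      _ ≤ 1 / 4 := by rw [pow_one, div_le_iff₀ (by linarith)]; linarith
  · refine htθ.trans ?_
    gcongr
    have : 80 * (8 * T ^ 2) ^ 5 ≤ B ^ 57 := by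
      calc 80 * (8 * T ^ 2) ^ 5 ≤ (B * B) * (B ^ 11) ^ 5 := by gcongr; nlinarith
        _ = B ^ 57 := by ring
    exact_mod_cast this

lemma exists_sq_recurrence {d M N : ℕ} (hd : 0 < d) (hM : 16 ≤ M) (hdM : d ≤ M)
    (hN : M ^ (300 * d ^ 2) ≤ N) (α : Fin d → ℝ) :
    ∃ n : ℕ, 1 ≤ n ∧ n ≤ N ∧ ∀ j, distToInt ((n : ℝ) ^ 2 * α j) ≤ 1 / M := by
  by_contra! hcon
  have hbad : ∀ n, 1 ≤ n → n ≤ N → ∃ j, 1 / (M : ℝ) ≤ distToInt ((n : ℝ) ^ 2 * α j) :=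
    fun n h1 h2 => (hcon n h1 h2).imp fun _ => le_of_lt
  have hMB : M ≤ M ^ d := Nat.le_self_pow hd.ne' M
  have hNW : ((M ^ d) ^ 100) ^ (d + 2) ≤ N := by
    refine le_trans ?_ hN
    rw [← pow_mul, ← pow_mul]
    exact Nat.pow_le_pow_right (by omega) (by nlinarith)
  have key : ∀ r ≤ d + 1, ∃ q : ℕ, 0 < q ∧ q ≤ ((M ^ d) ^ 100) ^ r ∧
      ∃ K : Fin r → Fin d → ℤ, (LinearIndependent ℝ fun i j => (K i j : ℝ)) ∧
        (∀ i j, |K i j| ≤ (M ^ 4 : ℕ)) ∧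
        ∀ i, distToInt ((q : ℝ) ^ 2 * ∑ j, K i j * α j) ≤
          1 / (((M : ℝ) ^ d) ^ 60 * (((M ^ d) ^ 100) ^ (d + 1 - r) : ℕ) ^ 2) := by
    intro r hr
    induction r with
    | zero =>
      exact ⟨1, one_pos, by simp, 0, linearIndependent_empty_type, fun i => i.elim0,
        fun i => i.elim0⟩
    | succ r ih =>
      obtain ⟨q, hq0, hq, K, hK, hKM, hKα⟩ := ih (by omega)
      have hsub : d + 1 - r = (d + 1 - (r + 1)) + 1 := by omega
      set s := d + 1 - (r + 1) with hs
      rw [hsub] at hKα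
      obtain ⟨Δ, t, k, hΔ0, hΔ, ht0, ht, hkM, hkspan, hkα⟩ :=
        exists_next_relation hd hM hdM (L := ((M ^ d) ^ 100) ^ (s + 1)) (by
          rw [← pow_mul (M ^ d) 100]
          exact Nat.pow_le_pow_right (by omega) (by omega)) hbad hq0 (by
          refine le_trans ?_ hNW
          calc (M ^ d) ^ 10 * q * (2 * ((M ^ d) ^ 100) ^ (s + 1)) ≤
                (M ^ d) ^ 10 * ((M ^ d) ^ 100) ^ r * (M ^ d * ((M ^ d) ^ 100) ^ (s + 1)) := by
                gcongr
                omega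
            _ = (M ^ d) ^ 11 * ((M ^ d) ^ 100) ^ (r + (s + 1)) := by ring
            _ ≤ (M ^ d) ^ 100 * ((M ^ d) ^ 100) ^ (r + (s + 1)) := by
                gcongr <;> omega
            _ = ((M ^ d) ^ 100) ^ (d + 2) := by
                rw [← pow_succ']
                congr 1
                omega) hK hKM hKα
      have hBdef : ((M ^ d : ℕ) : ℝ) = (M : ℝ) ^ d := by push_cast; rfl
      set B := M ^ d with hB
      rw [← hBdef] at hKα hkα ⊢
      have hB1 : 1 ≤ B := by omega
      have hBr : (1 : ℝ) ≤ B := by exact_mod_cast hB1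
      have hΔr : (Δ : ℝ) ≤ B ^ 10 := by exact_mod_cast hΔ
      have htr : (t : ℝ) ≤ B ^ 12 := by exact_mod_cast ht
      set L := (B ^ 100) ^ s with hL
      have hLL : (((B ^ 100) ^ (s + 1) : ℕ) : ℝ) = B ^ 100 * L := by rw [hL]; push_cast; ring
      have hLr : (0 : ℝ) < L := by rw [hL]; positivity
      rw [hLL] at hKα hkα
      refine ⟨t * (Δ * q), by positivity, ?_, Fin.snoc K k, ?_, fun i => ?_, fun i => ?_⟩
      · calc t * (Δ * q) ≤ B ^ 12 * (B ^ 10 * (B ^ 100) ^ r) := by gcongr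
          _ = B ^ 22 * (B ^ 100) ^ r := by ring
          _ ≤ B ^ 100 * (B ^ 100) ^ r := by gcongr; omega
          _ = _ := by ring
      · have h1 : (fun (i : Fin (r + 1)) (j : Fin d) =>
            (((Fin.snoc K k : Fin (r + 1) → Fin d → ℤ) i j : ℤ) : ℝ)) =
            Fin.snoc (fun i j => (K i j : ℝ)) (fun j => (k j : ℝ)) := by
          funext i
          refine Fin.lastCases ?_ (fun i => ?_) i
          · simp
          · simp
        exact h1 ▸ linearIndependent_finSnoc.2 ⟨hK, hkspan⟩
      · refine Fin.lastCases ?_ (fun i => ?_) i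
        · simpa using hkM
        · simpa using hKM i
      · refine Fin.lastCases ?_ (fun i => ?_) i
        · rw [Fin.snoc_last]
          have h1 : ((t * (Δ * q) : ℕ) : ℝ) ^ 2 * ∑ j, (k j : ℝ) * α j =
              ((t : ℤ) : ℝ) * (t * (((Δ * q : ℕ) : ℝ) ^ 2 * ∑ j, (k j : ℝ) * α j)) := by
            push_cast; ring
          rw [h1]
          refine (distToInt_intCast_mul_le _ _).trans ?_
          rw [Int.cast_natCast, Nat.abs_cast]
          calc (t : ℝ) * _ ≤ B ^ 12 * ((B : ℝ) ^ 57 / (B ^ 100 * L) ^ 2) :=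
                mul_le_mul htr hkα (distToInt_nonneg _) (by positivity)
            _ = 1 / (B ^ 131 * L ^ 2) := by field_simp
            _ ≤ _ := by gcongr; first | exact hBr | norm_num
        · rw [Fin.snoc_castSucc]
          have h1 : ((t * (Δ * q) : ℕ) : ℝ) ^ 2 * ∑ j, (K i j : ℝ) * α j =
              (((t * Δ : ℕ) ^ 2 : ℤ) : ℝ) * ((q : ℝ) ^ 2 * ∑ j, (K i j : ℝ) * α j) := by
            push_cast; ring
          rw [h1]
          refine (distToInt_intCast_mul_le _ _).trans ?_
          rw [abs_of_nonneg (by positivity)]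
          push_cast
          calc ((t : ℝ) * Δ) ^ 2 * _ ≤
                (B ^ 12 * B ^ 10) ^ 2 * (1 / ((B : ℝ) ^ 60 * (B ^ 100 * L) ^ 2)) :=
                mul_le_mul (by gcongr) (hKα i) (distToInt_nonneg _) (by positivity)
            _ = 1 / (B ^ 216 * L ^ 2) := by field_simp
            _ ≤ _ := by gcongr; first | exact hBr | norm_num
  obtain ⟨q, -, -, K, hK, -⟩ := key (d + 1) le_rfl
  have := hK.fintype_card_le_finrank
  simp at this

/-- **Schmidt's simultaneous quadratic recurrence.** There are absolute constants `c, C > 0`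
such that for any reals `α₁,…,α_d` and integer `N ≥ 1` there exists `1 ≤ n ≤ N` with
`‖n² αⱼ‖_{ℝ/ℤ} ≤ C d N^{-c/d²}` for all `j`. -/
theorem stmt_6 :
    ∃ c C : ℝ, 0 < c ∧ 0 < C ∧ ∀ (d : ℕ), 0 < d → ∀ (α : Fin d → ℝ) (N : ℕ), 1 ≤ N →
      ∃ n : ℕ, 1 ≤ n ∧ n ≤ N ∧
        ∀ j : Fin d, distToInt ((n : ℝ) ^ 2 * α j) ≤ C * d * (N : ℝ) ^ (-c / (d : ℝ) ^ 2) := by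
  refine ⟨1 / 300, 16, by norm_num, by norm_num, fun d hd α N hN => ?_⟩
  have hdr : (1 : ℝ) ≤ d := by exact_mod_cast hd
  have hNr : (1 : ℝ) ≤ N := by exact_mod_cast hN
  set x : ℝ := (N : ℝ) ^ ((1 / 300 : ℝ) / (d : ℝ) ^ 2) with hx
  have hx0 : 0 < x := by positivity
  have hinv : (N : ℝ) ^ (-(1 / 300 : ℝ) / (d : ℝ) ^ 2) = x⁻¹ := by
    rw [neg_div, Real.rpow_neg (by positivity)]
  rw [hinv]
  by_cases hsmall : x < 16 * d
  · refine ⟨1, le_rfl, hN, fun j => (distToInt_le_half _).trans ?_⟩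
    rw [← div_eq_mul_inv, le_div_iff₀ hx0]
    linarith
  push Not at hsmall
  set M := ⌊x⌋₊ with hMdef
  have hMx : (M : ℝ) ≤ x := Nat.floor_le hx0.le
  have hM : 16 * d ≤ M := Nat.le_floor (by exact_mod_cast hsmall)
  have hxpow : x ^ (300 * d ^ 2) = N := by
    rw [hx, ← Real.rpow_natCast, ← Real.rpow_mul (by positivity)]
    convert Real.rpow_one (N : ℝ) using 2
    push_cast
    field_simp
  obtain ⟨n, h1, h2, h3⟩ := exists_sq_recurrence (M := M) (N := N) hd (by omega) (by omega) (by
    have : (M : ℝ) ^ (300 * d ^ 2) ≤ N := hxpow ▸ pow_le_pow_left₀ (by positivity) hMx _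
    exact_mod_cast this) α
  refine ⟨n, h1, h2, fun j => (h3 j).trans ?_⟩
  have hM0 : (0 : ℝ) < M := by exact_mod_cast (show 0 < M by omega)
  have hM1 : (1 : ℝ) ≤ M := by exact_mod_cast (show 1 ≤ M by omega)
  have hxM := Nat.lt_floor_add_one x
  rw [← div_eq_mul_inv, div_le_div_iff₀ hM0 hx0]
  nlinarith
end

section
/- Let $\Lambda \subseteq \mathbb{R}^d$ be a full-rank lattice with $\det(\Lambda) \ge 1$, let $\alpha \in \mathbb{R}^d$, and let $N > 0$ be an integer. Then $F_{\Lambda,\alpha}(N) \ge c\, d^{-Cd} A_\Lambda^{-Cd}$ for absolute constants $c, C > 0$, where $A_\Lambda := \sum_{\xi \in \Lambda^*} e^{-\pi|\xi|^2}$. -/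
open Real Finset

/-- The squared Euclidean norm on `ℝ^d`. -/
noncomputable def normSq {d : ℕ} (v : Fin d → ℝ) : ℝ := ∑ i, v i ^ 2

/-- The point of the lattice `B·ℤ^d` with coordinates `m`. -/
noncomputable def latticePt {d : ℕ} (B : Matrix (Fin d) (Fin d) ℝ) (m : Fin d → ℤ) :
    Fin d → ℝ := B.mulVec (fun i => (m i : ℝ))

/-- `F_{Λ,α}(N) = det(Λ) 𝔼_{-N ≤ n ≤ N} ∑_{m ∈ Λ} e^{-π|n²α - m|²}` for the lattice
`Λ = B·ℤ^d`, the expectation being the average over integers `n ∈ [-N, N]`. -/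
noncomputable def latticeF {d : ℕ} (B : Matrix (Fin d) (Fin d) ℝ) (α : Fin d → ℝ)
    (N : ℝ) : ℝ :=
  |B.det| * (∑ n ∈ Finset.Icc ⌈-N⌉ ⌊N⌋, ∑' m : Fin d → ℤ,
      Real.exp (-π * normSq (fun i => (n : ℝ) ^ 2 * α i - latticePt B m i))) /
    (Finset.Icc ⌈-N⌉ ⌊N⌋).card

/-- The point of the dual lattice `(Bᵀ)⁻¹·ℤ^d` of `B·ℤ^d` with coordinates `k`. -/
noncomputable def dualPt {d : ℕ} (B : Matrix (Fin d) (Fin d) ℝ) (k : Fin d → ℤ) :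
    Fin d → ℝ := (B.transpose)⁻¹.mulVec (fun i => (k i : ℝ))

/-- `A_Λ = ∑_{ξ ∈ Λ*} e^{-π|ξ|²}` for the lattice `Λ = B·ℤ^d`. -/
noncomputable def latticeA {d : ℕ} (B : Matrix (Fin d) (Fin d) ℝ) : ℝ :=
  ∑' k : Fin d → ℤ, Real.exp (-π * normSq (dualPt B k))

section LatticeSums

theorem summable_exp_neg_mul_int_sq {c : ℝ} (hc : 0 < c) :
    Summable fun n : ℤ => Real.exp (-c * (n : ℝ) ^ 2) := by
  have hN : Summable fun n : ℕ => Real.exp (-c * (n : ℝ) ^ 2) := by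
    refine Summable.of_nonneg_of_le (fun n => (Real.exp_pos _).le) (fun n => ?_)
      (Real.summable_exp_nat_mul_of_ge (neg_lt_zero.mpr hc) (f := fun n => (n : ℝ) ^ 2) fun n => ?_)
    · exact le_rfl
    · exact_mod_cast Nat.le_self_pow two_ne_zero n
  exact Summable.of_nat_of_neg (by simpa using hN) (by simpa using hN)

theorem summable_prod_apply {d : ℕ} {f : ℤ → ℝ} (hf0 : ∀ n, 0 ≤ f n) (hf : Summable f) :
    Summable fun m : Fin d → ℤ => ∏ i, f (m i) := by
  classical
  refine summable_of_sum_le (c := ∏ _i : Fin d, ∑' n, f n)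
    (fun _ => Finset.prod_nonneg fun _ _ => hf0 _) fun s => ?_
  calc ∑ m ∈ s, ∏ i, f (m i)
      ≤ ∑ m ∈ Fintype.piFinset fun i => s.image fun m => m i, ∏ i, f (m i) := by
        refine Finset.sum_le_sum_of_subset_of_nonneg (fun m hm => ?_)
          fun _ _ _ => Finset.prod_nonneg fun _ _ => hf0 _
        exact Fintype.mem_piFinset.mpr fun i => Finset.mem_image_of_mem _ hm
    _ = ∏ i : Fin d, ∑ n ∈ s.image fun m => m i, f n := (Finset.prod_univ_sum _ _).symm
    _ ≤ _ := Finset.prod_le_prod (fun _ _ => Finset.sum_nonneg fun n _ => hf0 n)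
        fun _ _ => hf.sum_le_tsum _ fun n _ => hf0 n

theorem normSq_nonneg {d : ℕ} (v : Fin d → ℝ) : 0 ≤ normSq v :=
  Finset.sum_nonneg fun _ _ => sq_nonneg _

theorem normSq_mulVec_le {d : ℕ} (B : Matrix (Fin d) (Fin d) ℝ) (v : Fin d → ℝ) :
    normSq (B.mulVec v) ≤ (∑ i, ∑ j, B i j ^ 2) * normSq v := by
  unfold normSq
  rw [Finset.sum_mul]
  exact Finset.sum_le_sum fun i _ => by
    simpa only [Matrix.mulVec, dotProduct] using Finset.sum_mul_sq_le_sq_mul_sq Finset.univ (B i) v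

theorem exists_mul_normSq_le_mulVec {d : ℕ} {B : Matrix (Fin d) (Fin d) ℝ} (hB : B.det ≠ 0) :
    ∃ b : ℝ, 0 < b ∧ ∀ v, b * normSq v ≤ normSq (B.mulVec v) := by
  have hS : 0 ≤ ∑ i, ∑ j, B⁻¹ i j ^ 2 :=
    Finset.sum_nonneg fun i _ => Finset.sum_nonneg fun j _ => sq_nonneg _
  refine ⟨1 / (∑ i, ∑ j, B⁻¹ i j ^ 2 + 1), by positivity, fun v => ?_⟩
  have h := normSq_mulVec_le B⁻¹ (B.mulVec v)
  rw [Matrix.mulVec_mulVec, Matrix.nonsing_inv_mul B (isUnit_iff_ne_zero.mpr hB),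
    Matrix.one_mulVec] at h
  rw [one_div, inv_mul_le_iff₀ (by positivity)]
  nlinarith [normSq_nonneg (B.mulVec v)]

theorem summable_exp_neg_mul_normSq_mulVec {d : ℕ} {B : Matrix (Fin d) (Fin d) ℝ}
    (hB : B.det ≠ 0) {c : ℝ} (hc : 0 < c) :
    Summable fun m : Fin d → ℤ => Real.exp (-c * normSq (B.mulVec fun i => (m i : ℝ))) := by
  obtain ⟨b, hb, hbB⟩ := exists_mul_normSq_le_mulVec hB
  refine Summable.of_nonneg_of_le (fun m => (Real.exp_pos _).le) (fun m => ?_)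
    (summable_prod_apply (fun n => (Real.exp_pos _).le)
      (summable_exp_neg_mul_int_sq (mul_pos hc hb)))
  rw [← Real.exp_sum]
  refine Real.exp_le_exp.mpr ?_
  rw [← Finset.mul_sum]
  have := mul_le_mul_of_nonneg_left (hbB fun i => (m i : ℝ)) hc.le
  unfold normSq at this ⊢
  linarith

theorem normSq_add_ge {d : ℕ} (v w : Fin d → ℝ) :
    normSq w / 2 - normSq v ≤ normSq (v + w) := by
  unfold normSq
  rw [Finset.sum_div, ← Finset.sum_sub_distrib]
  refine Finset.sum_le_sum fun i _ => ?_
  rw [Pi.add_apply]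
  nlinarith [sq_nonneg (2 * v i + w i)]

theorem continuous_normSq {d : ℕ} : Continuous (normSq : (Fin d → ℝ) → ℝ) := by
  unfold normSq; fun_prop

end LatticeSums

section Poisson

open MeasureTheory

theorem hasSum_setIntegral_translate {d : ℕ} {E : Type*} [NormedAddCommGroup E] [NormedSpace ℝ E]
    {f : (Fin d → ℝ) → E} (hf : Integrable f) :
    HasSum (fun m : Fin d → ℤ => ∫ y in {x : Fin d → ℝ | ∀ i, x i ∈ Set.Ioc (0 : ℝ) (0 + 1)},
      f (y + fun i => (m i : ℝ))) (∫ y, f y) := by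
  set box : (Fin d → ℤ) → Set (Fin d → ℝ) :=
    fun m => {x | ∀ i, x i ∈ Set.Ioc (m i : ℝ) (m i + 1)} with hbox
  have hmeas : ∀ m, MeasurableSet (box m) := fun m =>
    MeasurableSet.univ_pi' fun i => measurableSet_Ioc
  have hdisj : Pairwise (Function.onFun Disjoint box) := by
    intro m m' hmm
    refine Set.disjoint_left.mpr fun x hx hx' => hmm (funext fun i => ?_)
    have h1 := hx i
    have h2 := hx' i
    have h3 : (m i : ℝ) < m' i + 1 := h1.1.trans_le h2.2
    have h4 : (m' i : ℝ) < m i + 1 := h2.1.trans_le h1.2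
    norm_cast at h3 h4
    omega
  have hunion : ⋃ m, box m = Set.univ := by
    refine Set.eq_univ_of_forall fun x => Set.mem_iUnion.mpr ⟨fun i => ⌈x i⌉ - 1, fun i => ?_⟩
    push_cast
    exact ⟨by linarith [Int.ceil_lt_add_one (x i)], by linarith [Int.le_ceil (x i)]⟩
  have h := hasSum_integral_iUnion hmeas hdisj hf.integrableOn
  rw [hunion, setIntegral_univ] at h
  convert! h using 2 with m
  have := (measurePreserving_add_right volume (fun i => (m i : ℝ))).setIntegral_preimage_emb
    (MeasurableEquiv.addRight (fun i => (m i : ℝ))).measurableEmbedding f (box m)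
  rw [← this]
  congr 2
  ext x
  simp [hbox, add_comm (x _) (m _ : ℝ)]

theorem mFourier_coe {d : ℕ} (k : Fin d → ℤ) (y : Fin d → ℝ) :
    UnitAddTorus.mFourier k (fun i => (y i : UnitAddCircle)) =
      Complex.exp (∑ i, 2 * π * Complex.I * k i * y i) := by
  simp only [UnitAddTorus.mFourier, ContinuousMap.coe_mk, fourier_coe_apply]
  rw [Complex.exp_sum]
  simp

/-- The Fourier coefficients of the periodization of `f` over `ℤ^d`. -/
theorem mFourierCoeff_periodization {d : ℕ} {f : (Fin d → ℝ) → ℂ} (hf : Integrable f)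
    {Ψ : UnitAddTorus (Fin d) → ℂ}
    (hΨ : ∀ y : Fin d → ℝ, HasSum (fun m : Fin d → ℤ => f (y + fun i => (m i : ℝ)))
      (Ψ fun i => (y i : UnitAddCircle))) (k : Fin d → ℤ) :
    UnitAddTorus.mFourierCoeff Ψ k =
      ∫ y, Complex.exp (∑ i, 2 * π * Complex.I * ((-k) i : ℤ) * y i) * f y := by
  have hnorm : ∀ y : Fin d → ℝ,
      ‖Complex.exp (∑ i, 2 * π * Complex.I * ((-k) i : ℤ) * y i)‖ = 1 := by
    intro y
    have : (∑ i, 2 * π * Complex.I * ((-k) i : ℤ) * y i : ℂ) =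
        ((∑ i, 2 * π * ((-k) i : ℤ) * y i : ℝ) : ℂ) * Complex.I := by
      push_cast
      rw [Finset.sum_mul]
      exact Finset.sum_congr rfl fun i _ => by ring
    rw [this, Complex.norm_exp_ofReal_mul_I]
  have hcont : Continuous fun y : Fin d → ℝ =>
      Complex.exp (∑ i, 2 * π * Complex.I * ((-k) i : ℤ) * y i) := by fun_prop
  set g : (Fin d → ℝ) → ℂ :=
    fun y => Complex.exp (∑ i, 2 * π * Complex.I * ((-k) i : ℤ) * y i) * f y with hg
  have hgi : Integrable g := by
    refine hf.bdd_mul (c := 1) hcont.aestronglyMeasurable ?_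
    exact Filter.Eventually.of_forall fun y => (hnorm y).le
  have hper : ∀ (y : Fin d → ℝ) (m : Fin d → ℤ), g (y + fun i => (m i : ℝ)) =
      Complex.exp (∑ i, 2 * π * Complex.I * ((-k) i : ℤ) * y i) *
        f (y + fun i => (m i : ℝ)) := by
    intro y m
    simp only [hg]
    congr 1
    rw [Complex.exp_eq_exp_iff_exists_int]
    refine ⟨∑ i, (-k) i * m i, ?_⟩
    push_cast
    rw [Finset.sum_mul, ← Finset.sum_add_distrib]
    refine Finset.sum_congr rfl fun i _ => ?_
    simp only [Pi.add_apply]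
    push_cast
    ring
  rw [UnitAddTorus.mFourierCoeff_eq_integral Ψ k 0]
  have h1 := hasSum_setIntegral_translate hgi
  have h1n := (hasSum_setIntegral_translate hgi.norm).summable
  have h2 := hasSum_integral_of_summable_integral_norm (μ := volume.restrict
    {x : Fin d → ℝ | ∀ i, x i ∈ Set.Ioc (0 : ℝ) (0 + 1)})
    (F := fun (m : Fin d → ℤ) y => g (y + fun i => (m i : ℝ)))
    (fun m => (hgi.comp_add_right _).integrableOn) h1n
  rw [← h2.unique h1]
  refine integral_congr_ae (Filter.Eventually.of_forall fun y => ?_)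
  simp only [hper, mFourier_coe, smul_eq_mul]
  rw [tsum_mul_left, (hΨ y).tsum_eq]

end Poisson

section GaussianPoisson

open MeasureTheory

theorem dualPt_dotProduct_mulVec {d : ℕ} {B : Matrix (Fin d) (Fin d) ℝ} (hB : B.det ≠ 0)
    (k : Fin d → ℤ) (y : Fin d → ℝ) :
    ∑ i, dualPt B k i * B.mulVec y i = ∑ i, (k i : ℝ) * y i := by
  have h1 : B.transpose.mulVec (dualPt B k) = fun i => (k i : ℝ) := by
    unfold dualPt
    rw [Matrix.mulVec_mulVec, Matrix.mul_nonsing_inv _ (by simpa using hB), Matrix.one_mulVec]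
  change dotProduct (dualPt B k) (B.mulVec y) = dotProduct (fun i => (k i : ℝ)) y
  rw [Matrix.dotProduct_mulVec, ← Matrix.mulVec_transpose, h1]

theorem summable_exp_neg_mul_normSq_dualPt {d : ℕ} {B : Matrix (Fin d) (Fin d) ℝ}
    (hB : B.det ≠ 0) {c : ℝ} (hc : 0 < c) :
    Summable fun k : Fin d → ℤ => Real.exp (-c * normSq (dualPt B k)) := by
  refine summable_exp_neg_mul_normSq_mulVec (B := (B.transpose)⁻¹) ?_ hc
  rw [Matrix.det_nonsing_inv, Matrix.det_transpose, Ring.inverse_eq_inv']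
  exact inv_ne_zero hB

/-- The Gaussian twisted by a dual lattice character. -/
noncomputable def twistedGaussian {d : ℕ} (w : Fin d → ℝ) (x : Fin d → ℝ) : ℂ :=
  Complex.exp (-π * ∑ i, (x i : ℂ) ^ 2 + ∑ i, (-2 * π * Complex.I * w i) * x i)

theorem continuous_twistedGaussian {d : ℕ} (w : Fin d → ℝ) : Continuous (twistedGaussian w) := by
  unfold twistedGaussian; fun_prop

theorem integrable_twistedGaussian {d : ℕ} (w : Fin d → ℝ) : Integrable (twistedGaussian w) :=
  GaussianFourier.integrable_cexp_neg_mul_sum_add (by simpa using Real.pi_pos) _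

theorem integral_twistedGaussian {d : ℕ} (w : Fin d → ℝ) :
    ∫ x, twistedGaussian w x = (Real.exp (-π * normSq w) : ℂ) := by
  unfold twistedGaussian
  have hpi : (π : ℂ) ≠ 0 := by exact_mod_cast Real.pi_ne_zero
  rw [GaussianFourier.integral_cexp_neg_mul_sum_add (by simpa using Real.pi_pos), div_self hpi,
    Complex.one_cpow, one_mul, Complex.ofReal_exp]
  congr 1
  unfold normSq
  push_cast
  rw [Finset.mul_sum, Finset.sum_div]
  refine Finset.sum_congr rfl fun i _ => ?_
  field_simp
  linear_combination 4 * (w i : ℂ) ^ 2 * Complex.I_sq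

theorem integrable_comp_mulVec {d : ℕ} {B : Matrix (Fin d) (Fin d) ℝ} (hB : B.det ≠ 0)
    {f : (Fin d → ℝ) → ℂ} (hf : Integrable f) (hfc : Continuous f) :
    Integrable fun y => f (B.mulVec y) := by
  have hlin : Continuous (Matrix.toLin' B) := LinearMap.continuous_of_finiteDimensional _
  have hmap := Real.map_matrix_volume_pi_eq_smul_volume_pi hB
  refine (integrable_map_measure (f := Matrix.toLin' B) (g := f) (μ := volume)
    hfc.aestronglyMeasurable hlin.aemeasurable).mp ?_
  rw [hmap]
  exact hf.smul_measure ENNReal.ofReal_ne_top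

theorem integral_comp_mulVec {d : ℕ} {B : Matrix (Fin d) (Fin d) ℝ} (hB : B.det ≠ 0)
    {f : (Fin d → ℝ) → ℂ} (hfc : Continuous f) :
    ∫ y, f (B.mulVec y) = ((|B.det|⁻¹ : ℝ) : ℂ) * ∫ x, f x := by
  have hlin : Continuous (Matrix.toLin' B) := LinearMap.continuous_of_finiteDimensional _
  have hmap := Real.map_matrix_volume_pi_eq_smul_volume_pi hB
  have h := integral_map (φ := Matrix.toLin' B) (f := f) (μ := volume)
    hlin.aemeasurable hfc.aestronglyMeasurable
  rw [hmap, integral_smul_measure, ENNReal.toReal_ofReal (abs_nonneg _)] at h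
  rw [← abs_inv, ← Complex.real_smul, h]
  rfl

theorem normSq_mulVec_add {d : ℕ} (B : Matrix (Fin d) (Fin d) ℝ) (y : Fin d → ℝ)
    (m : Fin d → ℤ) :
    Real.exp (-π * normSq (B.mulVec (y + fun i => (m i : ℝ)))) ≤
      Real.exp (π * normSq (B.mulVec y)) *
        Real.exp (-(π / 2) * normSq (B.mulVec fun i => (m i : ℝ))) := by
  rw [← Real.exp_add]
  refine Real.exp_le_exp.mpr ?_
  rw [Matrix.mulVec_add]
  nlinarith [mul_le_mul_of_nonneg_left (normSq_add_ge (B.mulVec y) (B.mulVec fun i => (m i : ℝ)))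
    Real.pi_pos.le]

theorem summable_exp_neg_normSq_translate {d : ℕ} {B : Matrix (Fin d) (Fin d) ℝ}
    (hB : B.det ≠ 0) (y : Fin d → ℝ) :
    Summable fun m : Fin d → ℤ =>
      Real.exp (-π * normSq (B.mulVec (y + fun i => (m i : ℝ)))) :=
  Summable.of_nonneg_of_le (fun _ => (Real.exp_pos _).le) (fun m => normSq_mulVec_add B y m)
    ((summable_exp_neg_mul_normSq_mulVec hB (by positivity)).mul_left _)

theorem continuous_tsum_exp_neg_normSq_translate {d : ℕ} {B : Matrix (Fin d) (Fin d) ℝ}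
    (hB : B.det ≠ 0) :
    Continuous fun y : Fin d → ℝ => ∑' m : Fin d → ℤ,
      Real.exp (-π * normSq (B.mulVec (y + fun i => (m i : ℝ)))) := by
  have hc : Continuous fun y : Fin d → ℝ => normSq (B.mulVec y) :=
    continuous_normSq.comp (Continuous.matrix_mulVec continuous_const continuous_id)
  refine continuous_iff_continuousAt.mpr fun y₀ => ?_
  set s : Set (Fin d → ℝ) := {y | normSq (B.mulVec y) < normSq (B.mulVec y₀) + 1} with hs
  have hs_nhds : s ∈ nhds y₀ :=
    (isOpen_lt hc continuous_const).mem_nhds (by simp)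
  refine ContinuousOn.continuousAt (s := s) ?_ hs_nhds
  refine continuousOn_tsum (u := fun m : Fin d → ℤ =>
    Real.exp (π * (normSq (B.mulVec y₀) + 1)) *
      Real.exp (-(π / 2) * normSq (B.mulVec fun i => (m i : ℝ)))) (fun m => ?_)
    ((summable_exp_neg_mul_normSq_mulVec hB (by positivity)).mul_left _) fun m y hy => ?_
  · refine Continuous.continuousOn ?_
    have := hc.comp (continuous_id.add (continuous_const (y := fun i => (m i : ℝ))))
    exact Real.continuous_exp.comp (continuous_const.mul this)
  · rw [Real.norm_of_nonneg (Real.exp_pos _).le]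
    refine (normSq_mulVec_add B y m).trans ?_
    have : normSq (B.mulVec y) ≤ normSq (B.mulVec y₀) + 1 := le_of_lt hy
    gcongr

theorem exists_continuousMap_torus {d : ℕ} {P : (Fin d → ℝ) → ℂ} (hP : Continuous P)
    (hper : ∀ (y : Fin d → ℝ) (m : Fin d → ℤ), P (y + fun i => (m i : ℝ)) = P y) :
    ∃ Ψ : C(UnitAddTorus (Fin d), ℂ), ∀ y : Fin d → ℝ,
      Ψ (fun i => (y i : UnitAddCircle)) = P y := by
  have hq : IsOpenQuotientMap (Pi.map fun (_ : Fin d) (x : ℝ) => (x : UnitAddCircle)) :=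
    IsOpenQuotientMap.piMap fun _ => QuotientAddGroup.isOpenQuotientMap_mk
  have hfac : Function.FactorsThrough P
      (Pi.map fun (_ : Fin d) (x : ℝ) => (x : UnitAddCircle)) := by
    intro y y' h
    have h' : ∀ i, ∃ n : ℤ, n • (1 : ℝ) = y i - y' i := fun i => by
      have := congrFun h i
      simp only [Pi.map_apply] at this
      rw [← AddCircle.coe_eq_zero_iff, AddCircle.coe_sub, this, sub_self]
    choose n hn using h'
    have : y = y' + fun i => (n i : ℝ) := by
      funext i
      have := hn i
      simp only [zsmul_eq_mul, mul_one] at this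
      rw [Pi.add_apply, this]
      ring
    rw [this, hper]
  let pr : C(Fin d → ℝ, UnitAddTorus (Fin d)) := ⟨_, hq.continuous⟩
  have hpr : Topology.IsQuotientMap pr := hq.isQuotientMap
  refine ⟨hpr.lift ⟨P, hP⟩ hfac, fun y => ?_⟩
  exact DFunLike.congr_fun (hpr.lift_comp ⟨P, hP⟩ hfac) y

/-- **Poisson summation** for the Gaussian over the lattice `B·ℤ^d`. -/
theorem gaussian_poisson {d : ℕ} {B : Matrix (Fin d) (Fin d) ℝ} (hB : B.det ≠ 0)
    (x : Fin d → ℝ) :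
    |B.det| * ∑' m : Fin d → ℤ, Real.exp (-π * normSq (fun i => x i - latticePt B m i)) =
      ∑' k : Fin d → ℤ, Real.exp (-π * normSq (dualPt B k)) *
        Real.cos (2 * π * ∑ i, dualPt B k i * x i) := by
  have hdet : 0 < |B.det| := abs_pos.mpr hB
  set P : (Fin d → ℝ) → ℝ := fun y => ∑' m : Fin d → ℤ,
    Real.exp (-π * normSq (B.mulVec (y + fun i => (m i : ℝ)))) with hPdef
  have hPper : ∀ (y : Fin d → ℝ) (m : Fin d → ℤ), P (y + fun i => (m i : ℝ)) = P y := by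
    intro y m
    simp only [hPdef]
    rw [← (Equiv.addLeft m).tsum_eq fun m' : Fin d → ℤ =>
      Real.exp (-π * normSq (B.mulVec (y + fun i => (m' i : ℝ))))]
    refine tsum_congr fun m' => ?_
    congr 4
    funext i
    simp [add_assoc]
  obtain ⟨Ψ, hΨ⟩ := exists_continuousMap_torus (P := fun y => (P y : ℂ))
    (Complex.continuous_ofReal.comp (continuous_tsum_exp_neg_normSq_translate hB))
    (fun y m => by simp only [hPper])
  have hg : ∀ y, ((Real.exp (-π * normSq (B.mulVec y)) : ℝ) : ℂ) =
      twistedGaussian 0 (B.mulVec y) := by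
    intro y
    simp [twistedGaussian, normSq]
  have hfi : Integrable fun y : Fin d → ℝ =>
      ((Real.exp (-π * normSq (B.mulVec y)) : ℝ) : ℂ) := by
    simp only [hg]
    exact integrable_comp_mulVec hB (integrable_twistedGaussian 0) (continuous_twistedGaussian 0)
  have hcoeff : ∀ k : Fin d → ℤ, UnitAddTorus.mFourierCoeff Ψ k =
      ((|B.det|⁻¹ * Real.exp (-π * normSq (dualPt B k)) : ℝ) : ℂ) := by
    intro k
    rw [mFourierCoeff_periodization hfi (Ψ := Ψ) (fun y => ?_) k]
    · rw [Complex.ofReal_mul, ← integral_twistedGaussian,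
        ← integral_comp_mulVec hB (continuous_twistedGaussian _)]
      congr 1 with y
      rw [hg, twistedGaussian, twistedGaussian, ← Complex.exp_add]
      congr 1
      have h := dualPt_dotProduct_mulVec hB k y
      have h' : (∑ i, (dualPt B k i : ℂ) * (B.mulVec y i : ℂ)) = ∑ i, (k i : ℂ) * (y i : ℂ) := by
        exact_mod_cast congrArg (fun t : ℝ => (t : ℂ)) h
      have e1 : ∑ i, 2 * π * Complex.I * ((-k) i : ℤ) * (y i : ℂ) =
          -2 * π * Complex.I * ∑ i, (k i : ℂ) * (y i : ℂ) := by
        rw [Finset.mul_sum]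
        refine Finset.sum_congr rfl fun i _ => ?_
        simp only [Pi.neg_apply]
        push_cast
        ring
      have e2 : ∑ i, (-2 * π * Complex.I * (dualPt B k i : ℂ)) * (B.mulVec y i : ℂ) =
          -2 * π * Complex.I * ∑ i, (dualPt B k i : ℂ) * (B.mulVec y i : ℂ) := by
        rw [Finset.mul_sum]
        exact Finset.sum_congr rfl fun i _ => by ring
      rw [e1, e2, h']
      simp
      ring
    · rw [hΨ]
      exact (Complex.hasSum_ofReal.mpr (summable_exp_neg_normSq_translate hB y).hasSum)
  have hsum : Summable (UnitAddTorus.mFourierCoeff Ψ) := by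
    rw [show UnitAddTorus.mFourierCoeff Ψ = _ from funext hcoeff]
    exact Complex.summable_ofReal.mpr
      ((summable_exp_neg_mul_normSq_dualPt hB Real.pi_pos).mul_left _)
  set y : Fin d → ℝ := B⁻¹.mulVec x with hy
  have hBy : B.mulVec y = x := by
    rw [hy, Matrix.mulVec_mulVec, Matrix.mul_nonsing_inv B (isUnit_iff_ne_zero.mpr hB),
      Matrix.one_mulVec]
  have hF := UnitAddTorus.hasSum_mFourier_series_apply_of_summable hsum
    fun i => (y i : UnitAddCircle)
  rw [hΨ] at hF
  have hFre := Complex.hasSum_re hF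
  rw [Complex.ofReal_re] at hFre
  have hPx : P y = ∑' m : Fin d → ℤ, Real.exp (-π * normSq (fun i => x i - latticePt B m i)) := by
    simp only [hPdef]
    rw [← (Equiv.neg (Fin d → ℤ)).tsum_eq fun m : Fin d → ℤ =>
      Real.exp (-π * normSq (B.mulVec (y + fun i => (m i : ℝ))))]
    refine tsum_congr fun m => ?_
    congr 3
    have : (fun i => (((Equiv.neg (Fin d → ℤ)) m i : ℤ) : ℝ)) = -fun i => (m i : ℝ) := by
      funext i
      simp
    rw [this, Matrix.mulVec_add, Matrix.mulVec_neg, hBy]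
    rfl
  rw [← hPx, ← hFre.tsum_eq, ← tsum_mul_left]
  refine tsum_congr fun k => ?_
  rw [hcoeff, mFourier_coe, smul_eq_mul, Complex.re_ofReal_mul, ← mul_assoc, ← mul_assoc,
    mul_inv_cancel₀ hdet.ne', one_mul]
  congr 1
  have h := dualPt_dotProduct_mulVec hB k y
  rw [hBy] at h
  rw [h]
  have e : (∑ i, 2 * π * Complex.I * (k i : ℂ) * (y i : ℂ)) =
      ((2 * π * ∑ i, (k i : ℝ) * y i : ℝ) : ℂ) * Complex.I := by
    push_cast
    rw [Finset.mul_sum, Finset.sum_mul]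
    exact Finset.sum_congr rfl fun i _ => by ring
  rw [e, Complex.exp_ofReal_mul_I_re]

end GaussianPoisson

section Weyl

set_option maxHeartbeats 1000000 in
theorem exists_nat_mul_near_int {M : ℕ} (hM : 0 < M) {η φ : ℝ} (hη : 0 < η) (hη1 : η ≤ 1)
    (H : Finset ℤ) (hH : ∀ h ∈ H, |(h : ℝ)| ≤ 2 * M) (hcard : η * M ≤ #H)
    (hφ : ∀ h ∈ H, |h * φ - round (h * φ)| ≤ 1 / (η * M)) :
    ∃ q : ℕ, 0 < q ∧ (q : ℝ) ≤ 281 / η ^ 2 ∧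
      ∃ p : ℤ, |q * φ - p| ≤ 300000 / (η ^ 6 * M ^ 2) := by
  have hM' : (0 : ℝ) < M := Nat.cast_pos.mpr hM
  have hηM : 0 < η * M := by positivity
  have hη2 : η ^ 2 ≤ 1 := pow_le_one₀ hη.le hη1
  rcases lt_or_ge (η ^ 3 * M) 750 with hsmall | hlarge
  · refine ⟨1, one_pos, ?_, round φ, ?_⟩
    · rw [le_div_iff₀ (by positivity)]
      norm_num
      linarith
    · have h1 : |φ - round φ| ≤ 1 / 2 := abs_sub_round φ
      have h2 : (1 : ℝ) / 2 ≤ 300000 / (η ^ 6 * M ^ 2) := by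
        rw [le_div_iff₀ (by positivity)]
        have : η ^ 6 * M ^ 2 = (η ^ 3 * M) ^ 2 := by ring
        rw [this]
        have : 0 ≤ η ^ 3 * M := by positivity
        nlinarith
      simpa using h1.trans h2
  have hlarge1 : 750 ≤ η * (η * M) := by
    have : η ^ 3 * M ≤ η * (η * M) := by
      have : η ^ 3 * M = η * (η * (η * M)) := by ring
      rw [this]
      have h2 : η * (η * M) ≤ η * M := mul_le_of_le_one_left hηM.le hη1
      exact mul_le_mul_of_nonneg_left h2 hη.le
    linarith
  have hlarge2 : 750 ≤ η * M := hlarge1.trans (mul_le_of_le_one_left hηM.le hη1)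
  set e : ℤ → ℝ := fun h => h * φ - round (h * φ) with he
  set J : ℕ := ⌈16 / η⌉₊ with hJ
  set l : ℕ := ⌈280 / η ^ 2⌉₊ with hl
  have hJ1 : 16 / η ≤ J := Nat.le_ceil _
  have hJ2 : (J : ℝ) ≤ 17 / η := by
    have h1 : (J : ℝ) < 16 / η + 1 := Nat.ceil_lt_add_one (by positivity)
    have h2 : 1 ≤ 1 / η := (one_le_div hη).mpr hη1
    have h3 : 17 / η = 16 / η + 1 / η := by ring
    linarith
  have hl1 : 280 / η ^ 2 ≤ l := Nat.le_ceil _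
  have hl2 : (l : ℝ) ≤ 281 / η ^ 2 := by
    have h1 : (l : ℝ) < 280 / η ^ 2 + 1 := Nat.ceil_lt_add_one (by positivity)
    have h2 : 1 ≤ 1 / η ^ 2 := (one_le_div (by positivity)).mpr hη2
    have h3 : 281 / η ^ 2 = 280 / η ^ 2 + 1 / η ^ 2 := by ring
    linarith
  have hJ0 : (0 : ℝ) < J := lt_of_lt_of_le (by positivity) hJ1
  have hl0 : (0 : ℝ) < l := lt_of_lt_of_le (by positivity) hl1
  set A : ℕ := ⌊(2 * M : ℝ) / l⌋₊ + 1 with hA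
  have hA1 : (A : ℝ) ≤ 2 * M / l + 1 := by
    rw [hA]
    push_cast
    gcongr
    exact Nat.floor_le (by positivity)
  have hA2 : (2 * M : ℝ) / l < A := by
    rw [hA]
    push_cast
    exact Nat.lt_floor_add_one _
  have hcells : #((Finset.Icc (-(A : ℤ)) A) ×ˢ (Finset.Icc (-(J : ℤ)) J)) < #H := by
    rw [Finset.card_product, Int.card_Icc, Int.card_Icc]
    have e1 : ((A : ℤ) + 1 - -A).toNat = 2 * A + 1 := by omega
    have e2 : ((J : ℤ) + 1 - -J).toNat = 2 * J + 1 := by omega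
    rw [e1, e2]
    have : ((2 * A + 1 : ℕ) * (2 * J + 1 : ℕ) : ℝ) < η * M := by
      push_cast
      have h1 : (2 * J + 1 : ℝ) ≤ 35 / η := by
        have h2 : 1 ≤ 1 / η := (one_le_div hη).mpr hη1
        have h3 : 35 / η = 2 * (17 / η) + 1 / η := by ring
        linarith
      have h2 : (2 * A + 1 : ℝ) ≤ η ^ 2 * M / 70 + 3 := by
        have : 2 * (M : ℝ) / l ≤ η ^ 2 * M / 140 := by
          rw [div_le_iff₀ hl0]
          have := (div_le_iff₀ (by positivity)).mp hl1
          nlinarith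
        linarith
      calc (2 * A + 1 : ℝ) * (2 * J + 1) ≤ (η ^ 2 * M / 70 + 3) * (35 / η) := by gcongr
        _ = η * M / 2 + 105 / η := by field_simp; ring
        _ < η * M := by
          have : 105 / η < η * M / 2 := by
            rw [div_lt_iff₀ hη]
            linarith
          linarith
    exact_mod_cast this.trans_le hcard
  have hw : ∀ h ∈ H, |e h * (η * M) * J| ≤ J := fun h hh => by
    rw [abs_mul, abs_mul, abs_of_pos hηM, abs_of_pos hJ0]
    have := (le_div_iff₀ hηM).mp (hφ h hh)
    exact mul_le_of_le_one_left hJ0.le this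
  obtain ⟨h0, hh0, h1, hh1, hne, heq⟩ := Finset.exists_ne_map_eq_of_card_lt_of_maps_to hcells
    (f := fun h : ℤ => (⌊(h : ℝ) / l⌋, ⌊e h * (η * M) * J⌋)) fun h hh => by
      have hb := abs_le.mp (hH h hh)
      have hc := abs_le.mp (hw h hh)
      simp only [Finset.coe_product, Finset.coe_Icc, Set.mem_prod, Set.mem_Icc]
      refine ⟨⟨Int.le_floor.mpr ?_, ?_⟩, Int.le_floor.mpr ?_, ?_⟩
      · push_cast
        have : -(2 * M : ℝ) / l ≤ h / l := by gcongr; linarith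
        rw [neg_div] at this
        linarith
      · have : (h : ℝ) / l ≤ 2 * M / l := by gcongr; linarith
        have h3 : ((⌊(h : ℝ) / l⌋ : ℤ) : ℝ) ≤ A := (Int.floor_le _).trans (by linarith)
        exact_mod_cast h3
      · push_cast
        exact hc.1
      · have h3 : ((⌊e h * (η * M) * J⌋ : ℤ) : ℝ) ≤ J := (Int.floor_le _).trans hc.2
        exact_mod_cast h3
  wlog hlt : h0 < h1 generalizing h0 h1
  · exact this h1 hh1 h0 hh0 hne.symm heq.symm (lt_of_le_of_ne (not_lt.mp hlt) hne.symm)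
  simp only [Prod.mk.injEq] at heq
  have hd1 : ((h1 : ℝ) - h0) < l := by
    have := (abs_lt.mp (Int.abs_sub_lt_one_of_floor_eq_floor heq.1)).1
    rw [← sub_div, lt_div_iff₀ hl0] at this
    linarith
  have hd2 : |e h1 - e h0| * (η * M) < η / 16 := by
    have := Int.abs_sub_lt_one_of_floor_eq_floor heq.2
    rw [← sub_mul, ← sub_mul, abs_mul, abs_mul, abs_of_pos hηM, abs_of_pos hJ0, abs_sub_comm]
      at this
    have h3 := (div_le_iff₀ hη).mp hJ1
    have h4 : |e h1 - e h0| * (η * M) * 16 ≤ |e h1 - e h0| * (η * M) * (J * η) := by gcongr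
    have h5 : |e h1 - e h0| * (η * M) * J * η < 1 * η := by gcongr
    linarith
  have hfar : ∃ h2 ∈ H, η * M / 4 ≤ |(h2 : ℝ) - h0| := by
    by_contra! hcon
    have hsub : H ⊆ Finset.Icc (h0 - ⌊η * M / 4⌋) (h0 + ⌊η * M / 4⌋) := fun h hh => by
      have := abs_lt.mp (hcon h hh)
      have h3 : h - h0 ≤ ⌊η * M / 4⌋ := Int.le_floor.mpr (by push_cast; linarith)
      have h4 : h0 - h ≤ ⌊η * M / 4⌋ := Int.le_floor.mpr (by push_cast; linarith)
      exact Finset.mem_Icc.mpr ⟨by linarith, by linarith⟩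
    have hc := Finset.card_le_card hsub
    rw [Int.card_Icc] at hc
    have hf0 : 0 ≤ ⌊η * M / 4⌋ := Int.floor_nonneg.mpr (by positivity)
    have hc' : (#H : ℤ) ≤ 2 * ⌊η * M / 4⌋ + 1 := by omega
    have hc'' : (#H : ℝ) ≤ 2 * ⌊η * M / 4⌋ + 1 := by exact_mod_cast hc'
    have := Int.floor_le (η * M / 4)
    linarith
  obtain ⟨h2, hh2, hfar⟩ := hfar
  have hq0 : (0 : ℝ) < (h1 : ℝ) - h0 := by
    rw [sub_pos]
    exact_mod_cast hlt
  have he2 : |e h2 - e h0| * (η * M) ≤ 2 := by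
    have a1 := (le_div_iff₀ hηM).mp (hφ h2 hh2)
    have a2 := (le_div_iff₀ hηM).mp (hφ h0 hh0)
    have a3 := abs_sub (e h2) (e h0)
    have a4 : |e h2 - e h0| * (η * M) ≤ (|e h2| + |e h0|) * (η * M) := by gcongr
    linarith
  have h20 : |(h2 : ℝ) - h0| ≤ 4 * M := by
    have a3 := abs_sub (h2 : ℝ) (h0 : ℝ)
    linarith [hH h2 hh2, hH h0 hh0]
  set D : ℤ := (h1 - h0) * (round (h2 * φ) - round (h0 * φ)) -
    (h2 - h0) * (round (h1 * φ) - round (h0 * φ)) with hD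
  have hDe : (D : ℝ) = (h2 - h0) * (e h1 - e h0) - (h1 - h0) * (e h2 - e h0) := by
    rw [hD, he]
    push_cast
    ring
  have hDabs : |(D : ℝ)| < 1 := by
    have b1 : |((h2 : ℝ) - h0) * (e h1 - e h0)| * η ≤ η / 4 := by
      rw [abs_mul]
      have : |(h2 : ℝ) - h0| * |e h1 - e h0| ≤ (4 * M) * |e h1 - e h0| := by gcongr
      nlinarith
    have b2 : |((h1 : ℝ) - h0) * (e h2 - e h0)| * (η * M) ≤ 2 * l := by
      rw [abs_mul, abs_of_pos hq0]
      calc ((h1 : ℝ) - h0) * |e h2 - e h0| * (η * M)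
          = ((h1 : ℝ) - h0) * (|e h2 - e h0| * (η * M)) := by ring
        _ ≤ l * 2 := by gcongr
        _ = 2 * l := by ring
    have b3 : 2 * l < 3 / 4 * (η * M) := by
      have c1 : 281 / η ^ 2 * η ^ 2 = 281 := by field_simp
      have c2 : (l : ℝ) * η ^ 2 ≤ 281 := by
        rw [← c1]
        gcongr
      have c3 : η ^ 2 * (2 * l) < η ^ 2 * (3 / 4 * (η * M)) := by nlinarith
      exact lt_of_mul_lt_mul_left c3 (by positivity)
    have b1' : |((h2 : ℝ) - h0) * (e h1 - e h0)| ≤ 1 / 4 :=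
      le_of_mul_le_mul_right (by linarith) hη
    have b2' : |((h1 : ℝ) - h0) * (e h2 - e h0)| < 3 / 4 :=
      lt_of_mul_lt_mul_right (b2.trans_lt b3) hηM.le
    rw [hDe]
    linarith [abs_sub (((h2 : ℝ) - h0) * (e h1 - e h0)) (((h1 : ℝ) - h0) * (e h2 - e h0))]
  have hD0 : D = 0 := by
    rw [← Int.abs_lt_one_iff]
    exact_mod_cast hDabs
  rw [hD0, Int.cast_zero] at hDe
  have hfin : |e h1 - e h0| * (η ^ 2 * M ^ 2) ≤ 8 * l := by
    have c1 : |(h2 : ℝ) - h0| * |e h1 - e h0| = (h1 - h0) * |e h2 - e h0| := by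
      have : ((h2 : ℝ) - h0) * (e h1 - e h0) = (h1 - h0) * (e h2 - e h0) := by linarith
      rw [← abs_mul, this, abs_mul, abs_of_pos hq0]
    have c2 : η * M / 4 * |e h1 - e h0| ≤ l * |e h2 - e h0| :=
      calc η * M / 4 * |e h1 - e h0| ≤ |(h2 : ℝ) - h0| * |e h1 - e h0| := by gcongr
        _ = (h1 - h0) * |e h2 - e h0| := c1
        _ ≤ l * |e h2 - e h0| := by gcongr
    calc |e h1 - e h0| * (η ^ 2 * M ^ 2) = 4 * (η * M) * (η * M / 4 * |e h1 - e h0|) := by ring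
      _ ≤ 4 * (η * M) * (l * |e h2 - e h0|) := by gcongr
      _ = 4 * l * (|e h2 - e h0| * (η * M)) := by ring
      _ ≤ 4 * l * 2 := by gcongr
      _ = 8 * l := by ring
  have hcast : (((h1 - h0).toNat : ℕ) : ℝ) = h1 - h0 := by
    have : (((h1 - h0).toNat : ℕ) : ℤ) = h1 - h0 := Int.toNat_of_nonneg (by omega)
    exact_mod_cast congrArg (fun z : ℤ => (z : ℝ)) this
  refine ⟨(h1 - h0).toNat, by omega, ?_, round (h1 * φ) - round (h0 * φ), ?_⟩
  · rw [hcast]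
    linarith
  · rw [hcast]
    have : ((h1 : ℝ) - h0) * φ - ((round (h1 * φ) - round (h0 * φ) : ℤ) : ℝ) = e h1 - e h0 := by
      rw [he]
      push_cast
      ring
    rw [this, le_div_iff₀ (by positivity)]
    have c1 : (l : ℝ) * η ^ 2 ≤ 281 := (le_div_iff₀ (by positivity)).mp hl2
    calc |e h1 - e h0| * (η ^ 6 * M ^ 2) = |e h1 - e h0| * (η ^ 2 * M ^ 2) * η ^ 4 := by ring
      _ ≤ 8 * l * η ^ 4 := by gcongr
      _ = 8 * (l * η ^ 2) * η ^ 2 := by ring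
      _ ≤ 8 * 281 * 1 := by gcongr
      _ ≤ 300000 := by norm_num

theorem sum_Icc_int_sub {f : ℤ → ℂ} {u v : ℤ} (h : u ≤ v + 1) :
    ∑ b ∈ Finset.Icc u v, (f (b + 1) - f b) = f (v + 1) - f u := by
  obtain ⟨n, hn⟩ := Int.le.dest h
  obtain rfl : v = u + n - 1 := by omega
  clear h hn
  induction n with
  | zero => simp
  | succ n ih =>
    have : Finset.Icc u (u + (n + 1 : ℕ) - 1) = insert (u + n : ℤ) (Finset.Icc u (u + n - 1)) := by
      ext b
      simp only [Finset.mem_Icc, Finset.mem_insert]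
      omega
    rw [this, Finset.sum_insert (by simp), ih]
    have e1 : u + n - 1 + 1 = u + (n : ℤ) := by ring
    have e2 : u + (n + 1 : ℕ) - 1 + 1 = u + (n : ℤ) + 1 := by push_cast; ring
    rw [e1, e2]
    ring

theorem norm_sum_exp_mul_abs_sub_round_le (φ : ℝ) (u v : ℤ) :
    ‖∑ b ∈ Finset.Icc u v, Complex.exp ((2 * π * (b * φ) : ℝ) * Complex.I)‖ * |φ - round φ| ≤
      1 / 2 := by
  rcases lt_or_ge (v + 1) u with h | h
  · rw [Finset.Icc_eq_empty (by omega)]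
    simp
  set f : ℤ → ℂ := fun b => Complex.exp ((2 * π * (b * φ) : ℝ) * Complex.I) with hf
  have hsub : ∀ b, f (b + 1) - f b = f b * (Complex.exp (Complex.I * (2 * π * φ : ℝ)) - 1) := by
    intro b
    have : f (b + 1) = f b * Complex.exp (Complex.I * (2 * π * φ : ℝ)) := by
      simp only [hf]
      rw [← Complex.exp_add]
      congr 1
      push_cast
      ring
    rw [this]
    ring
  have htel := sum_Icc_int_sub (f := f) h
  simp only [hsub] at htel
  rw [← Finset.sum_mul] at htel
  have hnorm : ∀ b, ‖f b‖ = 1 := fun b => Complex.norm_exp_ofReal_mul_I _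
  have h2 : ‖∑ b ∈ Finset.Icc u v, f b‖ * ‖Complex.exp (Complex.I * (2 * π * φ : ℝ)) - 1‖ ≤ 2 := by
    rw [← norm_mul, htel]
    have := norm_sub_le (f (v + 1)) (f u)
    rw [hnorm, hnorm] at this
    linarith
  have h4 : 4 * |φ - round φ| ≤ ‖Complex.exp (Complex.I * (2 * π * φ : ℝ)) - 1‖ := by
    have e : Complex.exp (Complex.I * (2 * π * φ : ℝ)) =
        Complex.exp (Complex.I * (2 * (π * (φ - round φ)) : ℝ)) := by
      rw [show Complex.I * (2 * π * φ : ℝ) = Complex.I * (2 * (π * (φ - round φ)) : ℝ) +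
        (round φ : ℤ) * (2 * π * Complex.I) by push_cast; ring, Complex.exp_add,
        Complex.exp_int_mul_two_pi_mul_I, mul_one]
    rw [e, Complex.norm_exp_I_mul_ofReal_sub_one, mul_div_cancel_left₀ _ two_ne_zero,
      norm_mul, Real.norm_eq_abs, Real.norm_eq_abs, abs_two]
    have hr := abs_sub_round φ
    have := Real.mul_abs_le_abs_sin (x := π * (φ - round φ)) (by
      rw [abs_mul, abs_of_pos Real.pi_pos]
      nlinarith [Real.pi_pos])
    rw [abs_mul π, abs_of_pos Real.pi_pos, ← mul_assoc, div_mul_cancel₀ _ Real.pi_pos.ne'] at this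
    linarith
  have h5 : ‖∑ b ∈ Finset.Icc u v, f b‖ * (4 * |φ - round φ|) ≤ 2 :=
    (mul_le_mul_of_nonneg_left h4 (norm_nonneg _)).trans h2
  linarith

theorem sum_sum_Icc_eq_sum_diff (M : ℕ) (F : ℤ → ℤ → ℂ) :
    ∑ a ∈ Finset.Icc (-(M : ℤ)) M, ∑ b ∈ Finset.Icc (-(M : ℤ)) M, F a b =
      ∑ h ∈ Finset.Icc (-(2 * M : ℤ)) (2 * M),
        ∑ b ∈ Finset.Icc (max (-(M : ℤ)) (-M - h)) (min (M : ℤ) (M - h)), F (b + h) b := by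
  rw [Finset.sum_sigma', Finset.sum_sigma']
  refine Finset.sum_nbij' (fun x => ⟨x.1 - x.2, x.2⟩) (fun x => ⟨x.2 + x.1, x.2⟩) ?_ ?_ ?_ ?_ ?_
  · rintro ⟨a, b⟩ h
    simp only [Finset.mem_sigma, Finset.mem_Icc] at h ⊢
    omega
  · rintro ⟨a, b⟩ h
    simp only [Finset.mem_sigma, Finset.mem_Icc] at h ⊢
    omega
  · rintro ⟨a, b⟩ _
    simp
  · rintro ⟨a, b⟩ _
    simp
  · rintro ⟨a, b⟩ _
    simp

theorem norm_sq_sum_exp_sq_le (M : ℕ) (θ : ℝ) :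
    ‖∑ n ∈ Finset.Icc (-(M : ℤ)) M, Complex.exp ((2 * π * (n ^ 2 * θ) : ℝ) * Complex.I)‖ ^ 2 ≤
      ∑ h ∈ Finset.Icc (-(2 * M : ℤ)) (2 * M),
        ‖∑ b ∈ Finset.Icc (max (-(M : ℤ)) (-M - h)) (min (M : ℤ) (M - h)),
          Complex.exp ((2 * π * (b * (h * (2 * θ))) : ℝ) * Complex.I)‖ := by
  have hconj : ∀ x : ℝ, (starRingEnd ℂ) (Complex.exp (x * Complex.I)) =
      Complex.exp ((-x : ℝ) * Complex.I) := fun x => by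
    rw [← Complex.exp_conj]
    simp
  have key : ((‖∑ n ∈ Finset.Icc (-(M : ℤ)) M,
      Complex.exp ((2 * π * (n ^ 2 * θ) : ℝ) * Complex.I)‖ ^ 2 : ℝ) : ℂ) =
      ∑ h ∈ Finset.Icc (-(2 * M : ℤ)) (2 * M), Complex.exp ((2 * π * (h ^ 2 * θ) : ℝ) * Complex.I) *
        ∑ b ∈ Finset.Icc (max (-(M : ℤ)) (-M - h)) (min (M : ℤ) (M - h)),
          Complex.exp ((2 * π * (b * (h * (2 * θ))) : ℝ) * Complex.I) := by
    rw [Complex.ofReal_pow, ← Complex.mul_conj', map_sum, Finset.sum_mul_sum,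
      sum_sum_Icc_eq_sum_diff]
    refine Finset.sum_congr rfl fun h _ => ?_
    rw [Finset.mul_sum]
    refine Finset.sum_congr rfl fun b _ => ?_
    rw [hconj, ← Complex.exp_add, ← Complex.exp_add]
    congr 1
    push_cast
    ring
  have := congrArg norm key
  rw [Complex.norm_real, Real.norm_of_nonneg (sq_nonneg _)] at this
  rw [this]
  refine (norm_sum_le _ _).trans (Finset.sum_le_sum fun h _ => ?_)
  rw [norm_mul, Complex.norm_exp_ofReal_mul_I, one_mul]

/-- **Weyl's inequality** for quadratic phases, in inverse form. -/
theorem exists_nat_mul_near_int_of_le_abs_sum_cos {M : ℕ} (hM : 0 < M) {κ θ : ℝ} (hκ : 0 < κ)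
    (hκ1 : κ ≤ 1)
    (h : κ * (2 * M + 1) ≤ |∑ n ∈ Finset.Icc (-(M : ℤ)) M, Real.cos (2 * π * (n ^ 2 * θ))|) :
    ∃ q : ℕ, 0 < q ∧ (q : ℝ) ≤ 562 / κ ^ 4 ∧
      ∃ p : ℤ, |q * θ - p| ≤ 300000 / (κ ^ 12 * M ^ 2) := by
  have hM' : (0 : ℝ) < M := Nat.cast_pos.mpr hM
  have hS : κ * (2 * M + 1) ≤ ‖∑ n ∈ Finset.Icc (-(M : ℤ)) M,
      Complex.exp ((2 * π * (n ^ 2 * θ) : ℝ) * Complex.I)‖ := by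
    refine h.trans (le_trans (le_of_eq ?_) (Complex.abs_re_le_norm _))
    rw [Complex.re_sum]
    simp only [Complex.exp_ofReal_mul_I_re]
  have hS2 := (pow_le_pow_left₀ (by positivity) hS 2).trans (norm_sq_sum_exp_sq_le M θ)
  set g : ℤ → ℝ := fun h => ‖∑ b ∈ Finset.Icc (max (-(M : ℤ)) (-M - h)) (min (M : ℤ) (M - h)),
          Complex.exp ((2 * π * (b * (h * (2 * θ))) : ℝ) * Complex.I)‖ with hg
  set I := Finset.Icc (-(2 * M : ℤ)) (2 * M) with hI
  have hIcard : (#I : ℝ) = 4 * M + 1 := by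
    have : #I = 4 * M + 1 := by
      rw [hI, Int.card_Icc]
      omega
    rw [this]
    push_cast
    ring
  set H := I.filter fun h => κ ^ 2 * (2 * M + 1) / 4 ≤ g h with hHdef
  have hgle : ∀ h, g h ≤ 2 * M + 1 := fun h => by
    refine (norm_sum_le _ _).trans ?_
    simp only [Complex.norm_exp_ofReal_mul_I, Finset.sum_const, nsmul_eq_mul, mul_one]
    have : #(Finset.Icc (max (-(M : ℤ)) (-M - h)) (min (M : ℤ) (M - h))) ≤ 2 * M + 1 := by
      rw [Int.card_Icc]
      omega
    exact_mod_cast this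
  have hHcard : κ ^ 2 * M ≤ #H := by
    have hsplit : ∑ h ∈ I, g h ≤ #H * (2 * M + 1) + #I * (κ ^ 2 * (2 * M + 1) / 4) := by
      rw [← Finset.sum_filter_add_sum_filter_not I fun h => κ ^ 2 * (2 * M + 1) / 4 ≤ g h]
      refine add_le_add ?_ ?_
      · rw [← nsmul_eq_mul]
        exact Finset.sum_le_card_nsmul _ _ _ fun h _ => hgle h
      · calc _ ≤ #(I.filter fun h => ¬ κ ^ 2 * (2 * M + 1) / 4 ≤ g h) *
              (κ ^ 2 * (2 * M + 1) / 4) := by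
              rw [← nsmul_eq_mul]
              exact Finset.sum_le_card_nsmul _ _ _ fun h hh =>
                (not_le.mp (Finset.mem_filter.mp hh).2).le
          _ ≤ _ := by
              gcongr
              exact Finset.filter_subset _ _
    rw [hIcard] at hsplit
    have h1 := hS2.trans hsplit
    have h2 : (2 * M + 1 : ℝ) * (κ ^ 2 * M) ≤ (2 * M + 1) * #H := by
      have : 0 ≤ κ ^ 2 * (2 * M + 1) * (3 / 4 : ℝ) := by positivity
      nlinarith
    exact le_of_mul_le_mul_left h2 (by positivity)
  obtain ⟨q, hq, hq1, p, hp⟩ := exists_nat_mul_near_int hM (η := κ ^ 2) (φ := 2 * θ)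
    (by positivity) (pow_le_one₀ hκ.le hκ1) H (fun h hh => by
      have := (Finset.mem_filter.mp hh).1
      rw [hI, Finset.mem_Icc] at this
      rw [abs_le]
      constructor
      · exact_mod_cast this.1
      · exact_mod_cast this.2) hHcard fun h hh => by
      have h1 := (Finset.mem_filter.mp hh).2
      have h2 := norm_sum_exp_mul_abs_sub_round_le (h * (2 * θ)) (max (-(M : ℤ)) (-M - h))
        (min (M : ℤ) (M - h))
      rw [le_div_iff₀ (by positivity)]
      have h3 : κ ^ 2 * (2 * M + 1) / 4 * |h * (2 * θ) - round (h * (2 * θ))| ≤ 1 / 2 :=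
        (mul_le_mul_of_nonneg_right h1 (abs_nonneg _)).trans h2
      have h4 : 0 ≤ κ ^ 2 * |h * (2 * θ) - round (h * (2 * θ))| := by positivity
      linarith
  refine ⟨2 * q, by omega, ?_, p, ?_⟩
  · push_cast
    have : 562 / κ ^ 4 = 2 * (281 / (κ ^ 2) ^ 2) := by ring
    rw [this]
    gcongr
  · have e1 : ((2 * q : ℕ) : ℝ) * θ - p = q * (2 * θ) - p := by push_cast; ring
    rw [e1]
    convert hp using 3
    ring

end Weyl

section Phase

open scoped RealInnerProductSpace

variable {Λ E : Type*} [AddCommGroup Λ] [NormedAddCommGroup E]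

/-- The Gaussian sum `∑ e^{-c|ξ|²}` over the points `ξ k`. -/
noncomputable def expNormSum (ξ : Λ →+ E) (c : ℝ) : ℝ := ∑' k, Real.exp (-c * ‖ξ k‖ ^ 2)

/-- The Gaussian sums over the points `ξ k` converge, and grow under dilation at most as they do
for a lattice of rank `d`. -/
structure HasGaussianGrowth (ξ : Λ →+ E) (d : ℕ) : Prop where
  summable : ∀ c : ℝ, 0 < c → Summable fun k => Real.exp (-c * ‖ξ k‖ ^ 2)
  expNormSum_le : ∀ t : ℝ, 1 ≤ t → expNormSum ξ (π / t ^ 2) ≤ t ^ d * expNormSum ξ π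

namespace HasGaussianGrowth

variable {ξ : Λ →+ E} {d : ℕ}

theorem one_le_expNormSum (hξ : HasGaussianGrowth ξ d) {c : ℝ} (hc : 0 < c) :
    1 ≤ expNormSum ξ c := by
  have := (hξ.summable c hc).le_tsum (0 : Λ) fun k _ => (Real.exp_pos _).le
  simpa [expNormSum] using this

theorem summable_tail (hξ : HasGaussianGrowth ξ d) (R : ℝ) :
    Summable fun k => if ‖ξ k‖ ≤ R then 0 else Real.exp (-π * ‖ξ k‖ ^ 2) := by
  refine Summable.of_nonneg_of_le (fun k => ?_) (fun k => ?_) (hξ.summable π Real.pi_pos)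
  · split_ifs
    exacts [le_rfl, (Real.exp_pos _).le]
  · split_ifs
    exacts [(Real.exp_pos _).le, le_rfl]

theorem tsum_tail_le (hξ : HasGaussianGrowth ξ d) {R : ℝ} (hR : 0 ≤ R) :
    (∑' k, if ‖ξ k‖ ≤ R then 0 else Real.exp (-π * ‖ξ k‖ ^ 2)) ≤
      Real.exp (-(3 * π / 4) * R ^ 2) * (2 ^ d * expNormSum ξ π) := by
  calc (∑' k, if ‖ξ k‖ ≤ R then 0 else Real.exp (-π * ‖ξ k‖ ^ 2))
      ≤ ∑' k, Real.exp (-(3 * π / 4) * R ^ 2) * Real.exp (-(π / 2 ^ 2) * ‖ξ k‖ ^ 2) := by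
        refine (hξ.summable_tail R).tsum_le_tsum (fun k => ?_)
          ((hξ.summable _ (by positivity)).mul_left _)
        split_ifs with h
        · positivity
        · rw [← Real.exp_add, Real.exp_le_exp]
          have h1 : R ^ 2 ≤ ‖ξ k‖ ^ 2 := pow_le_pow_left₀ hR (not_le.mp h).le 2
          have := mul_le_mul_of_nonneg_left h1 (show 0 ≤ 3 * π / 4 by positivity)
          linarith
    _ = Real.exp (-(3 * π / 4) * R ^ 2) * expNormSum ξ (π / 2 ^ 2) := tsum_mul_left
    _ ≤ _ := by
        gcongr
        exact hξ.expNormSum_le 2 one_le_two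

theorem summable_translate (hξ : HasGaussianGrowth ξ d) {c : ℝ} (hc : 0 < c) (x : E) :
    Summable fun k => Real.exp (-c * ‖x + ξ k‖ ^ 2) := by
  refine Summable.of_nonneg_of_le (fun k => (Real.exp_pos _).le) (fun k => ?_)
    ((hξ.summable (c / 2) (by positivity)).mul_left (Real.exp (c * ‖x‖ ^ 2)))
  rw [← Real.exp_add, Real.exp_le_exp]
  have h1 : ‖ξ k‖ ≤ ‖x + ξ k‖ + ‖x‖ := by
    have := norm_sub_le (x + ξ k) x
    rwa [add_sub_cancel_left] at this
  have h2 : ‖ξ k‖ ^ 2 ≤ 2 * ‖x + ξ k‖ ^ 2 + 2 * ‖x‖ ^ 2 := by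
    have := pow_le_pow_left₀ (norm_nonneg _) h1 2
    nlinarith [sq_nonneg (‖x + ξ k‖ - ‖x‖)]
  nlinarith

open Classical in
theorem summable_ite_translate (hξ : HasGaussianGrowth ξ d) {c : ℝ} (hc : 0 < c) (x : E)
    (p : Λ → Prop) : Summable fun k => if p k then Real.exp (-c * ‖x + ξ k‖ ^ 2) else 0 := by
  refine Summable.of_nonneg_of_le (fun k => ?_) (fun k => ?_) (hξ.summable_translate hc x)
  · split_ifs
    exacts [(Real.exp_pos _).le, le_rfl]
  · split_ifs
    exacts [le_rfl, (Real.exp_pos _).le]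

end HasGaussianGrowth

variable [InnerProductSpace ℝ E]

/-- The Gaussian weighted sum of the phases `cos (2π⟪ξ k, x⟫)`. -/
noncomputable def phaseSum (ξ : Λ →+ E) (x : E) : ℝ :=
  ∑' k, Real.exp (-π * ‖ξ k‖ ^ 2) * Real.cos (2 * π * ⟪ξ k, x⟫)

/-- The average of `phaseSum ξ (n² • α)` over the integers `|n| ≤ M`. -/
noncomputable def phaseAvg (ξ : Λ →+ E) (α : E) (M : ℝ) : ℝ :=
  (∑ n ∈ Finset.Icc (-(⌊M⌋₊ : ℤ)) ⌊M⌋₊, phaseSum ξ ((n : ℝ) ^ 2 • α)) / (2 * ⌊M⌋₊ + 1)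

theorem phaseAvg_of_lt_one {ξ : Λ →+ E} {α : E} {M : ℝ} (hM : M < 1) :
    phaseAvg ξ α M = expNormSum ξ π := by
  simp [phaseAvg, phaseSum, expNormSum, Nat.floor_eq_zero.mpr hM]

namespace HasGaussianGrowth

variable {ξ : Λ →+ E} {d : ℕ}

theorem summable_phase (hξ : HasGaussianGrowth ξ d) (x : E) :
    Summable fun k => Real.exp (-π * ‖ξ k‖ ^ 2) * Real.cos (2 * π * ⟪ξ k, x⟫) := by
  refine (hξ.summable π Real.pi_pos).of_norm_bounded fun k => ?_
  rw [norm_mul, Real.norm_of_nonneg (Real.exp_pos _).le, Real.norm_eq_abs]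
  exact mul_le_of_le_one_right (Real.exp_pos _).le (Real.abs_cos_le_one _)

theorem phaseAvg_eq_tsum (hξ : HasGaussianGrowth ξ d) (α : E) (M : ℝ) :
    phaseAvg ξ α M = ∑' k, Real.exp (-π * ‖ξ k‖ ^ 2) *
      ((∑ n ∈ Finset.Icc (-(⌊M⌋₊ : ℤ)) ⌊M⌋₊, Real.cos (2 * π * (n ^ 2 * ⟪ξ k, α⟫))) /
        (2 * ⌊M⌋₊ + 1)) := by
  rw [phaseAvg]
  simp only [phaseSum]
  rw [← Summable.tsum_finsetSum fun n _ => hξ.summable_phase _, ← tsum_div_const]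
  refine tsum_congr fun k => ?_
  rw [← Finset.mul_sum, mul_div_assoc]
  simp only [inner_smul_right]

theorem summable_phaseAvg (hξ : HasGaussianGrowth ξ d) (α : E) (m : ℕ) :
    Summable fun k => Real.exp (-π * ‖ξ k‖ ^ 2) *
      ((∑ n ∈ Finset.Icc (-(m : ℤ)) m, Real.cos (2 * π * (n ^ 2 * ⟪ξ k, α⟫))) / (2 * m + 1)) := by
  have h : Summable fun k => ∑ n ∈ Finset.Icc (-(m : ℤ)) m,
      Real.exp (-π * ‖ξ k‖ ^ 2) * Real.cos (2 * π * ⟪ξ k, (n : ℝ) ^ 2 • α⟫) :=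
    summable_sum fun n _ => hξ.summable_phase _
  refine (h.div_const (2 * m + 1 : ℝ)).congr fun k => ?_
  rw [← Finset.mul_sum, mul_div_assoc]
  simp only [inner_smul_right]

theorem abs_phaseSum_sub_le (hξ : HasGaussianGrowth ξ d) {R : ℝ} (hR : 0 ≤ R) (x y : E) :
    |phaseSum ξ x - phaseSum ξ y| ≤ 2 * π * R * ‖x - y‖ * expNormSum ξ π +
      2 * (Real.exp (-(3 * π / 4) * R ^ 2) * (2 ^ d * expNormSum ξ π)) := by
  rw [phaseSum, phaseSum, ← (hξ.summable_phase x).tsum_sub (hξ.summable_phase y),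
    ← Real.norm_eq_abs]
  have hs := ((hξ.summable π Real.pi_pos).mul_left (2 * π * R * ‖x - y‖)).add
    ((hξ.summable_tail R).mul_left 2)
  refine (tsum_of_norm_bounded hs.hasSum fun k => ?_).trans ?_
  · rw [← mul_sub, norm_mul, Real.norm_of_nonneg (Real.exp_pos _).le, Real.norm_eq_abs]
    split_ifs with h
    · have h1 : |Real.cos (2 * π * ⟪ξ k, x⟫) - Real.cos (2 * π * ⟪ξ k, y⟫)| ≤
          2 * π * R * ‖x - y‖ := by
        refine (Real.abs_cos_sub_cos_le _ _).trans ?_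
        rw [← mul_sub, ← inner_sub_right, abs_mul, abs_of_pos Real.two_pi_pos, mul_assoc (2 * π)]
        gcongr
        exact (abs_real_inner_le_norm _ _).trans (by gcongr)
      rw [mul_zero, add_zero, mul_comm]
      gcongr
    · have h1 : |Real.cos (2 * π * ⟪ξ k, x⟫) - Real.cos (2 * π * ⟪ξ k, y⟫)| ≤ 2 := by
        have a1 := Real.abs_cos_le_one (2 * π * ⟪ξ k, x⟫)
        have a2 := Real.abs_cos_le_one (2 * π * ⟪ξ k, y⟫)
        exact (abs_sub _ _).trans (by linarith)
      have h2 : Real.exp (-π * ‖ξ k‖ ^ 2) *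
          |Real.cos (2 * π * ⟪ξ k, x⟫) - Real.cos (2 * π * ⟪ξ k, y⟫)| ≤
          Real.exp (-π * ‖ξ k‖ ^ 2) * 2 := by gcongr
      have h3 : 0 ≤ 2 * π * R * ‖x - y‖ * Real.exp (-π * ‖ξ k‖ ^ 2) := by positivity
      linarith
  · rw [((hξ.summable π Real.pi_pos).mul_left _).tsum_add ((hξ.summable_tail R).mul_left 2),
      tsum_mul_left, tsum_mul_left]
    have := hξ.tsum_tail_le hR
    rw [expNormSum] at this ⊢
    linarith

theorem phaseAvg_le_phaseAvg_add (hξ : HasGaussianGrowth ξ d) {R : ℝ} (hR : 0 ≤ R)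
    (α β : E) {M : ℝ} (hM : 0 ≤ M) :
    phaseAvg ξ α M ≤ phaseAvg ξ β M + (2 * π * R * (‖α - β‖ * M ^ 2) * expNormSum ξ π +
      2 * (Real.exp (-(3 * π / 4) * R ^ 2) * (2 ^ d * expNormSum ξ π))) := by
  set ε := 2 * π * R * (‖α - β‖ * M ^ 2) * expNormSum ξ π +
      2 * (Real.exp (-(3 * π / 4) * R ^ 2) * (2 ^ d * expNormSum ξ π)) with hε
  have hA := hξ.one_le_expNormSum Real.pi_pos
  have hpt : ∀ n ∈ Finset.Icc (-(⌊M⌋₊ : ℤ)) ⌊M⌋₊, phaseSum ξ ((n : ℝ) ^ 2 • α) ≤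
      phaseSum ξ ((n : ℝ) ^ 2 • β) + ε := fun n hn => by
    have h1 := (abs_le.mp (hξ.abs_phaseSum_sub_le hR ((n : ℝ) ^ 2 • α) ((n : ℝ) ^ 2 • β))).2
    have h2 : ‖(n : ℝ) ^ 2 • α - (n : ℝ) ^ 2 • β‖ ≤ ‖α - β‖ * M ^ 2 := by
      rw [← smul_sub, norm_smul, mul_comm, Real.norm_of_nonneg (sq_nonneg _)]
      gcongr ?_ * ?_
      have h3 : |(n : ℝ)| ≤ M := by
        have h4 := Finset.mem_Icc.mp hn
        have h5 : |(n : ℝ)| ≤ (⌊M⌋₊ : ℝ) := by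
          rw [abs_le]
          exact ⟨by exact_mod_cast h4.1, by exact_mod_cast h4.2⟩
        exact h5.trans (Nat.floor_le hM)
      exact sq_le_sq.mpr (h3.trans (le_abs_self _))
    have h3 : 2 * π * R * ‖(n : ℝ) ^ 2 • α - (n : ℝ) ^ 2 • β‖ * expNormSum ξ π ≤
        2 * π * R * (‖α - β‖ * M ^ 2) * expNormSum ξ π := by gcongr
    linarith
  have hcard : #(Finset.Icc (-(⌊M⌋₊ : ℤ)) ⌊M⌋₊) = 2 * ⌊M⌋₊ + 1 := by
    rw [Int.card_Icc]
    omega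
  have hsum := Finset.sum_le_sum hpt
  rw [Finset.sum_add_distrib, Finset.sum_const, hcard, nsmul_eq_mul] at hsum
  push_cast at hsum
  rw [phaseAvg, phaseAvg, div_le_iff₀ (by positivity), add_mul, div_mul_cancel₀ _ (by positivity)]
  linarith

/-- If the phase average is small, then some short vector outside `V` has a biased phase. -/
theorem exists_biased_phase (hξ : HasGaussianGrowth ξ d) {R : ℝ} (hR : 0 ≤ R)
    (htail : Real.exp (-(3 * π / 4) * R ^ 2) * (2 ^ d * expNormSum ξ π) ≤ 1 / 16)
    (V : Submodule ℝ E) {α : E} (hα : ∀ k, ξ k ∈ V → ∃ z : ℤ, ⟪ξ k, α⟫ = z) {M : ℝ}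
    (hG : phaseAvg ξ α M < 1 / 2) :
    ∃ k, ξ k ∉ V ∧ ‖ξ k‖ ≤ R ∧ 1 / (4 * expNormSum ξ π) * (2 * ⌊M⌋₊ + 1) ≤
      |∑ n ∈ Finset.Icc (-(⌊M⌋₊ : ℤ)) ⌊M⌋₊, Real.cos (2 * π * (n ^ 2 * ⟪ξ k, α⟫))| := by
  classical
  by_contra! hcon
  set κ := 1 / (4 * expNormSum ξ π) with hκ
  have hA := hξ.one_le_expNormSum Real.pi_pos
  have hκ0 : 0 < κ := by positivity
  have hcard : #(Finset.Icc (-(⌊M⌋₊ : ℤ)) ⌊M⌋₊) = 2 * ⌊M⌋₊ + 1 := by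
    rw [Int.card_Icc]
    omega
  set c : Λ → ℝ := fun k =>
    (∑ n ∈ Finset.Icc (-(⌊M⌋₊ : ℤ)) ⌊M⌋₊, Real.cos (2 * π * (n ^ 2 * ⟪ξ k, α⟫))) /
        (2 * ⌊M⌋₊ + 1) with hc
  have hcV : ∀ k, ξ k ∈ V → c k = 1 := fun k hk => by
    obtain ⟨z, hz⟩ := hα k hk
    have : ∀ n : ℤ, Real.cos (2 * π * (n ^ 2 * ⟪ξ k, α⟫)) = 1 := fun n => by
      rw [hz, show 2 * π * ((n : ℝ) ^ 2 * z) = ((n ^ 2 * z : ℤ) : ℝ) * (2 * π) by push_cast; ring,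
        Real.cos_int_mul_two_pi]
    simp only [hc, this, Finset.sum_const, hcard, nsmul_eq_mul, mul_one]
    push_cast
    exact div_self (by positivity)
  have hc1 : ∀ k, -1 ≤ c k := fun k => by
    have h1 : -((2 * ⌊M⌋₊ + 1 : ℕ) : ℝ) ≤ ∑ n ∈ Finset.Icc (-(⌊M⌋₊ : ℤ)) ⌊M⌋₊,
        Real.cos (2 * π * (n ^ 2 * ⟪ξ k, α⟫)) := by
      rw [← hcard]
      have := Finset.card_nsmul_le_sum (Finset.Icc (-(⌊M⌋₊ : ℤ)) ⌊M⌋₊)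
        (fun n : ℤ => Real.cos (2 * π * (n ^ 2 * ⟪ξ k, α⟫))) (-1) fun n _ => Real.neg_one_le_cos _
      simpa using this
    rw [hc, le_div_iff₀ (by positivity)]
    push_cast at h1
    linarith
  have hlow : ∀ k, ((if k = 0 then 1 else 0) - κ * Real.exp (-π * ‖ξ k‖ ^ 2)) -
      (if ‖ξ k‖ ≤ R then 0 else Real.exp (-π * ‖ξ k‖ ^ 2)) ≤ Real.exp (-π * ‖ξ k‖ ^ 2) * c k := by
    intro k
    have hpos := Real.exp_pos (-π * ‖ξ k‖ ^ 2)
    have hκp : 0 < κ * Real.exp (-π * ‖ξ k‖ ^ 2) := by positivity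
    by_cases hk : k = 0
    · subst hk
      rw [hcV 0 (by simp)]
      simp [hκ0.le, hR]
    · rw [if_neg hk]
      by_cases hkV : ξ k ∈ V
      · rw [hcV k hkV]
        split_ifs <;> linarith
      · split_ifs with hkR
        · have h1 := (abs_lt.mp (hcon k hkV hkR)).1
          have h2 : -κ ≤ c k := by
            rw [hc, le_div_iff₀ (by positivity)]
            linarith
          nlinarith
        · nlinarith [hc1 k]
  have hs0 : Summable fun k : Λ => if k = 0 then (1 : ℝ) else 0 :=
    (hasSum_ite_eq (0 : Λ) (1 : ℝ)).summable
  have hs1 := (hξ.summable π Real.pi_pos).mul_left κ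
  have := (((hs0.sub hs1).sub (hξ.summable_tail R)).tsum_le_tsum hlow
    (hξ.summable_phaseAvg α ⌊M⌋₊))
  rw [(hs0.sub hs1).tsum_sub (hξ.summable_tail R), hs0.tsum_sub hs1, tsum_ite_eq, tsum_mul_left,
    ← hξ.phaseAvg_eq_tsum] at this
  have ht := hξ.tsum_tail_le hR
  have hκA : κ * ∑' k, Real.exp (-π * ‖ξ k‖ ^ 2) = 1 / 4 := by
    rw [hκ, ← expNormSum]
    field_simp
  linarith

end HasGaussianGrowth

end Phase

section Slice

open scoped RealInnerProductSpace

variable {Λ E : Type*} [AddCommGroup Λ] [NormedAddCommGroup E] [InnerProductSpace ℝ E]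

open Classical in
/-- The Gaussian sum at scale `R` over the points `x + ξ k` with `ξ k ∈ V`. -/
noncomputable def sliceSum (ξ : Λ →+ E) (R : ℝ) (V : Submodule ℝ E) (x : E) : ℝ :=
  ∑' k, if ξ k ∈ V then Real.exp (-(π / R ^ 2) * ‖x + ξ k‖ ^ 2) else 0

theorem sub_inner_smul_mem_of_mem_sup {V : Submodule ℝ E} {u y x : E}
    (huV : ∀ v ∈ V, ⟪v, u⟫ = 0) (hy : y - ⟪y, u⟫ • u ∈ V) (hx : x ∈ V ⊔ Submodule.span ℝ {y}) :
    x - ⟪x, u⟫ • u ∈ V := by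
  obtain ⟨v, hv, z, hz, rfl⟩ := Submodule.mem_sup.mp hx
  obtain ⟨a, rfl⟩ := Submodule.mem_span_singleton.mp hz
  have : v + a • y - ⟪v + a • y, u⟫ • u = v + a • (y - ⟪y, u⟫ • u) := by
    rw [inner_add_left, huV v hv, real_inner_smul_left, zero_add, smul_sub, mul_smul]
    abel
  rw [this]
  exact V.add_mem hv (V.smul_mem a hy)

theorem exists_unit_normal [FiniteDimensional ℝ E] {V : Submodule ℝ E} {y : E} (hy : y ∉ V) :
    ∃ u : E, ‖u‖ = 1 ∧ (∀ v ∈ V, ⟪v, u⟫ = 0) ∧ y - ⟪y, u⟫ • u ∈ V ∧ 0 < ⟪y, u⟫ := by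
  set w := y - V.starProjection y with hw
  have hpV : V.starProjection y ∈ V := V.starProjection_apply_mem y
  have hwV : w ∈ Vᗮ := V.sub_starProjection_mem_orthogonal y
  have hw0 : w ≠ 0 := fun h => hy (by rw [sub_eq_zero.mp h]; exact hpV)
  have hwn : 0 < ‖w‖ := norm_pos_iff.mpr hw0
  have hperp : ∀ v ∈ V, ⟪v, ‖w‖⁻¹ • w⟫ = 0 := fun v hv => by
    rw [real_inner_smul_right, Submodule.inner_right_of_mem_orthogonal hv hwV, mul_zero]
  have hyu : ⟪y, ‖w‖⁻¹ • w⟫ = ‖w‖ := by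
    have : y = V.starProjection y + w := by rw [hw]; abel
    rw [this, inner_add_left, hperp _ hpV, real_inner_smul_right, real_inner_self_eq_norm_sq]
    field_simp
    simp
  refine ⟨‖w‖⁻¹ • w, ?_, hperp, ?_, ?_⟩
  · rw [norm_smul, norm_inv, norm_norm, inv_mul_cancel₀ hwn.ne']
  · rw [hyu, smul_inv_smul₀ hwn.ne', hw]
    simp
  · rw [hyu]
    exact hwn

theorem exists_finset_card_of_dense {T : Set ℝ} (hT : Dense T) {R : ℝ} (hR : 0 < R) (n : ℕ) :
    ∃ s : Finset ℝ, (∀ t ∈ s, t ∈ T ∧ |t| ≤ R) ∧ #s = n := by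
  have h_inf : (Set.Ioo 0 R ∩ T).Infinite := by
    intro hfin
    have hne : (Set.Ioo 0 R \ (Set.Ioo 0 R ∩ T)).Nonempty :=
      ((Set.Ioo_infinite hR).sdiff hfin).nonempty
    obtain ⟨t, ht, htT⟩ := hT.inter_open_nonempty _ (isOpen_Ioo.sdiff hfin.isClosed) hne
    exact ht.2 ⟨ht.1, htT⟩
  obtain ⟨s, hs, hn⟩ := h_inf.exists_subset_card_eq n
  refine ⟨s, fun t ht => ?_, hn⟩
  have := hs (Finset.mem_coe.mpr ht)
  exact ⟨this.2, by rw [abs_of_pos this.1.1]; exact this.1.2.le⟩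

namespace HasGaussianGrowth

variable {ξ : Λ →+ E} {d : ℕ}

theorem sliceSum_zero_le (hξ : HasGaussianGrowth ξ d) {R : ℝ} (hR : 1 ≤ R) (V : Submodule ℝ E) :
    sliceSum ξ R V 0 ≤ R ^ d * expNormSum ξ π := by
  have hc : 0 < π / R ^ 2 := by positivity
  refine le_trans ((hξ.summable_ite_translate hc 0 _).tsum_le_tsum (fun k => ?_)
    (hξ.summable _ hc)) (hξ.expNormSum_le R hR)
  rw [zero_add]
  split_ifs
  exacts [le_rfl, (Real.exp_pos _).le]

theorem card_mul_le_sliceSum (hξ : HasGaussianGrowth ξ d) {R P : ℝ} (hR : 0 < R)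
    {V W : Submodule ℝ E} (hVW : V ≤ W) (hP : ∀ x ∈ V, P ≤ sliceSum ξ R V x) {u : E}
    (hu : ‖u‖ = 1) (huV : ∀ v ∈ V, ⟪v, u⟫ = 0) (x : E) (C : Finset Λ)
    (hCW : ∀ c ∈ C, ξ c ∈ W) (hinj : Set.InjOn (fun c => ⟪ξ c, u⟫) C)
    (hCV : ∀ c ∈ C, x + ξ c - ⟪x + ξ c, u⟫ • u ∈ V) (hCR : ∀ c ∈ C, |⟪x + ξ c, u⟫| ≤ R) :
    #C * (P * Real.exp (-π)) ≤ sliceSum ξ R W x := by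
  classical
  have hc : 0 < π / R ^ 2 := by positivity
  have hone : ∀ c ∈ C, P * Real.exp (-π) ≤
      ∑' k, if ξ (k - c) ∈ V then Real.exp (-(π / R ^ 2) * ‖x + ξ k‖ ^ 2) else 0 := by
    intro c hcC
    rw [← (Equiv.addRight c).tsum_eq fun k =>
      if ξ (k - c) ∈ V then Real.exp (-(π / R ^ 2) * ‖x + ξ k‖ ^ 2) else 0]
    set t := ⟪x + ξ c, u⟫ with ht
    set v := x + ξ c - t • u with hv
    have hvV : v ∈ V := hCV c hcC
    have hnorm : ∀ k, ξ k ∈ V → ‖x + ξ (k + c)‖ ^ 2 = ‖v + ξ k‖ ^ 2 + t ^ 2 := fun k hk => by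
      have h0 : ⟪v + ξ k, t • u⟫ = 0 := by
        rw [real_inner_smul_right, huV _ (V.add_mem hvV hk), mul_zero]
      have h1 := norm_add_sq_eq_norm_sq_add_norm_sq_of_inner_eq_zero _ _ h0
      have h2 : x + ξ (k + c) = (v + ξ k) + t • u := by
        rw [hv, map_add]
        abel
      rw [h2, pow_two, h1, norm_smul, hu, mul_one, Real.norm_eq_abs, abs_mul_abs_self]
      ring
    have hterm : ∀ k, (if ξ k ∈ V then Real.exp (-(π / R ^ 2) * ‖v + ξ k‖ ^ 2) else 0) *
        Real.exp (-π) ≤ if ξ ((Equiv.addRight c) k - c) ∈ V then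
          Real.exp (-(π / R ^ 2) * ‖x + ξ ((Equiv.addRight c) k)‖ ^ 2) else 0 := fun k => by
      simp only [Equiv.coe_addRight, add_sub_cancel_right]
      split_ifs with hk
      · rw [hnorm k hk, ← Real.exp_add, Real.exp_le_exp, mul_add]
        have h1 : t ^ 2 ≤ R ^ 2 := sq_le_sq.mpr ((hCR c hcC).trans (le_abs_self R))
        have h2 : π / R ^ 2 * t ^ 2 ≤ π := by
          rw [div_mul_eq_mul_div, div_le_iff₀ (by positivity)]
          gcongr
        linarith
      · simp
    have hs := (Equiv.addRight c).summable_iff.mpr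
      (hξ.summable_ite_translate hc x fun k => ξ (k - c) ∈ V)
    calc P * Real.exp (-π) ≤ sliceSum ξ R V v * Real.exp (-π) := by
          gcongr
          exact hP v hvV
      _ = ∑' k, (if ξ k ∈ V then Real.exp (-(π / R ^ 2) * ‖v + ξ k‖ ^ 2) else 0) *
            Real.exp (-π) := tsum_mul_right.symm
      _ ≤ _ := ((hξ.summable_ite_translate hc v _).mul_right _).tsum_le_tsum hterm
            hs
  have hsum := Finset.card_nsmul_le_sum C _ _ hone
  rw [nsmul_eq_mul] at hsum
  refine hsum.trans ?_
  rw [← Summable.tsum_finsetSum fun c _ => hξ.summable_ite_translate hc x _]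
  refine (summable_sum fun c _ => hξ.summable_ite_translate hc x _).tsum_le_tsum (fun k => ?_)
    (hξ.summable_ite_translate hc x _)
  by_cases hex : ∃ c ∈ C, ξ (k - c) ∈ V
  · obtain ⟨c, hcC, hck⟩ := hex
    rw [Finset.sum_eq_single_of_mem c hcC]
    · have : ξ k ∈ W := by
        have := W.add_mem (hVW hck) (hCW c hcC)
        rwa [← map_add, sub_add_cancel] at this
      rw [if_pos hck, if_pos this]
    · intro b hb hbc
      rw [if_neg]
      intro hbk
      refine hbc (hinj hb hcC ?_)
      have h1 := huV _ hck
      have h2 := huV _ hbk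
      rw [map_sub, inner_sub_left] at h1 h2
      simp only
      linarith
  · push Not at hex
    rw [Finset.sum_eq_zero fun c hcC => if_neg (hex c hcC)]
    split_ifs
    exacts [(Real.exp_pos _).le, le_rfl]

/-- Enlarging `V` by a short vector: the points over the larger space project to a cyclic group
orthogonally to `V`, and the Gaussian sums over them grow accordingly. -/
theorem exists_cyclic_extension [FiniteDimensional ℝ E] (hξ : HasGaussianGrowth ξ d) {R P : ℝ}
    (hR : 0 < R) (hP0 : 0 < P) {V : Submodule ℝ E} (hP : ∀ x ∈ V, P ≤ sliceSum ξ R V x) {k₁ : Λ}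
    (hk₁ : ξ k₁ ∉ V) (hk₁R : ‖ξ k₁‖ ≤ R) :
    ∃ (u : E) (g : ℝ) (η : Λ) (j : ℕ), ‖u‖ = 1 ∧ (∀ v ∈ V, ⟪v, u⟫ = 0) ∧ 0 < g ∧ 0 < j ∧
      j * g ≤ R ∧ ⟪ξ η, u⟫ = g ∧ ξ (j • η - k₁) ∈ V ∧
      (∀ k, ξ k ∈ V ⊔ Submodule.span ℝ {ξ k₁} → ∃ c : ℤ, ξ (k - c • η) ∈ V) ∧
      ∀ x ∈ V ⊔ Submodule.span ℝ {ξ k₁},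
        P * Real.exp (-π) * R / g ≤ sliceSum ξ R (V ⊔ Submodule.span ℝ {ξ k₁}) x := by
  classical
  obtain ⟨u, hu, huV, hyV, hy⟩ := exists_unit_normal hk₁
  set W := V ⊔ Submodule.span ℝ {ξ k₁} with hW
  have hVW : V ≤ W := le_sup_left
  have hk₁W : ξ k₁ ∈ W := Submodule.mem_sup_right (Submodule.mem_span_singleton_self _)
  have hWV : ∀ x ∈ W, x - ⟪x, u⟫ • u ∈ V := fun x hx =>
    sub_inner_smul_mem_of_mem_sup huV hyV hx
  set φ : Λ →+ ℝ := AddMonoidHom.mk' (fun k => ⟪ξ k, u⟫) fun a b => by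
    rw [map_add, inner_add_left] with hφ
  have hφ' : ∀ k, φ k = ⟪ξ k, u⟫ := fun k => rfl
  set T : AddSubgroup ℝ := AddSubgroup.map φ (AddSubgroup.comap ξ W.toAddSubgroup) with hT
  have hTmem : ∀ t, t ∈ T ↔ ∃ k, ξ k ∈ W ∧ φ k = t := fun t => by
    simp [hT]
  have hPe : 0 < P * Real.exp (-π) := by positivity
  have hnd : ¬ Dense (T : Set ℝ) := by
    intro hdense
    obtain ⟨n, hn⟩ := exists_nat_gt (sliceSum ξ R W 0 / (P * Real.exp (-π)))
    obtain ⟨s, hs, hsn⟩ := exists_finset_card_of_dense hdense hR n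
    have hpre : ∀ t : ℝ, ∃ k, t ∈ s → ξ k ∈ W ∧ φ k = t := fun t => by
      by_cases ht : t ∈ s
      · obtain ⟨k, hk⟩ := (hTmem t).mp (hs t ht).1
        exact ⟨k, fun _ => hk⟩
      · exact ⟨0, fun h => absurd h ht⟩
    choose f hf using hpre
    have hcard : #(s.image f) = n := by
      rw [← hsn]
      refine Finset.card_image_of_injOn fun a ha b hb hab => ?_
      rw [← (hf a ha).2, ← (hf b hb).2, hab]
    have hCW : ∀ c ∈ s.image f, ξ c ∈ W := fun c hc => by
      obtain ⟨t, ht, rfl⟩ := Finset.mem_image.mp hc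
      exact (hf t ht).1
    have := hξ.card_mul_le_sliceSum hR hVW hP hu huV 0 (s.image f) hCW
      (fun a ha b hb hab => by
        obtain ⟨t, ht, rfl⟩ := Finset.mem_image.mp (Finset.mem_coe.mp ha)
        obtain ⟨t', ht', rfl⟩ := Finset.mem_image.mp (Finset.mem_coe.mp hb)
        have h1 : φ (f t) = φ (f t') := hab
        rw [(hf t ht).2, (hf t' ht').2] at h1
        rw [h1])
      (fun c hc => by
        rw [zero_add]
        exact hWV _ (hCW c hc))
      (fun c hc => by
        obtain ⟨t, ht, rfl⟩ := Finset.mem_image.mp hc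
        rw [zero_add, ← hφ', (hf t ht).2]
        exact (hs t ht).2)
    rw [hcard] at this
    rw [div_lt_iff₀ hPe] at hn
    linarith
  have hcyc : ∃ g : ℝ, 0 < g ∧ g ∈ T ∧ ∀ t ∈ T, ∃ c : ℤ, t = c * g := by
    obtain ⟨a, ha⟩ := T.dense_or_cyclic.resolve_left hnd
    have hmem : ∀ t, t ∈ T ↔ ∃ n : ℤ, n • a = t := fun t => by
      rw [ha, AddSubgroup.mem_closure_singleton]
    have ha0 : a ≠ 0 := by
      rintro rfl
      obtain ⟨n, hn⟩ := (hmem _).mp ((hTmem _).mpr ⟨k₁, hk₁W, rfl⟩)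
      rw [smul_zero] at hn
      rw [← hφ', ← hn] at hy
      exact lt_irrefl _ hy
    have haT : a ∈ T := (hmem a).mpr ⟨1, one_smul _ _⟩
    rcases lt_or_gt_of_ne ha0 with h | h
    · refine ⟨-a, neg_pos.mpr h, T.neg_mem haT, fun t ht => ?_⟩
      obtain ⟨n, rfl⟩ := (hmem t).mp ht
      exact ⟨-n, by simp⟩
    · refine ⟨a, h, haT, fun t ht => ?_⟩
      obtain ⟨n, rfl⟩ := (hmem t).mp ht
      exact ⟨n, by simp⟩
  obtain ⟨g, hg, hgT, hgen⟩ := hcyc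
  obtain ⟨η, hηW, hη⟩ := (hTmem g).mp hgT
  obtain ⟨c₁, hc₁⟩ := hgen _ ((hTmem _).mpr ⟨k₁, hk₁W, rfl⟩)
  rw [hφ'] at hc₁
  have hc₁pos : 0 < c₁ := by
    rw [hc₁] at hy
    exact_mod_cast pos_of_mul_pos_left hy hg.le
  have hj : ((c₁.toNat : ℕ) : ℤ) = c₁ := Int.toNat_of_nonneg hc₁pos.le
  have hj' : ((c₁.toNat : ℕ) : ℝ) = c₁ := by exact_mod_cast congrArg (fun z : ℤ => (z : ℝ)) hj
  have hzero : ∀ k, ξ k ∈ W → φ k = 0 → ξ k ∈ V := fun k hk h0 => by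
    have := hWV _ hk
    rwa [← hφ', h0, zero_smul, sub_zero] at this
  have hsmulW : ∀ c : ℤ, ξ (c • η) ∈ W := fun c => by
    rw [map_zsmul]
    exact W.toAddSubgroup.zsmul_mem hηW c
  have hφsmul : ∀ c : ℤ, φ (c • η) = c * g := fun c => by
    rw [map_zsmul, hη, zsmul_eq_mul]
  have hgR : c₁.toNat * g ≤ R := by
    rw [hj', ← hc₁]
    refine (real_inner_le_norm _ _).trans ?_
    rwa [hu, mul_one]
  have hg1 : g ≤ R := by
    refine le_trans ?_ hgR
    have : (1 : ℝ) ≤ c₁.toNat := by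
      rw [hj']
      exact_mod_cast hc₁pos
    nlinarith
  refine ⟨u, g, η, c₁.toNat, hu, huV, hg, by omega, hgR, hη, ?_, ?_, ?_⟩
  · refine hzero _ ?_ ?_
    · rw [← natCast_zsmul, map_sub]
      exact W.sub_mem (hsmulW _) hk₁W
    · rw [← natCast_zsmul, map_sub, hφsmul, hφ' k₁, hc₁, hj, sub_self]
  · intro k hk
    obtain ⟨c, hc⟩ := hgen _ ((hTmem _).mpr ⟨k, hk, rfl⟩)
    refine ⟨c, hzero _ ?_ ?_⟩
    · rw [map_sub]
      exact W.sub_mem hk (hsmulW _)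
    · rw [map_sub, hφsmul, hc, sub_self]
  · intro x hx
    set t := ⟪x, u⟫ with ht
    set I := Finset.Icc ⌈(-R - t) / g⌉ ⌊(R - t) / g⌋ with hI
    have hinjI : Function.Injective fun c : ℤ => c • η := fun a b hab => by
      have := congrArg φ hab
      simp only [hφsmul] at this
      exact_mod_cast mul_right_cancel₀ hg.ne' this
    have hIcard : R / g ≤ #I := by
      rw [hI, Int.card_Icc]
      have h1 : (R - t) / g < ⌊(R - t) / g⌋ + 1 := Int.lt_floor_add_one _
      have h2 : (⌈(-R - t) / g⌉ : ℝ) < (-R - t) / g + 1 := Int.ceil_lt_add_one _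
      have h3 : ((⌊(R - t) / g⌋ + 1 - ⌈(-R - t) / g⌉ : ℤ) : ℝ) ≤
          ((⌊(R - t) / g⌋ + 1 - ⌈(-R - t) / g⌉).toNat : ℝ) := by
        exact_mod_cast Int.self_le_toNat _
      push_cast at h3
      have h4 : (R - t) / g - (-R - t) / g = 2 * (R / g) := by ring
      have h5 : 1 ≤ R / g := (one_le_div hg).mpr hg1
      linarith
    have hCW : ∀ c ∈ I.image (fun c : ℤ => c • η), ξ c ∈ W := fun c hc => by
      obtain ⟨c, -, rfl⟩ := Finset.mem_image.mp hc
      exact hsmulW c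
    have := hξ.card_mul_le_sliceSum hR hVW hP hu huV x (I.image fun c : ℤ => c • η) hCW
      (fun a ha b hb hab => by
        obtain ⟨c, -, rfl⟩ := Finset.mem_image.mp (Finset.mem_coe.mp ha)
        obtain ⟨c', -, rfl⟩ := Finset.mem_image.mp (Finset.mem_coe.mp hb)
        simp only [← hφ', hφsmul] at hab
        have : (c : ℤ) = c' := by exact_mod_cast mul_right_cancel₀ hg.ne' hab
        rw [this])
      (fun c hc => hWV _ (W.add_mem hx (hCW c hc)))
      (fun c hc => by
        obtain ⟨c, hcI, rfl⟩ := Finset.mem_image.mp hc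
        rw [inner_add_left, ← hφ' (c • η), hφsmul, ← ht, abs_le]
        have h1 := Finset.mem_Icc.mp hcI
        have h2 := (div_le_iff₀ hg).mp (Int.ceil_le.mp h1.1)
        have h3 := (le_div_iff₀ hg).mp (Int.le_floor.mp h1.2)
        constructor <;> linarith)
    rw [Finset.card_image_of_injective _ hinjI] at this
    calc P * Real.exp (-π) * R / g = R / g * (P * Real.exp (-π)) := by ring
      _ ≤ #I * (P * Real.exp (-π)) := by gcongr
      _ ≤ _ := this

end HasGaussianGrowth

end Slice

section Descent

open scoped RealInnerProductSpace

namespace HasGaussianGrowth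

variable {Λ E : Type*} [AddCommGroup Λ] [NormedAddCommGroup E] [InnerProductSpace ℝ E]
  [FiniteDimensional ℝ E] {ξ : Λ →+ E} {d : ℕ}

/-- One step of the descent: if the phase average is small, the space of vectors having integral
pairing with `α` can be enlarged, at the cost of shortening the range of averaging. -/
theorem exists_descent_step (hξ : HasGaussianGrowth ξ d) {R δ τ Q : ℝ} (hR : 1 ≤ R)
    (htail : Real.exp (-(3 * π / 4) * R ^ 2) * (2 ^ d * expNormSum ξ π) ≤ 1 / 16)
    (hτR : 2 * R ≤ τ) (hτ : 2 * R * (1200000 * (4 * expNormSum ξ π) ^ 12) ≤ δ * τ ^ 2)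
    (hQ : 562 * (4 * expNormSum ξ π) ^ 4 * τ * Real.exp π ≤ Q * R)
    {V : Submodule ℝ E} {α : E} {M P : ℝ} (hP0 : 0 < P)
    (hα : ∀ k, ξ k ∈ V → ∃ z : ℤ, ⟪ξ k, α⟫ = z) (hP : ∀ x ∈ V, P ≤ sliceSum ξ R V x)
    (hG : phaseAvg ξ α M < 1 / 2) :
    ∃ (W : Submodule ℝ E) (q : ℕ) (α' : E) (M' P' : ℝ),
      Module.finrank ℝ W = Module.finrank ℝ V + 1 ∧ 0 < q ∧ 0 < M' ∧ 0 < P' ∧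
      q * M' ≤ M / 2 ∧ ‖(q : ℝ) ^ 2 • α - α'‖ * M' ^ 2 ≤ δ / 2 ∧
      (∀ k, ξ k ∈ W → ∃ z : ℤ, ⟪ξ k, α'⟫ = z) ∧ (∀ x ∈ W, P' ≤ sliceSum ξ R W x) ∧
      M * P ≤ Q * (M' * P') := by
  have hA := hξ.one_le_expNormSum Real.pi_pos
  set A := expNormSum ξ π with hAdef
  have hR0 : 0 < R := by linarith
  have hτ0 : 0 < τ := by linarith
  have hM1 : 1 ≤ M := by
    by_contra! hM
    rw [phaseAvg_of_lt_one hM] at hG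
    linarith
  have hM0 : 0 < M := by linarith
  set m := ⌊M⌋₊ with hm
  have hm1 : 0 < m := Nat.floor_pos.mpr hM1
  have hm2 : M ≤ 2 * m := by
    have h1 := Nat.lt_floor_add_one M
    have h2 : (1 : ℝ) ≤ m := by exact_mod_cast hm1
    linarith
  obtain ⟨k₁, hk₁, hk₁R, hbias⟩ := hξ.exists_biased_phase hR0.le htail V hα hG
  obtain ⟨q, hq, hqle, p, hp⟩ := exists_nat_mul_near_int_of_le_abs_sum_cos hm1
    (κ := 1 / (4 * A)) (θ := ⟪ξ k₁, α⟫) (by positivity)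
    ((div_le_one (by positivity)).mpr (by linarith)) hbias
  obtain ⟨u, g, η, j, hu, huV, hg, hj, hjR, hη, hηk, hgen, hslice⟩ :=
    hξ.exists_cyclic_extension hR0 hP0 hP hk₁ hk₁R
  set W := V ⊔ Submodule.span ℝ {ξ k₁} with hW
  have hq0 : (0 : ℝ) < q := Nat.cast_pos.mpr hq
  have hj0 : (0 : ℝ) < j := Nat.cast_pos.mpr hj
  set ε := q * ⟪ξ k₁, α⟫ - p with hε
  set β := -(q * j * ε / g) with hβ
  have hqle' : (q : ℝ) ≤ 562 * (4 * A) ^ 4 := by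
    refine hqle.trans_eq ?_
    rw [div_pow, one_pow]
    field_simp
  have hεM : |ε| * M ^ 2 ≤ 1200000 * (4 * A) ^ 12 := by
    have h1 : |ε| ≤ 300000 * (4 * A) ^ 12 / m ^ 2 := by
      refine hp.trans_eq ?_
      rw [div_pow, one_pow]
      field_simp
    rw [le_div_iff₀ (by positivity)] at h1
    calc |ε| * M ^ 2 ≤ |ε| * (2 * m) ^ 2 := by gcongr
      _ = 4 * (|ε| * m ^ 2) := by ring
      _ ≤ _ := by linarith
  refine ⟨W, q * j, ((q * j : ℕ) : ℝ) ^ 2 • α + β • u, M * g / (q * τ),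
    P * Real.exp (-π) * R / g, ?_, by positivity, by positivity, by positivity, ?_, ?_, ?_, hslice,
    ?_⟩
  · have hk0 : ξ k₁ ≠ 0 := fun h => hk₁ (h ▸ V.zero_mem)
    have hdisj : V ⊓ Submodule.span ℝ {ξ k₁} = ⊥ := by
      rw [← disjoint_iff, Submodule.disjoint_span_singleton' hk0]
      exact hk₁
    have := Submodule.finrank_sup_add_finrank_inf_eq V (Submodule.span ℝ {ξ k₁})
    rw [hdisj, finrank_bot, finrank_span_singleton hk0] at this
    exact this
  · have h1 : ((q * j : ℕ) : ℝ) * (M * g / (q * τ)) = M * (j * g) / τ := by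
      push_cast
      field_simp
    rw [h1, div_le_iff₀ hτ0]
    have : M * (j * g) ≤ M * R := by gcongr
    nlinarith
  · have h1 : ‖((q * j : ℕ) : ℝ) ^ 2 • α - (((q * j : ℕ) : ℝ) ^ 2 • α + β • u)‖ =
        q * j * |ε| / g := by
      rw [sub_add_cancel_left, norm_neg, norm_smul, hu, mul_one, hβ, norm_neg, Real.norm_eq_abs,
        abs_div, abs_mul, abs_mul, abs_of_pos hq0, abs_of_pos hj0, abs_of_pos hg]
    have h2 : (q * j * |ε| / g) * (M * g / (q * τ)) ^ 2 =
        (j * g) * (|ε| * M ^ 2) / (q * τ ^ 2) := by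
      field_simp
    rw [h1, h2, div_le_iff₀ (by positivity)]
    have h3 : (1 : ℝ) ≤ q := by exact_mod_cast hq
    have hδ : 0 ≤ δ * τ ^ 2 := le_trans (by positivity) hτ
    calc (j * g) * (|ε| * M ^ 2) ≤ R * (1200000 * (4 * A) ^ 12) := by gcongr
      _ ≤ δ * τ ^ 2 / 2 := by linarith
      _ ≤ δ * τ ^ 2 / 2 * q := le_mul_of_one_le_right (by linarith) h3
      _ = δ / 2 * (q * τ ^ 2) := by ring
  · intro k hk
    obtain ⟨c, hc⟩ := hgen k hk
    obtain ⟨z₁, hz₁⟩ := hα _ hηk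
    obtain ⟨z₂, hz₂⟩ := hα _ hc
    have hu1 := huV _ hc
    rw [map_sub, map_nsmul, inner_sub_left, ← Nat.cast_smul_eq_nsmul ℝ, real_inner_smul_left] at hz₁
    rw [map_sub, map_zsmul, inner_sub_left, ← Int.cast_smul_eq_zsmul ℝ, real_inner_smul_left]
      at hz₂ hu1
    rw [hη] at hu1
    refine ⟨(q * j) ^ 2 * z₂ + c * (q * j * p + q ^ 2 * j * z₁), ?_⟩
    have e1 : ⟪ξ k, α⟫ = c * ⟪ξ η, α⟫ + z₂ := by linarith
    have e2 : ⟪ξ k, u⟫ = c * g := by linarith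
    have e3 : j * ⟪ξ η, α⟫ = ⟪ξ k₁, α⟫ + z₁ := by linarith
    have e4 : β * g = -(q * j * ε) := by
      rw [hβ]
      field_simp
    rw [inner_add_right, real_inner_smul_right, real_inner_smul_right, e1, e2]
    push_cast
    have e5 : β * (c * g) = c * -(q * j * ε) := by rw [← e4]; ring
    rw [e5, hε]
    linear_combination (c : ℝ) * q ^ 2 * j * e3
  · have h1 : M * g / (q * τ) * (P * Real.exp (-π) * R / g) =
        M * P * R / (q * τ * Real.exp π) := by
      rw [Real.exp_neg]
      field_simp
    rw [h1, ← mul_div_assoc, le_div_iff₀ (by positivity)]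
    have h2 : q * τ * Real.exp π ≤ Q * R := by
      refine le_trans ?_ hQ
      gcongr
    calc M * P * (q * τ * Real.exp π) ≤ M * P * (Q * R) := by gcongr
      _ = Q * (M * P * R) := by ring

theorem exists_large_phaseAvg_aux (hξ : HasGaussianGrowth ξ d) {R δ τ Q : ℝ} (hR : 1 ≤ R)
    (htail : Real.exp (-(3 * π / 4) * R ^ 2) * (2 ^ d * expNormSum ξ π) ≤ 1 / 16)
    (hτR : 2 * R ≤ τ) (hτ : 2 * R * (1200000 * (4 * expNormSum ξ π) ^ 12) ≤ δ * τ ^ 2)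
    (hQ1 : 1 ≤ Q) (hQ : 562 * (4 * expNormSum ξ π) ^ 4 * τ * Real.exp π ≤ Q * R)
    (α₀ : E) (N : ℝ) (n : ℕ) :
    ∀ (V : Submodule ℝ E) (q : ℕ) (α : E) (M P : ℝ), Module.finrank ℝ V + n = Module.finrank ℝ E →
      0 < q → 0 < M → 0 < P → q * M ≤ N → ‖(q : ℝ) ^ 2 • α₀ - α‖ * M ^ 2 ≤ δ →
      (∀ k, ξ k ∈ V → ∃ z : ℤ, ⟪ξ k, α⟫ = z) → (∀ x ∈ V, P ≤ sliceSum ξ R V x) →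
      ∃ (q' : ℕ) (α' : E) (M' : ℝ), 0 < q' ∧ 0 < M' ∧ q' * M' ≤ N ∧
        ‖(q' : ℝ) ^ 2 • α₀ - α'‖ * M' ^ 2 ≤ δ ∧ 1 / 2 ≤ phaseAvg ξ α' M' ∧
        M * P ≤ Q ^ n * (R ^ d * expNormSum ξ π) * M' := by
  have hA := hξ.one_le_expNormSum Real.pi_pos
  have hdone : ∀ (n : ℕ) {V : Submodule ℝ E} {M P : ℝ}, 0 < M →
      (∀ x ∈ V, P ≤ sliceSum ξ R V x) → M * P ≤ Q ^ n * (R ^ d * expNormSum ξ π) * M := by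
    intro n V M P hM hP
    have h1 := (hP 0 V.zero_mem).trans (hξ.sliceSum_zero_le hR V)
    have h2 : 1 ≤ Q ^ n := one_le_pow₀ hQ1
    have h3 : 0 ≤ R ^ d * expNormSum ξ π := by positivity
    have h4 : P ≤ Q ^ n * (R ^ d * expNormSum ξ π) := by nlinarith
    nlinarith
  induction n with
  | zero =>
    intro V q α M P hV hq hM hP0 hqM hαα hα hP
    refine ⟨q, α, M, hq, hM, hqM, hαα, ?_, hdone 0 hM hP⟩
    by_contra! hG
    obtain ⟨W, -, -, -, -, hWV, -⟩ := hξ.exists_descent_step hR htail hτR hτ hQ hP0 hα hP hG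
    have := W.finrank_le
    omega
  | succ n ih =>
    intro V q α M P hV hq hM hP0 hqM hαα hα hP
    rcases le_or_gt (1 / 2) (phaseAvg ξ α M) with hG | hG
    · exact ⟨q, α, M, hq, hM, hqM, hαα, hG, hdone _ hM hP⟩
    obtain ⟨W, q₁, α₁, M₁, P₁, hWV, hq₁, hM₁, hP₁, hqM₁, hαα₁, hα₁, hPW, hMP⟩ :=
      hξ.exists_descent_step hR htail hτR hτ hQ hP0 hα hP hG
    have hq0 : (0 : ℝ) < q := Nat.cast_pos.mpr hq
    obtain ⟨q', α', M', hq', hM', hqM', hαα', hG', hfin⟩ := ih W (q * q₁) α₁ M₁ P₁ (by omega)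
      (by positivity) hM₁ hP₁ (by
        push_cast
        have : (q : ℝ) * (q₁ * M₁) ≤ q * (M / 2) := by gcongr
        nlinarith [mul_pos hq0 hM]) (by
        have e1 : ((q * q₁ : ℕ) : ℝ) ^ 2 • α₀ - α₁ =
            (q₁ : ℝ) ^ 2 • ((q : ℝ) ^ 2 • α₀ - α) + ((q₁ : ℝ) ^ 2 • α - α₁) := by
          rw [smul_sub, smul_smul]
          push_cast
          rw [mul_pow, mul_comm ((q : ℝ) ^ 2)]
          abel
        have h1 : ‖((q * q₁ : ℕ) : ℝ) ^ 2 • α₀ - α₁‖ ≤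
            (q₁ : ℝ) ^ 2 * ‖(q : ℝ) ^ 2 • α₀ - α‖ + ‖(q₁ : ℝ) ^ 2 • α - α₁‖ := by
          rw [e1]
          refine (norm_add_le _ _).trans_eq ?_
          rw [norm_smul, Real.norm_of_nonneg (by positivity)]
        have h2 : (q₁ * M₁) ^ 2 ≤ (M / 2) ^ 2 := by gcongr
        calc ‖((q * q₁ : ℕ) : ℝ) ^ 2 • α₀ - α₁‖ * M₁ ^ 2
            ≤ ((q₁ : ℝ) ^ 2 * ‖(q : ℝ) ^ 2 • α₀ - α‖ + ‖(q₁ : ℝ) ^ 2 • α - α₁‖) * M₁ ^ 2 := by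
              gcongr
          _ = ‖(q : ℝ) ^ 2 • α₀ - α‖ * (q₁ * M₁) ^ 2 + ‖(q₁ : ℝ) ^ 2 • α - α₁‖ * M₁ ^ 2 := by ring
          _ ≤ ‖(q : ℝ) ^ 2 • α₀ - α‖ * (M / 2) ^ 2 + δ / 2 := by gcongr
          _ ≤ δ := by
            have : 0 ≤ ‖(q : ℝ) ^ 2 • α₀ - α‖ * M ^ 2 := by positivity
            nlinarith) hα₁ hPW
    refine ⟨q', α', M', hq', hM', hqM', hαα', hG', ?_⟩
    calc M * P ≤ Q * (M₁ * P₁) := hMP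
      _ ≤ Q * (Q ^ n * (R ^ d * expNormSum ξ π) * M') := by gcongr
      _ = Q ^ (n + 1) * (R ^ d * expNormSum ξ π) * M' := by ring

/-- Some multiple `q² • α` is close to a point with large phase average, over a long range. -/
theorem exists_large_phaseAvg (hξ : HasGaussianGrowth ξ d) {R δ τ Q : ℝ} (hR : 1 ≤ R)
    (hδ : 0 ≤ δ)
    (htail : Real.exp (-(3 * π / 4) * R ^ 2) * (2 ^ d * expNormSum ξ π) ≤ 1 / 16)
    (hτR : 2 * R ≤ τ) (hτ : 2 * R * (1200000 * (4 * expNormSum ξ π) ^ 12) ≤ δ * τ ^ 2)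
    (hQ1 : 1 ≤ Q) (hQ : 562 * (4 * expNormSum ξ π) ^ 4 * τ * Real.exp π ≤ Q * R)
    (α : E) {N : ℝ} (hN : 0 < N) :
    ∃ (q : ℕ) (α' : E) (M : ℝ), 0 < q ∧ 0 < M ∧ q * M ≤ N ∧
      ‖(q : ℝ) ^ 2 • α - α'‖ * M ^ 2 ≤ δ ∧ 1 / 2 ≤ phaseAvg ξ α' M ∧
      N ≤ Q ^ Module.finrank ℝ E * (R ^ d * expNormSum ξ π) * M := by
  obtain ⟨q, α', M, h1, h2, h3, h4, h5, h6⟩ := hξ.exists_large_phaseAvg_aux hR htail hτR hτ hQ1 hQ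
    α N (Module.finrank ℝ E) ⊥ 1 α N 1 (by simp) one_pos hN one_pos (by simp) (by simpa using hδ)
    (fun k hk => ⟨0, by rw [(Submodule.mem_bot ℝ).mp hk]; simp⟩) fun x hx => by
      classical
      rw [(Submodule.mem_bot ℝ).mp hx]
      have hs := hξ.summable_ite_translate (c := π / R ^ 2) (by positivity) 0
        fun k => ξ k ∈ (⊥ : Submodule ℝ E)
      have := hs.le_tsum (0 : Λ) fun k _ => by
        split_ifs
        exacts [(Real.exp_pos _).le, le_rfl]
      refine le_trans (le_of_eq ?_) this
      simp
  exact ⟨q, α', M, h1, h2, h3, h4, h5, by simpa using h6⟩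

theorem phaseAvg_lower_bound (hξ : HasGaussianGrowth ξ d) {R δ τ Q : ℝ} (hR : 1 ≤ R)
    (hδ0 : 0 ≤ δ) (hδ : 2 * π * R * δ * expNormSum ξ π ≤ 1 / 8)
    (htail : Real.exp (-(3 * π / 4) * R ^ 2) * (2 ^ d * expNormSum ξ π) ≤ 1 / 16)
    (hτR : 2 * R ≤ τ) (hτ : 2 * R * (1200000 * (4 * expNormSum ξ π) ^ 12) ≤ δ * τ ^ 2)
    (hQ1 : 1 ≤ Q) (hQ : 562 * (4 * expNormSum ξ π) ^ 4 * τ * Real.exp π ≤ Q * R)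
    (hpos : ∀ x, 0 ≤ phaseSum ξ x) (α : E) {N : ℕ} (hN : 0 < N) :
    1 ≤ 12 * (Q ^ Module.finrank ℝ E * (R ^ d * expNormSum ξ π)) * phaseAvg ξ α N := by
  have hA := hξ.one_le_expNormSum Real.pi_pos
  have hN0 : (0 : ℝ) < N := Nat.cast_pos.mpr hN
  have hN1 : (1 : ℝ) ≤ N := by exact_mod_cast hN
  obtain ⟨q, α', M, hq, hM, hqM, hαα, hG, hNM⟩ :=
    hξ.exists_large_phaseAvg hR hδ0 htail hτR hτ hQ1 hQ α hN0
  set K := Q ^ Module.finrank ℝ E * (R ^ d * expNormSum ξ π) with hK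
  have hK0 : 0 < K := by positivity
  have hq0 : (0 : ℝ) < q := Nat.cast_pos.mpr hq
  have hquarter : 1 / 4 ≤ phaseAvg ξ ((q : ℝ) ^ 2 • α) M := by
    have h1 := hξ.phaseAvg_le_phaseAvg_add (R := R) (by linarith) α' ((q : ℝ) ^ 2 • α) hM.le
    rw [norm_sub_rev] at h1
    have h2 : 2 * π * R * (‖(q : ℝ) ^ 2 • α - α'‖ * M ^ 2) * expNormSum ξ π ≤
        2 * π * R * δ * expNormSum ξ π := by gcongr
    linarith
  have hqm : q * ⌊M⌋₊ ≤ N := by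
    have : (q : ℝ) * ⌊M⌋₊ ≤ N := le_trans (by gcongr; exact Nat.floor_le hM.le) hqM
    exact_mod_cast this
  have hsub : ∑ n ∈ Finset.Icc (-(⌊M⌋₊ : ℤ)) ⌊M⌋₊, phaseSum ξ ((n : ℝ) ^ 2 • (q : ℝ) ^ 2 • α) ≤
      ∑ n ∈ Finset.Icc (-(N : ℤ)) N, phaseSum ξ ((n : ℝ) ^ 2 • α) := by
    have hinj : Function.Injective fun n : ℤ => (q : ℤ) * n := fun a b hab =>
      mul_left_cancel₀ (by exact_mod_cast hq.ne') hab
    calc _ = ∑ n ∈ (Finset.Icc (-(⌊M⌋₊ : ℤ)) ⌊M⌋₊).image fun n => (q : ℤ) * n,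
          phaseSum ξ ((n : ℝ) ^ 2 • α) := by
          rw [Finset.sum_image fun a _ b _ hab => hinj hab]
          refine Finset.sum_congr rfl fun n _ => ?_
          rw [smul_smul]
          push_cast
          rw [mul_pow, mul_comm]
      _ ≤ _ := by
          refine Finset.sum_le_sum_of_subset_of_nonneg (fun n hn => ?_) fun n _ _ => hpos _
          obtain ⟨n, hn', rfl⟩ := Finset.mem_image.mp hn
          have h1 := Finset.mem_Icc.mp hn'
          have hqz : (0 : ℤ) ≤ q := by positivity
          have h2 : (q : ℤ) * ⌊M⌋₊ ≤ N := by exact_mod_cast hqm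
          have h3 := mul_le_mul_of_nonneg_left h1.1 hqz
          have h4 := mul_le_mul_of_nonneg_left h1.2 hqz
          exact Finset.mem_Icc.mpr ⟨by linarith, by linarith⟩
  rw [phaseAvg, le_div_iff₀ (by positivity)] at hquarter
  rw [phaseAvg, Nat.floor_natCast, ← mul_div_assoc, le_div_iff₀ (by positivity), one_mul]
  have h1 := hquarter.trans hsub
  have h2 := Nat.lt_floor_add_one M
  have h3 : M ≤ 4 * ∑ n ∈ Finset.Icc (-(N : ℤ)) N, phaseSum ξ ((n : ℝ) ^ 2 • α) := by linarith
  calc (2 * N + 1 : ℝ) ≤ 3 * N := by linarith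
    _ ≤ 3 * (K * M) := by gcongr
    _ ≤ 3 * (K * (4 * ∑ n ∈ Finset.Icc (-(N : ℤ)) N, phaseSum ξ ((n : ℝ) ^ 2 • α))) := by gcongr
    _ = _ := by ring

end HasGaussianGrowth

end Descent

section DualLattice

open scoped RealInnerProductSpace

/-- The parametrization of the dual lattice of `B·ℤ^d` by coordinate vectors. -/
noncomputable def dualHom {d : ℕ} (B : Matrix (Fin d) (Fin d) ℝ) :
    (Fin d → ℤ) →+ EuclideanSpace ℝ (Fin d) where
  toFun k := WithLp.toLp 2 (dualPt B k)
  map_zero' := by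
    ext i
    simp [dualPt, Matrix.mulVec, dotProduct]
  map_add' k l := by
    ext i
    simp [dualPt, Matrix.mulVec, dotProduct, mul_add, Finset.sum_add_distrib]

variable {d : ℕ} {B : Matrix (Fin d) (Fin d) ℝ}

theorem norm_dualHom_sq (k : Fin d → ℤ) : ‖dualHom B k‖ ^ 2 = normSq (dualPt B k) := by
  simp [dualHom, EuclideanSpace.norm_sq_eq, normSq]

theorem inner_dualHom_toLp (k : Fin d → ℤ) (x : Fin d → ℝ) :
    ⟪dualHom B k, WithLp.toLp 2 x⟫ = ∑ i, dualPt B k i * x i := by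
  simp [dualHom, PiLp.inner_apply, mul_comm]

theorem expNormSum_dualHom : expNormSum (dualHom B) π = latticeA B := by
  simp [expNormSum, latticeA, norm_dualHom_sq]

theorem phaseSum_dualHom (hB : B.det ≠ 0) (x : Fin d → ℝ) :
    phaseSum (dualHom B) (WithLp.toLp 2 x) =
      |B.det| * ∑' m : Fin d → ℤ, Real.exp (-π * normSq (fun i => x i - latticePt B m i)) := by
  rw [gaussian_poisson hB]
  simp only [phaseSum, norm_dualHom_sq, inner_dualHom_toLp]

theorem latticeF_eq_phaseAvg (hB : B.det ≠ 0) (α : Fin d → ℝ) (N : ℕ) :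
    latticeF B α N = phaseAvg (dualHom B) (WithLp.toLp 2 α) N := by
  have hcard : ((Finset.Icc (-(N : ℤ)) N).card : ℝ) = 2 * N + 1 := by
    rw [Int.card_Icc]
    have h : ((N : ℤ) + 1 - -(N : ℤ)).toNat = 2 * N + 1 := by omega
    rw [h]
    push_cast
    ring
  have h (n : ℤ) : phaseSum (dualHom B) ((n : ℝ) ^ 2 • WithLp.toLp 2 α) =
      |B.det| * ∑' m : Fin d → ℤ,
        Real.exp (-π * normSq (fun i => (n : ℝ) ^ 2 * α i - latticePt B m i)) := by
    rw [← WithLp.toLp_smul, phaseSum_dualHom hB]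
    rfl
  simp only [latticeF, phaseAvg, h, Nat.floor_natCast, Int.ceil_neg, Int.floor_natCast, hcard,
    Finset.mul_sum]

theorem abs_det_mul_tsum_latticePt (hB : B.det ≠ 0) :
    |B.det| * ∑' m : Fin d → ℤ, Real.exp (-π * normSq (latticePt B m)) = latticeA B := by
  have h := gaussian_poisson hB 0
  simpa [normSq, latticeA] using h

theorem dualPt_smul {t : ℝ} (ht : t ≠ 0) (hB : B.det ≠ 0) (k : Fin d → ℤ) :
    dualPt (t • B) k = t⁻¹ • dualPt B k := by
  have hinv : ((t • B).transpose)⁻¹ = t⁻¹ • (B.transpose)⁻¹ := by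
    refine Matrix.inv_eq_left_inv ?_
    rw [Matrix.transpose_smul, Matrix.smul_mul, Matrix.mul_smul, smul_smul, inv_mul_cancel₀ ht,
      one_smul, Matrix.nonsing_inv_mul _ (by simpa using hB)]
  rw [dualPt, hinv, Matrix.smul_mulVec, dualPt]

theorem normSq_smul (t : ℝ) (v : Fin d → ℝ) : normSq (t • v) = t ^ 2 * normSq v := by
  simp [normSq, mul_pow, Finset.mul_sum]

theorem hasGaussianGrowth_dualHom (hB : B.det ≠ 0) : HasGaussianGrowth (dualHom B) d where
  summable c hc := by simpa only [norm_dualHom_sq] using summable_exp_neg_mul_normSq_dualPt hB hc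
  expNormSum_le t ht := by
    have ht0 : 0 < t := by linarith
    have hdet : (t • B).det = t ^ d * B.det := by simp
    have htB : (t • B).det ≠ 0 := by rw [hdet]; positivity
    have hleft : expNormSum (dualHom B) (π / t ^ 2) = latticeA (t • B) := by
      refine tsum_congr fun k => ?_
      rw [norm_dualHom_sq, dualPt_smul ht0.ne' hB, normSq_smul]
      congr 1
      field_simp
    have hpt (m : Fin d → ℤ) : normSq (latticePt (t • B) m) = t ^ 2 * normSq (latticePt B m) := by
      rw [latticePt, Matrix.smul_mulVec, normSq_smul, latticePt]
    have hs {b : Matrix (Fin d) (Fin d) ℝ} (hb : b.det ≠ 0) :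
        Summable fun m : Fin d → ℤ => Real.exp (-π * normSq (latticePt b m)) :=
      summable_exp_neg_mul_normSq_mulVec hb Real.pi_pos
    rw [hleft, expNormSum_dualHom, ← abs_det_mul_tsum_latticePt htB,
      ← abs_det_mul_tsum_latticePt hB, hdet, abs_mul, abs_of_pos (pow_pos ht0 d), mul_assoc]
    refine mul_le_mul_of_nonneg_left (mul_le_mul_of_nonneg_left ?_ (abs_nonneg _)) (by positivity)
    refine (hs htB).tsum_le_tsum (fun m => Real.exp_le_exp.mpr ?_) (hs hB)
    have h := le_mul_of_one_le_left (normSq_nonneg (latticePt B m)) (one_le_pow₀ (n := 2) ht)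
    rw [hpt, neg_mul, neg_mul, neg_le_neg_iff]
    exact mul_le_mul_of_nonneg_left h Real.pi_pos.le

theorem one_le_latticeA (hB : B.det ≠ 0) : 1 ≤ latticeA B := by
  rw [← expNormSum_dualHom]
  exact (hasGaussianGrowth_dualHom hB).one_le_expNormSum Real.pi_pos

theorem phaseSum_dualHom_nonneg (hB : B.det ≠ 0) (x : EuclideanSpace ℝ (Fin d)) :
    0 ≤ phaseSum (dualHom B) x := by
  rw [show x = WithLp.toLp 2 (x.ofLp) from rfl, phaseSum_dualHom hB]
  positivity

theorem exp_pi_le : Real.exp π ≤ 24 := by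
  have h1 : π ≤ 3.15 := Real.pi_lt_d2.le
  have h2 : Real.exp 3.15 = Real.exp 1 ^ 3 * Real.exp 0.15 := by
    rw [← Real.exp_nat_mul, ← Real.exp_add]; norm_num
  have h3 : Real.exp 0.15 ≤ 1 / (1 - 0.15) := by
    have := Real.one_sub_le_exp_neg (0.15 : ℝ)
    rw [Real.exp_neg] at this
    rw [le_div_iff₀ (by norm_num)]
    have h := mul_le_mul_of_nonneg_left this (Real.exp_pos 0.15).le
    rwa [mul_inv_cancel₀ (Real.exp_pos _).ne'] at h
  have h4 : Real.exp 1 ^ 3 ≤ 2.7183 ^ 3 :=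
    pow_le_pow_left₀ (Real.exp_pos 1).le (by linarith [Real.exp_one_lt_d9]) 3
  calc Real.exp π ≤ Real.exp 3.15 := Real.exp_le_exp.mpr h1
    _ = Real.exp 1 ^ 3 * Real.exp 0.15 := h2
    _ ≤ 2.7183 ^ 3 * (1 / (1 - 0.15)) := by gcongr
    _ ≤ 24 := by norm_num

theorem one_le_mul_latticeF (hd : 0 < d) (hB : B.det ≠ 0) (α : Fin d → ℝ) {N : ℕ} (hN : 0 < N) :
    1 ≤ 12 * ((8 * 10 ^ 14 * (d * latticeA B) ^ 13) ^ d * latticeA B) * latticeF B α N := by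
  have hA := one_le_latticeA hB
  set A := latticeA B with hAdef
  set X : ℝ := d * A with hX
  have hd1 : (1 : ℝ) ≤ d := by exact_mod_cast hd
  have hAX : A ≤ X := le_mul_of_one_le_left (by linarith) hd1
  have hdX : (d : ℝ) ≤ X := le_mul_of_one_le_right (by linarith) hA
  have hX1 : 1 ≤ X := hA.trans hAX
  have hX0 : 0 < X := by linarith
  have hpi := Real.pi_lt_d2
  have hpow {n : ℕ} : A ^ n ≤ X ^ n := pow_le_pow_left₀ (by linarith) hAX n
  have key := (hasGaussianGrowth_dualHom hB).phaseAvg_lower_bound (R := 2 * X)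
    (δ := 1 / (128 * X ^ 2)) (τ := 2 * 10 ^ 8 * X ^ 8) (Q := 4 * 10 ^ 14 * X ^ 12)
    (by linarith) (by positivity) ?_ ?_ ?_ ?_ ?_ ?_ (phaseSum_dualHom_nonneg hB)
    (WithLp.toLp 2 α) hN
  · rw [← latticeF_eq_phaseAvg hB, expNormSum_dualHom, ← hAdef, finrank_euclideanSpace_fin,
      ← mul_assoc (_ ^ d), ← mul_pow] at key
    refine key.trans_eq ?_
    ring
  · rw [expNormSum_dualHom, ← hAdef]
    calc 2 * π * (2 * X) * (1 / (128 * X ^ 2)) * A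
        ≤ 2 * π * (2 * X) * (1 / (128 * X ^ 2)) * X := by gcongr
      _ = π / 32 := by field_simp; norm_num
      _ ≤ 1 / 8 := by linarith
  · rw [expNormSum_dualHom, ← hAdef]
    have h2 : (2 : ℝ) ^ d ≤ Real.exp X := by
      calc (2 : ℝ) ^ d ≤ Real.exp 1 ^ d :=
            pow_le_pow_left₀ (by norm_num) (by linarith [Real.exp_one_gt_d9]) d
        _ = Real.exp d := by rw [← Real.exp_nat_mul, mul_one]
        _ ≤ Real.exp X := Real.exp_le_exp.mpr hdX
    have h3 : A ≤ Real.exp X := by linarith [Real.add_one_le_exp X]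
    have h16 : Real.exp (-7) ≤ 1 / 16 := by
      have h : Real.exp (-7) = (Real.exp 7)⁻¹ := Real.exp_neg 7
      have h' : (16 : ℝ) ≤ Real.exp 7 := by
        have h7 : Real.exp 7 = Real.exp 1 ^ 7 := by rw [← Real.exp_nat_mul]; norm_num
        rw [h7]
        calc (16 : ℝ) ≤ 2 ^ 7 := by norm_num
          _ ≤ _ := pow_le_pow_left₀ (by norm_num) (by linarith [Real.exp_one_gt_d9]) 7
      rw [h, one_div]
      exact inv_anti₀ (by norm_num) h'
    calc Real.exp (-(3 * π / 4) * (2 * X) ^ 2) * (2 ^ d * A)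
        ≤ Real.exp (-(3 * π / 4) * (2 * X) ^ 2) * (Real.exp X * Real.exp X) := by gcongr
      _ = Real.exp (-(3 * π / 4) * (2 * X) ^ 2 + (X + X)) := by rw [Real.exp_add, Real.exp_add]
      _ ≤ Real.exp (-7) := by
          refine Real.exp_le_exp.mpr ?_
          nlinarith [mul_le_mul_of_nonneg_right Real.pi_gt_three.le (sq_nonneg X)]
      _ ≤ 1 / 16 := h16
  · have h : X ≤ X ^ 8 := le_self_pow₀ hX1 (by norm_num)
    nlinarith
  · rw [expNormSum_dualHom, ← hAdef]
    calc 2 * (2 * X) * (1200000 * (4 * A) ^ 12)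
        ≤ 2 * (2 * X) * (1200000 * (4 * X) ^ 12) := by gcongr
      _ = 4800000 * 4 ^ 12 * X ^ 13 := by ring
      _ ≤ 4 * 10 ^ 16 / 128 * X ^ 14 := by
          have h : X ^ 13 ≤ X ^ 14 := pow_le_pow_right₀ hX1 (by norm_num)
          nlinarith [pow_pos hX0 13]
      _ = 1 / (128 * X ^ 2) * (2 * 10 ^ 8 * X ^ 8) ^ 2 := by field_simp; norm_num
  · nlinarith [one_le_pow₀ hX1 (n := 12)]
  · rw [expNormSum_dualHom, ← hAdef]
    calc 562 * (4 * A) ^ 4 * (2 * 10 ^ 8 * X ^ 8) * Real.exp π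
        ≤ 562 * (4 * X) ^ 4 * (2 * 10 ^ 8 * X ^ 8) * 24 := by gcongr; exact exp_pi_le
      _ = 562 * 4 ^ 4 * 2 * 10 ^ 8 * 24 * X ^ 12 := by ring
      _ ≤ 8 * 10 ^ 14 * X ^ 13 := by
          have h : X ^ 12 ≤ X ^ 13 := pow_le_pow_right₀ hX1 (by norm_num)
          nlinarith [pow_pos hX0 12]
      _ = 4 * 10 ^ 14 * X ^ 12 * (2 * X) := by ring

theorem latticeF_lower_bound (hd : 0 < d) (hB : B.det ≠ 0) (α : Fin d → ℝ) {N : ℕ} (hN : 0 < N) :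
    1 / (12 * 2 ^ 50) * ((d : ℝ) ^ (63 * d))⁻¹ * (latticeA B ^ (63 * d))⁻¹ ≤ latticeF B α N := by
  have hA := one_le_latticeA hB
  have hF := one_le_mul_latticeF hd hB α hN
  have hd1 : (1 : ℝ) ≤ d := by exact_mod_cast hd
  have h2 : (2 : ℝ) ^ (50 * d) ≤ 2 ^ 50 * d ^ (50 * d) := by
    rcases Nat.lt_or_ge d 2 with h | h
    · obtain rfl : d = 1 := by omega
      norm_num
    · calc (2 : ℝ) ^ (50 * d) ≤ d ^ (50 * d) :=
            pow_le_pow_left₀ (by norm_num) (by exact_mod_cast h) _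
        _ ≤ 2 ^ 50 * d ^ (50 * d) := le_mul_of_one_le_left (by positivity) (by norm_num)
  have hbound : (8 * 10 ^ 14 * (d * latticeA B) ^ 13) ^ d * latticeA B ≤
      2 ^ 50 * d ^ (63 * d) * latticeA B ^ (63 * d) := by
    calc (8 * 10 ^ 14 * (d * latticeA B) ^ 13) ^ d * latticeA B
        ≤ (2 ^ 50 * (d * latticeA B) ^ 13) ^ d * latticeA B := by
          gcongr
          norm_num
      _ = 2 ^ (50 * d) * d ^ (13 * d) * latticeA B ^ (13 * d + 1) := by
          rw [mul_pow _ _ d, mul_pow _ _ 13, mul_pow _ _ d, ← pow_mul, ← pow_mul, ← pow_mul,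
            pow_succ]
          ring
      _ ≤ (2 ^ 50 * d ^ (50 * d)) * d ^ (13 * d) * latticeA B ^ (63 * d) := by
          gcongr
          omega
      _ = 2 ^ 50 * d ^ (63 * d) * latticeA B ^ (63 * d) := by
          rw [mul_assoc (2 ^ 50 : ℝ), ← pow_add, ← add_mul]
  have hF0 : 0 ≤ latticeF B α N := by
    rw [latticeF_eq_phaseAvg hB]
    exact div_nonneg (Finset.sum_nonneg fun _ _ => phaseSum_dualHom_nonneg hB _) (by positivity)
  have h := hF.trans (mul_le_mul_of_nonneg_right
    (mul_le_mul_of_nonneg_left hbound (by norm_num : (0 : ℝ) ≤ 12)) hF0)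
  rw [← mul_assoc, ← mul_assoc] at h
  have hx : 0 < (d : ℝ) ^ (63 * d) := by positivity
  have hy : 0 < latticeA B ^ (63 * d) := by positivity
  rw [← div_eq_mul_inv, ← div_eq_mul_inv, div_div, div_div, div_le_iff₀ (by positivity), mul_comm,
    ← mul_assoc]
  exact h

theorem latticeA_of_dim_zero (B : Matrix (Fin 0) (Fin 0) ℝ) : latticeA B = 1 := by
  simp [latticeA, normSq]

theorem latticeF_of_dim_zero (B : Matrix (Fin 0) (Fin 0) ℝ) (α : Fin 0 → ℝ) (N : ℕ) :
    latticeF B α N = 1 := by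
  have h : ((Finset.Icc ⌈-(N : ℝ)⌉ ⌊(N : ℝ)⌋).card : ℝ) ≠ 0 := by
    refine Nat.cast_ne_zero.mpr (Finset.card_ne_zero_of_mem (a := 0) ?_)
    rw [Finset.mem_Icc, Int.ceil_le, Int.le_floor]
    simp
  unfold latticeF normSq
  simpa [-Int.card_Icc] using div_self h

end DualLattice

/-- **Lower bound for `F_{Λ,α}`.** There are absolute constants `c, C > 0` such that for
any full-rank lattice `Λ = B·ℤ^d` with `det Λ ≥ 1`, any `α ∈ ℝ^d` and any integer `N ≥ 1`,
`F_{Λ,α}(N) ≥ c · d^{-Cd} · A_Λ^{-Cd}`. -/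
theorem stmt_19 :
    ∃ c C : ℝ, 0 < c ∧ 0 < C ∧
      ∀ (d : ℕ) (B : Matrix (Fin d) (Fin d) ℝ), B.det ≠ 0 → 1 ≤ |B.det| →
        ∀ (α : Fin d → ℝ) (N : ℕ), 0 < N →
          latticeF B α N ≥
            c * (d : ℝ) ^ (-(C * d)) * latticeA B ^ (-(C * d)) := by
  refine ⟨1 / (12 * 2 ^ 50), 63, by norm_num, by norm_num, fun d B hB _ α N hN => ?_⟩
  rcases Nat.eq_zero_or_pos d with rfl | hd
  · rw [latticeF_of_dim_zero, latticeA_of_dim_zero]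
    norm_num
  · have hcast : -((63 : ℝ) * d) = -((63 * d : ℕ) : ℝ) := by push_cast; ring
    have hA := one_le_latticeA hB
    rw [hcast, Real.rpow_neg (by positivity), Real.rpow_neg (by linarith), Real.rpow_natCast,
      Real.rpow_natCast]
    exact latticeF_lower_bound hd hB α hN
end
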